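/- Let d ≥ 2 and let Q ⊂ ℝ^d be the open cube with unit side centered at the origin. There exist a velocity field u ∈ C^∞([0,∞) × ℝ^d; ℝ^d) and a nontrivial solution ρ ∈ C^∞([0,∞) × ℝ^d) of the continuity equation ∂_t ρ + div(u ρ) = 0 such that: (i) u(t,·) is bounded, divergence-free, and compactly supported in Q for every t; (ii) ρ(t,·) has zero average and is bounded and compactly supported in Q for every t; (iii) u(t,·) is Lipschitz continuous uniformly in time; (iv) for every r ≥ 0 and 1 < p < ∞ there exist constants b > 0 and B_r > 0 such that ‖u(t,·)‖_{Ẇ^{r,p}(ℝ^d)} ≤ B_r exp((r−1) b t) for all t ≥ 0; (v) for every 0 < s < 2 there exist constants c > 0 and Ĉ_s > 0 such that ‖ρ(t,·)‖_{Ḣ^{−s}(ℝ^d)} ≤ Ĉ_s exp(−s c t) for all t ≥ 0. -/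

import Mathlib

open MeasureTheory Filter Real Set
open scoped FourierTransform ENNReal NNReal Topology

noncomputable section

/-- Euclidean space `ℝ^d`. -/
abbrev Euc (d : ℕ) := EuclideanSpace ℝ (Fin d)

/-- Square of the homogeneous Sobolev norm `‖f‖_{Ḣ^s}² = ∫ |ξ|^{2s} |𝓕f(ξ)|² dξ`,
with values in `ℝ≥0∞`. -/
def hsNormSqE (d : ℕ) (s : ℝ) (f : Euc d → ℂ) : ℝ≥0∞ :=
  ∫⁻ ξ : Euc d, ENNReal.ofReal (‖ξ‖ ^ (2 * s)) * (‖𝓕 f ξ‖₊ : ℝ≥0∞) ^ (2 : ℕ)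

/-- Membership in the homogeneous Sobolev space `Ḣ^s(ℝ^d)`:
the Fourier transform is locally integrable and the weighted square integral is finite. -/
def MemHs (d : ℕ) (s : ℝ) (f : Euc d → ℂ) : Prop :=
  LocallyIntegrable (𝓕 f) volume ∧ hsNormSqE d s f < ⊤

/-- Homogeneous Sobolev norm `‖f‖_{Ẇ^{s,p}}`: the `L^p` norm of `𝓕⁻¹(|ξ|^s 𝓕f(ξ))`. -/
def wspNormE (d : ℕ) (s p : ℝ) (f : Euc d → ℂ) : ℝ≥0∞ :=
  eLpNorm (𝓕⁻ (fun ξ : Euc d => (‖ξ‖ ^ s : ℝ) • 𝓕 f ξ)) (ENNReal.ofReal p) volume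

/-- `Ẇ^{s,p}` norm of a vector field, defined componentwise. -/
def wspNormVecE (d : ℕ) (s p : ℝ) (w : Euc d → Euc d) : ℝ≥0∞ :=
  ∑ i : Fin d, wspNormE d s p (fun x => (w x i : ℂ))

/-- A vector field is divergence-free in the sense of distributions. -/
def WeakDivFree (d : ℕ) (w : Euc d → Euc d) : Prop :=
  ∀ ψ : Euc d → ℝ, ContDiff ℝ (⊤ : ℕ∞) ψ → HasCompactSupport ψ →
    ∫ x : Euc d, fderiv ℝ ψ x (w x) = 0

/-- `∂_t ρ + div(u ρ) = 0` in the sense of distributions on `(0,∞) × ℝ^d`: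
for every smooth compactly supported test function `φ` with support in `{t > 0}`,
`∫∫ (ρ ∂_t φ + ρ u · ∇φ) dx dt = 0`. -/
def IsWeakSol (d : ℕ) (u : ℝ → Euc d → Euc d) (ρ : ℝ → Euc d → ℝ) : Prop :=
  ∀ φ : ℝ × Euc d → ℝ, ContDiff ℝ (⊤ : ℕ∞) φ → HasCompactSupport φ →
    tsupport φ ⊆ {q : ℝ × Euc d | 0 < q.1} →
    ∫ q : ℝ × Euc d,
      ρ q.1 q.2 * (fderiv ℝ φ q (1, 0) + fderiv ℝ φ q (0, u q.1 q.2)) = 0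

/-- Homogeneous Sobolev norm `‖f‖_{Ḣ^s}`, valued in `ℝ≥0∞`. -/
def hsNormE (d : ℕ) (s : ℝ) (f : Euc d → ℂ) : ℝ≥0∞ :=
  (hsNormSqE d s f) ^ (1/2 : ℝ)

/-- The open cube of unit side centered at the origin of `ℝ^d`. -/
def unitCube (d : ℕ) : Set (Euc d) := {x : Euc d | ∀ i : Fin d, |x i| < 1/2}

namespace Mixer

open scoped ContDiff ComplexConjugate

/-! ### A smooth softplus function, a smooth step and a smooth cap -/

/-- An even bump of total mass one supported in `[-1, 1]` and bounded by one. -/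
def kernelBump : ContDiffBump (0 : ℝ) := ⟨1 / 2, 1, by norm_num, by norm_num⟩

/-- The density of `softplus'`. -/
def spDensity (z : ℝ) : ℝ := kernelBump.normed volume z

lemma spDensity_contDiff : ContDiff ℝ ∞ spDensity := kernelBump.contDiff_normed

lemma spDensity_nonneg (z : ℝ) : 0 ≤ spDensity z := kernelBump.nonneg_normed z

lemma spDensity_le_one (z : ℝ) : spDensity z ≤ 1 := by
  have h := kernelBump.normed_le_div_measure_closedBall_rIn (μ := (volume : Measure ℝ)) z
  have h2 : kernelBump.rIn = 1 / 2 := rfl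
  rw [h2, Measure.real, Real.volume_closedBall] at h
  norm_num at h
  exact h

lemma spDensity_neg (z : ℝ) : spDensity (-z) = spDensity z := kernelBump.normed_neg z

lemma spDensity_eq_zero {z : ℝ} (h : 1 ≤ |z|) : spDensity z = 0 := by
  have := kernelBump.support_normed_eq (μ := (volume : Measure ℝ))
  by_contra hne
  have hz : z ∈ Function.support (kernelBump.normed volume) := hne
  rw [this, Metric.mem_ball, dist_zero_right, Real.norm_eq_abs] at hz
  exact absurd hz (not_lt.2 h)

/-- The derivative of `softplus`. -/
def sp' (z : ℝ) : ℝ := ∫ x in (-1)..z, spDensity x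

lemma hasDerivAt_sp' (z : ℝ) : HasDerivAt sp' (spDensity z) z :=
  spDensity_contDiff.continuous.integral_hasStrictDerivAt _ z |>.hasDerivAt

lemma sp'_contDiff : ContDiff ℝ ∞ sp' := by
  rw [contDiff_infty_iff_deriv]
  refine ⟨fun z => (hasDerivAt_sp' z).differentiableAt, ?_⟩
  have : deriv sp' = spDensity := funext fun z => (hasDerivAt_sp' z).deriv
  rw [this]; exact spDensity_contDiff

lemma sp'_mono : Monotone sp' :=
  monotone_of_hasDerivAt_nonneg hasDerivAt_sp' spDensity_nonneg

lemma sp'_of_le {z : ℝ} (h : z ≤ -1) : sp' z = 0 := by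
  unfold sp'
  rw [intervalIntegral.integral_symm, neg_eq_zero]
  apply intervalIntegral.integral_zero_ae
  refine Eventually.of_forall fun x hx => ?_
  rw [uIoc_of_le h] at hx
  apply spDensity_eq_zero
  rw [abs_of_nonpos (by linarith [hx.2])]; linarith [hx.2]

lemma sp'_of_ge {z : ℝ} (h : 1 ≤ z) : sp' z = 1 := by
  unfold sp'
  have h1 := kernelBump.integral_normed (μ := (volume : Measure ℝ))
  rw [intervalIntegral.integral_eq_integral_of_support_subset, ← h1]
  · rfl
  · intro x hx
    have : ¬ 1 ≤ |x| := fun hc => hx (spDensity_eq_zero hc)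
    rw [not_le, abs_lt] at this
    exact ⟨this.1, by linarith [this.2]⟩

lemma sp'_nonneg (z : ℝ) : 0 ≤ sp' z := by
  rcases le_total z (-1) with h | h
  · rw [sp'_of_le h]
  · rw [← sp'_of_le (le_refl (-1))]; exact sp'_mono h

lemma sp'_le_one (z : ℝ) : sp' z ≤ 1 := by
  rcases le_total 1 z with h | h
  · rw [sp'_of_ge h]
  · rw [← sp'_of_ge (le_refl 1)]; exact sp'_mono h

lemma sp'_add_neg (z : ℝ) : sp' z + sp' (-z) = 1 := by
  have hd : ∀ x, HasDerivAt (fun z => sp' z + sp' (-z)) 0 x := by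
    intro x
    have h := (hasDerivAt_sp' x).add ((hasDerivAt_sp' (-x)).comp x (hasDerivAt_neg x))
    rw [spDensity_neg] at h
    exact h.congr_deriv (by ring)
  have := is_const_of_deriv_eq_zero (fun x => (hd x).differentiableAt)
    (fun x => (hd x).deriv) z 1
  rw [this, sp'_of_ge le_rfl, sp'_of_le le_rfl, add_zero]

/-- A smooth approximation of the positive part. -/
def sp (z : ℝ) : ℝ := ∫ x in (-1)..z, sp' x

lemma hasDerivAt_sp (z : ℝ) : HasDerivAt sp (sp' z) z :=
  sp'_contDiff.continuous.integral_hasStrictDerivAt _ z |>.hasDerivAt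

lemma sp_contDiff : ContDiff ℝ ∞ sp := by
  rw [contDiff_infty_iff_deriv]
  refine ⟨fun z => (hasDerivAt_sp z).differentiableAt, ?_⟩
  have : deriv sp = sp' := funext fun z => (hasDerivAt_sp z).deriv
  rw [this]; exact sp'_contDiff

lemma sp_of_le {z : ℝ} (h : z ≤ -1) : sp z = 0 := by
  unfold sp
  rw [intervalIntegral.integral_symm, neg_eq_zero]
  apply intervalIntegral.integral_zero_ae
  refine Eventually.of_forall fun x hx => ?_
  rw [uIoc_of_le h] at hx
  exact sp'_of_le hx.2

lemma sp_sub_neg (z : ℝ) : sp z - sp (-z) = z := by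
  have hd : ∀ x, HasDerivAt (fun z => sp z - sp (-z) - z) 0 x := by
    intro x
    have h := ((hasDerivAt_sp x).sub
      ((hasDerivAt_sp (-x)).comp x (hasDerivAt_neg x))).sub (hasDerivAt_id x)
    exact h.congr_deriv (by linarith [sp'_add_neg x])
  have := is_const_of_deriv_eq_zero (fun x => (hd x).differentiableAt)
    (fun x => (hd x).deriv) z 0
  simp only [neg_zero, sub_self] at this
  linarith

lemma sp_of_ge {z : ℝ} (h : 1 ≤ z) : sp z = z := by
  have := sp_sub_neg z
  rw [sp_of_le (by linarith : -z ≤ -1)] at this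
  linarith

lemma sp_mono : Monotone sp :=
  monotone_of_hasDerivAt_nonneg hasDerivAt_sp sp'_nonneg

lemma sp_nonneg (z : ℝ) : 0 ≤ sp z := by
  rcases le_total z (-1) with h | h
  · rw [sp_of_le h]
  · rw [← sp_of_le (le_refl (-1))]; exact sp_mono h

lemma sp_le_one {z : ℝ} (h : z ≤ 1) : sp z ≤ 1 := by
  rw [← sp_of_ge (le_refl 1)]; exact sp_mono h

/-- A smooth step, `0` for `t ≤ 1/4` and `1` for `t ≥ 3/4`. -/
def stepη (t : ℝ) : ℝ := Real.smoothTransition (2 * t - 1 / 2)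

lemma stepη_contDiff : ContDiff ℝ ∞ stepη := by
  unfold stepη
  exact Real.smoothTransition.contDiff.comp ((contDiff_const.mul contDiff_id).sub contDiff_const)

lemma stepη_nonneg (t : ℝ) : 0 ≤ stepη t := Real.smoothTransition.nonneg _

lemma stepη_le_one (t : ℝ) : stepη t ≤ 1 := Real.smoothTransition.le_one _

lemma stepη_of_le {t : ℝ} (h : t ≤ 1 / 4) : stepη t = 0 :=
  Real.smoothTransition.zero_of_nonpos (by linarith)

lemma stepη_of_ge {t : ℝ} (h : 3 / 4 ≤ t) : stepη t = 1 :=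
  Real.smoothTransition.one_of_one_le (by linarith)

/-- A smooth odd-type cap of the identity: `c` for `|c| ≤ 1`, with values in `[-2, 2]`. -/
def cap (c : ℝ) : ℝ := c - sp (c - 2) + sp (-c - 2)

/-- The derivative of `cap`. -/
def cap' (c : ℝ) : ℝ := 1 - sp' (c - 2) - sp' (-c - 2)

lemma hasDerivAt_cap (c : ℝ) : HasDerivAt cap (cap' c) c := by
  have h1 := (hasDerivAt_sp (c - 2)).comp c ((hasDerivAt_id c).sub_const 2)
  have h2 := (hasDerivAt_sp (-c - 2)).comp c ((hasDerivAt_neg c).sub_const 2)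
  exact (((hasDerivAt_id c).sub h1).add h2).congr_deriv (by unfold cap'; ring)

lemma cap_contDiff : ContDiff ℝ ∞ cap := by
  unfold cap
  exact (contDiff_id.sub (sp_contDiff.comp (contDiff_id.sub contDiff_const))).add
    (sp_contDiff.comp (contDiff_neg.sub contDiff_const))

lemma cap'_nonneg (c : ℝ) : 0 ≤ cap' c := by
  unfold cap'
  rcases le_total 0 c with h | h
  · rw [sp'_of_le (by linarith : -c - 2 ≤ -1)]; linarith [sp'_le_one (c - 2)]
  · rw [sp'_of_le (by linarith : c - 2 ≤ -1)]; linarith [sp'_le_one (-c - 2)]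

lemma cap'_le_one (c : ℝ) : cap' c ≤ 1 := by
  unfold cap'; linarith [sp'_nonneg (c - 2), sp'_nonneg (-c - 2)]

lemma cap_of_abs_le {c : ℝ} (h : |c| ≤ 1) : cap c = c := by
  rw [abs_le] at h
  unfold cap
  rw [sp_of_le (by linarith), sp_of_le (by linarith)]; ring

lemma abs_cap_le (c : ℝ) : |cap c| ≤ 2 := by
  have hm : Monotone cap := monotone_of_hasDerivAt_nonneg hasDerivAt_cap cap'_nonneg
  have hu : ∀ c, 3 ≤ c → cap c = 2 := fun c h => by
    unfold cap; rw [sp_of_ge (by linarith), sp_of_le (by linarith)]; ring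
  have hl : ∀ c, c ≤ -3 → cap c = -2 := fun c h => by
    unfold cap; rw [sp_of_le (by linarith), sp_of_ge (by linarith)]; ring
  rw [abs_le]
  constructor
  · rw [← hl (min c (-3)) (min_le_right _ _)]; exact hm (min_le_left _ _)
  · rw [← hu (max c 3) (le_max_right _ _)]; exact hm (le_max_left _ _)

/-- The cap at scale `a`. -/
def capAt (a c : ℝ) : ℝ := a * cap (c / a)

lemma capAt_contDiff (a : ℝ) : ContDiff ℝ ∞ (capAt a) :=
  contDiff_const.mul (cap_contDiff.comp (contDiff_id.div_const a))

lemma hasDerivAt_capAt {a : ℝ} (ha : 0 < a) (c : ℝ) : HasDerivAt (capAt a) (cap' (c / a)) c := by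
  have := ((hasDerivAt_cap (c / a)).comp c ((hasDerivAt_id c).div_const a)).const_mul a
  exact this.congr_deriv (by field_simp)

lemma capAt_of_abs_le {a c : ℝ} (ha : 0 < a) (h : |c| ≤ a) : capAt a c = c := by
  unfold capAt
  rw [cap_of_abs_le]
  · field_simp
  · rw [abs_div, abs_of_pos ha]; exact (div_le_one ha).2 h

lemma abs_capAt_le {a : ℝ} (ha : 0 < a) (c : ℝ) : |capAt a c| ≤ 2 * a := by
  unfold capAt
  rw [abs_mul, abs_of_pos ha]
  nlinarith [abs_cap_le (c / a)]

/-! ### Smooth inverses of monotone families -/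

/-- A smooth family of increasing surjections has a jointly smooth inverse. -/
lemma exists_smooth_inverse {P : Type*} [NormedAddCommGroup P] [NormedSpace ℝ P] [CompleteSpace P]
    (Φ Φ' : P → ℝ → ℝ) (hΦ : ContDiff ℝ ∞ fun q : P × ℝ => Φ q.1 q.2)
    (hd : ∀ p c, HasDerivAt (Φ p) (Φ' p c) c) (hpos : ∀ p c, 0 < Φ' p c)
    (hsurj : ∀ p, Function.Surjective (Φ p)) :
    ∃ Λ : P → ℝ → ℝ, ContDiff ℝ ∞ (fun q : P × ℝ => Λ q.1 q.2) ∧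
      ∀ p x c, Λ p x = c ↔ Φ p c = x := by
  have hmono : ∀ p, StrictMono (Φ p) := fun p =>
    strictMono_of_hasDerivAt_pos (hd p) (hpos p)
  let F : P × ℝ → P × ℝ := fun q => (q.1, Φ q.1 q.2)
  have hF : ContDiff ℝ ∞ F := contDiff_fst.prodMk hΦ
  have hbij : Function.Bijective F := by
    constructor
    · rintro ⟨p, c⟩ ⟨p', c'⟩ h
      simp only [F, Prod.mk.injEq] at h
      obtain ⟨rfl, h⟩ := h
      rw [(hmono p).injective h]
    · rintro ⟨p, x⟩
      obtain ⟨c, hc⟩ := hsurj p x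
      exact ⟨(p, c), by simp [F, hc]⟩
  -- the partial derivative
  have hpart : ∀ q : P × ℝ, fderiv ℝ (fun q : P × ℝ => Φ q.1 q.2) q (0, 1) = Φ' q.1 q.2 := by
    rintro ⟨p, c⟩
    have h1 := (hΦ.differentiable (by simp) (p, c)).hasFDerivAt
    have h2 : HasDerivAt (fun c : ℝ => ((p, c) : P × ℝ)) (0, 1) c :=
      (hasDerivAt_const c p).prodMk (hasDerivAt_id c)
    exact (h1.comp_hasDerivAt c h2).unique (hd p c)
  let B : P × ℝ → ((P × ℝ) →L[ℝ] ℝ) := fun q => fderiv ℝ (fun q : P × ℝ => Φ q.1 q.2) q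
  have hB : ∀ q (v : P × ℝ), B q v = B q (v.1, 0) + v.2 * Φ' q.1 q.2 := by
    intro q v
    rw [← hpart q]
    have : v = (v.1, 0) + v.2 • ((0 : P), (1 : ℝ)) := by ext <;> simp
    conv_lhs => rw [this]
    rw [map_add, map_smul, smul_eq_mul]
  let e : P × ℝ → ((P × ℝ) ≃L[ℝ] (P × ℝ)) := fun q =>
    ContinuousLinearEquiv.equivOfInverse
      ((ContinuousLinearMap.fst ℝ P ℝ).prod (B q))
      ((ContinuousLinearMap.fst ℝ P ℝ).prod ((Φ' q.1 q.2)⁻¹ •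
        (ContinuousLinearMap.snd ℝ P ℝ -
          (B q).comp ((ContinuousLinearMap.inl ℝ P ℝ).comp (ContinuousLinearMap.fst ℝ P ℝ)))))
      (by
        intro v
        have := (hpos q.1 q.2).ne'
        ext
        · simp
        · simp [hB q v]
          field_simp)
      (by
        intro v
        have := (hpos q.1 q.2).ne'
        ext
        · simp
        · simp only [ContinuousLinearMap.prod_apply, ContinuousLinearMap.coe_fst']
          rw [hB]
          simp
          field_simp
          ring)
  have hFd : ∀ q, HasStrictFDerivAt F (e q : (P × ℝ) →L[ℝ] (P × ℝ)) q := by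
    intro q
    have h1 := (hΦ.contDiffAt (x := q)).hasStrictFDerivAt (by simp)
    exact hasStrictFDerivAt_fst.prodMk h1
  have hopen : IsOpenMap F := isOpenMap_of_hasStrictFDerivAt_equiv hFd
  let H : P × ℝ ≃ₜ P × ℝ :=
    (Equiv.ofBijective F hbij).toHomeomorphOfContinuousOpen hF.continuous hopen
  have hHs : ContDiff ℝ ∞ H.symm :=
    H.contDiff_symm (f₀' := e) (fun a => (hFd a).hasFDerivAt) hF
  have hfst : ∀ q, (H.symm q).1 = q.1 := by
    intro q
    have : F (H.symm q) = q := H.apply_symm_apply q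
    have h2 : (F (H.symm q)).1 = q.1 := by rw [this]
    exact h2
  have hsnd : ∀ q, Φ q.1 (H.symm q).2 = q.2 := by
    intro q
    have h : F (H.symm q) = q := H.apply_symm_apply q
    have h2 : Φ (H.symm q).1 (H.symm q).2 = q.2 := by
      have h3 : (F (H.symm q)).2 = q.2 := by rw [h]
      exact h3
    rwa [hfst] at h2
  refine ⟨fun p x => (H.symm (p, x)).2, hHs.snd, fun p x c => ?_⟩
  constructor
  · rintro rfl; exact hsnd (p, x)
  · intro h
    exact (hmono p).injective (by rw [hsnd (p, x), h])

/-! ### Strips described by generating functions -/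

/-- Half-width of the strips, measured in levels. -/
def wid : ℝ := 1 / 1000

/-- Margin used for all separation conditions. -/
def mrg : ℝ := 1 / 500

/-- The part of the triangle on one side of the level `c`. -/
def areaFn (c : ℝ) : ℝ := 1 / 4 + 7 / 10 * c

/-- A moving strip in the chamber `0 ≤ y ≤ x`, entering through the diagonal and leaving through
the horizontal axis. The level curves are `x = G (t, y, c)` where `G = ∂_y A`. -/
structure Strip where
  A : ℝ × ℝ × ℝ → ℝ
  G : ℝ × ℝ × ℝ → ℝ
  G' : ℝ × ℝ × ℝ → ℝ
  leg : ℝ → ℝ → ℝ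
  leg' : ℝ → ℝ → ℝ
  hyp : ℝ → ℝ → ℝ
  hyp' : ℝ → ℝ → ℝ
  Z : ℝ → ℝ
  smooth : ContDiff ℝ ∞ A
  hasDerivAt_A : ∀ t y c, HasDerivAt (fun y => A (t, y, c)) (G (t, y, c)) y
  hasDerivAt_G : ∀ t y c, |c| ≤ 2 * wid → HasDerivAt (fun c => G (t, y, c)) (G' (t, y, c)) c
  G'_pos : ∀ t y c, |c| ≤ 2 * wid → 0 < G' (t, y, c)
  hasDerivAt_leg : ∀ t c, HasDerivAt (fun t => leg t c) (leg' t c) t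
  hasDerivAt_hyp : ∀ t c, HasDerivAt (fun t => hyp t c) (hyp' t c) t
  Z_cont : Continuous Z
  A_leg : ∀ t y c, |c| ≤ wid → y ≤ mrg → A (t, y, c) = y * leg t c
  A_hyp : ∀ t y c, |c| ≤ wid → Z t ≤ y → A (t, y, c) = areaFn c + y ^ 2 / 2 - (y - hyp t c) ^ 2
  G_low : ∀ t y c, |c| ≤ wid → y ≤ Z t → y + mrg ≤ G (t, y, c)
  G_up : ∀ t y c, |c| ≤ wid → 0 ≤ y → G (t, y, c) ≤ 1 - mrg
  Z_le : ∀ t c, |c| ≤ wid → Z t + mrg ≤ hyp t c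
  leg_low : ∀ t c, |c| ≤ wid → 1 / 10 ≤ leg t c

lemma wid_pos : 0 < wid := by norm_num [wid]
lemma mrg_pos : 0 < mrg := by norm_num [mrg]

namespace Strip

variable (S : Strip)

lemma G_eq_fderiv (q : ℝ × ℝ × ℝ) : S.G q = fderiv ℝ S.A q (0, 1, 0) := by
  obtain ⟨t, y, c⟩ := q
  have h1 := (S.smooth.differentiable (by simp) (t, y, c)).hasFDerivAt
  have h2 : HasDerivAt (fun y : ℝ => ((t, y, c) : ℝ × ℝ × ℝ)) (0, 1, 0) y :=
    (hasDerivAt_const y t).prodMk ((hasDerivAt_id y).prodMk (hasDerivAt_const y c))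
  exact (S.hasDerivAt_A t y c).unique (h1.comp_hasDerivAt y h2)

lemma fderiv_smooth (v : ℝ × ℝ × ℝ) : ContDiff ℝ ∞ fun q => fderiv ℝ S.A q v :=
  (S.smooth.fderiv_right (m := ∞) (by simp)).clm_apply contDiff_const

lemma G_smooth : ContDiff ℝ ∞ S.G := by
  have : S.G = fun q => fderiv ℝ S.A q (0, 1, 0) := funext S.G_eq_fderiv
  rw [this]; exact S.fderiv_smooth _

/-- The time derivative of the generating function. -/
def Ψ (q : ℝ × ℝ × ℝ) : ℝ := fderiv ℝ S.A q (1, 0, 0)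

lemma Ψ_smooth : ContDiff ℝ ∞ S.Ψ := S.fderiv_smooth _

lemma fderiv_Ψ_eq (q : ℝ × ℝ × ℝ) :
    fderiv ℝ S.Ψ q (0, 1, 0) = fderiv ℝ S.G q (1, 0, 0) := by
  have hG : S.G = fun q => fderiv ℝ S.A q (0, 1, 0) := funext S.G_eq_fderiv
  have hdd : DifferentiableAt ℝ (fderiv ℝ S.A) q :=
    (S.smooth.fderiv_right (m := 1) (by norm_cast)).differentiable (by simp) q
  have h1 : ∀ v w, fderiv ℝ (fun q => fderiv ℝ S.A q v) q w = fderiv ℝ (fderiv ℝ S.A) q w v := by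
    intro v w
    rw [fderiv_clm_apply hdd (differentiableAt_const v)]
    simp
  have hs : IsSymmSndFDerivAt ℝ S.A q :=
    ((contDiff_infty.1 S.smooth 2).contDiffAt (x := q)).isSymmSndFDerivAt (by simp)
  rw [hG]
  show fderiv ℝ (fun q => fderiv ℝ S.A q (1, 0, 0)) q (0, 1, 0) = _
  rw [h1, h1]
  exact hs.eq _ _

lemma hasDerivAt_time (t y c : ℝ) : HasDerivAt (fun t => S.A (t, y, c)) (S.Ψ (t, y, c)) t := by
  have h1 := (S.smooth.differentiable (by simp) (t, y, c)).hasFDerivAt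
  have h2 : HasDerivAt (fun t : ℝ => ((t, y, c) : ℝ × ℝ × ℝ)) (1, 0, 0) t :=
    (hasDerivAt_id t).prodMk ((hasDerivAt_const t y).prodMk (hasDerivAt_const t c))
  exact h1.comp_hasDerivAt t h2

lemma G_leg {t y c : ℝ} (hc : |c| ≤ wid) (hy : y < mrg) : S.G (t, y, c) = S.leg t c := by
  have h : (fun y => S.A (t, y, c)) =ᶠ[𝓝 y] fun y => y * S.leg t c := by
    filter_upwards [Iio_mem_nhds hy] with y' hy'
    exact S.A_leg t y' c hc (le_of_lt hy')
  have h2 := ((hasDerivAt_id y).mul_const (S.leg t c)).congr_of_eventuallyEq h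
  simpa using (S.hasDerivAt_A t y c).unique h2

lemma Ψ_leg {t y c : ℝ} (hc : |c| ≤ wid) (hy : y ≤ mrg) : S.Ψ (t, y, c) = y * S.leg' t c := by
  have h : (fun t => S.A (t, y, c)) = fun t => y * S.leg t c :=
    funext fun t => S.A_leg t y c hc hy
  have h1 := S.hasDerivAt_time t y c
  rw [h] at h1
  exact h1.unique ((S.hasDerivAt_leg t c).const_mul y)

lemma G_hyp {t y c : ℝ} (hc : |c| ≤ wid) (hy : S.Z t < y) :
    S.G (t, y, c) = 2 * S.hyp t c - y := by
  have h : (fun y => S.A (t, y, c)) =ᶠ[𝓝 y]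
      fun y => areaFn c + y ^ 2 / 2 - (y - S.hyp t c) ^ 2 := by
    filter_upwards [Ioi_mem_nhds hy] with y' hy'
    exact S.A_hyp t y' c hc (le_of_lt hy')
  have h2 : HasDerivAt (fun y => areaFn c + y ^ 2 / 2 - (y - S.hyp t c) ^ 2)
      (2 * S.hyp t c - y) y := by
    have := ((((hasDerivAt_id y).pow 2).div_const 2).const_add (areaFn c)).sub
      (((hasDerivAt_id y).sub_const (S.hyp t c)).pow 2)
    exact this.congr_deriv (by simp; ring)
  exact (S.hasDerivAt_A t y c).unique (h2.congr_of_eventuallyEq h)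

lemma Ψ_hyp {t y c : ℝ} (hc : |c| ≤ wid) (hy : S.Z t < y) :
    S.Ψ (t, y, c) = 2 * (y - S.hyp t c) * S.hyp' t c := by
  have h : (fun t => S.A (t, y, c)) =ᶠ[𝓝 t]
      fun t => areaFn c + y ^ 2 / 2 - (y - S.hyp t c) ^ 2 := by
    filter_upwards [S.Z_cont.continuousAt.eventually (Iio_mem_nhds hy)] with t' ht'
    exact S.A_hyp t' y c hc (le_of_lt ht')
  have h2 : HasDerivAt (fun t => areaFn c + y ^ 2 / 2 - (y - S.hyp t c) ^ 2)
      (2 * (y - S.hyp t c) * S.hyp' t c) t := by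
    have := (((S.hasDerivAt_hyp t c).const_sub y).pow 2).const_sub (areaFn c + y ^ 2 / 2)
    exact this.congr_deriv (by simp)
  exact (S.hasDerivAt_time t y c).unique (h2.congr_of_eventuallyEq h)

lemma exists_level : ∃ Λ : ℝ × ℝ → ℝ → ℝ, ContDiff ℝ ∞ (fun q : (ℝ × ℝ) × ℝ => Λ q.1 q.2) ∧
    ∀ p x c, Λ p x = c ↔ S.G (p.1, p.2, capAt wid c) + c - capAt wid c = x := by
  have hw := wid_pos
  have hT := capAt_contDiff wid
  refine exists_smooth_inverse (fun (p : ℝ × ℝ) c => S.G (p.1, p.2, capAt wid c) + c - capAt wid c)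
    (fun p c => S.G' (p.1, p.2, capAt wid c) * cap' (c / wid) + 1 - cap' (c / wid)) ?_ ?_ ?_ ?_
  · have hcap : ContDiff ℝ ∞ fun q : (ℝ × ℝ) × ℝ => capAt wid q.2 := hT.comp contDiff_snd
    exact ((S.G_smooth.comp (contDiff_fst.fst.prodMk (contDiff_fst.snd.prodMk hcap))).add
      contDiff_snd).sub hcap
  · intro p c
    have h1 := (S.hasDerivAt_G p.1 p.2 (capAt wid c) (abs_capAt_le hw c)).comp c
      (hasDerivAt_capAt hw c)
    exact ((h1.add (hasDerivAt_id c)).sub (hasDerivAt_capAt hw c))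
  · intro p c
    have h1 := S.G'_pos p.1 p.2 (capAt wid c) (abs_capAt_le hw c)
    have h2 := cap'_nonneg (c / wid)
    have h3 := cap'_le_one (c / wid)
    rcases h2.eq_or_lt with h | h
    · rw [← h]; norm_num
    · have := mul_pos h1 h
      linarith
  · intro p x
    have hcont : Continuous fun c => S.G (p.1, p.2, capAt wid c) + c - capAt wid c := by
      have := S.G_smooth.continuous
      have := hT.continuous
      fun_prop
    obtain ⟨M, hM⟩ : ∃ M, ∀ c, |S.G (p.1, p.2, capAt wid c)| ≤ M := by
      have hc : ContinuousOn (fun c => S.G (p.1, p.2, c)) (Icc (-(2 * wid)) (2 * wid)) := by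
        have := S.G_smooth.continuous
        fun_prop
      obtain ⟨M, hM⟩ := isCompact_Icc.exists_bound_of_continuousOn hc
      refine ⟨M, fun c => hM _ ?_⟩
      exact abs_le.1 (abs_capAt_le hw c)
    have hM' := fun c => abs_le.1 (hM c)
    have hc' := fun c => abs_le.1 (abs_capAt_le hw c)
    have hbot : Tendsto (fun c => S.G (p.1, p.2, capAt wid c) + c - capAt wid c) atBot atBot := by
      refine tendsto_atBot_mono (fun c => ?_) (tendsto_atBot_add_const_right _ (M + 2 * wid)
        tendsto_id)
      simp only [id]; linarith [(hM' c).2, (hc' c).1]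
    have htop : Tendsto (fun c => S.G (p.1, p.2, capAt wid c) + c - capAt wid c) atTop atTop := by
      refine tendsto_atTop_mono (fun c => ?_) (tendsto_atTop_add_const_right _ (-(M + 2 * wid))
        tendsto_id)
      simp only [id]; linarith [(hM' c).1, (hc' c).2]
    exact hcont.surjective htop hbot x

/-- The level function of the strip. -/
def L (q : ℝ × ℂ) : ℝ := S.exists_level.choose (q.1, q.2.im) q.2.re

lemma L_smooth : ContDiff ℝ ∞ S.L := by
  have h := S.exists_level.choose_spec.1
  have h2 : ContDiff ℝ ∞ fun q : ℝ × ℂ => (((q.1, q.2.im), q.2.re) : (ℝ × ℝ) × ℝ) :=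
    (contDiff_fst.prodMk (Complex.imCLM.contDiff.comp contDiff_snd)).prodMk
      (Complex.reCLM.contDiff.comp contDiff_snd)
  exact h.comp h2

lemma L_eq_iff {q : ℝ × ℂ} {c : ℝ} (hc : |c| ≤ wid) :
    S.L q = c ↔ S.G (q.1, q.2.im, c) = q.2.re := by
  have := S.exists_level.choose_spec.2 (q.1, q.2.im) q.2.re c
  rw [capAt_of_abs_le wid_pos hc, add_sub_cancel_right] at this
  exact this

lemma L_eq_iff_leg {t c : ℝ} {z : ℂ} (hz : z.im < mrg) (hc : |c| ≤ wid) :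
    S.L (t, z) = c ↔ z.re = S.leg t c := by
  rw [S.L_eq_iff hc]; simp only; rw [S.G_leg hc hz]; exact eq_comm

lemma Z_lt_of_L {t : ℝ} {z : ℂ} (hz : |z.re - z.im| < mrg) (hc : |S.L (t, z)| ≤ wid) :
    S.Z t + mrg / 2 < z.im := by
  have h := (S.L_eq_iff (q := (t, z)) hc).1 rfl
  simp only at h
  rw [abs_lt] at hz
  by_cases hy : z.im ≤ S.Z t
  · have := S.G_low t z.im _ hc hy
    linarith
  · push Not at hy
    rw [S.G_hyp hc hy] at h
    linarith [S.Z_le t _ hc]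

lemma L_eq_iff_hyp {t c : ℝ} {z : ℂ} (hz : |z.re - z.im| < mrg) (hc : |c| ≤ wid) :
    S.L (t, z) = c ↔ z.re + z.im = 2 * S.hyp t c := by
  constructor
  · intro h
    subst h
    have hy := S.Z_lt_of_L hz hc
    have h := (S.L_eq_iff (q := (t, z)) hc).1 rfl
    simp only at h
    rw [S.G_hyp hc (by linarith [mrg_pos])] at h
    linarith
  · intro h
    rw [S.L_eq_iff hc]
    rw [abs_lt] at hz
    simp only
    rw [S.G_hyp hc (by linarith [S.Z_le t c hc, mrg_pos])]
    linarith

lemma Ψ_L_hyp {t : ℝ} {z : ℂ} (hz : |z.re - z.im| < mrg) (hc : |S.L (t, z)| ≤ wid) :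
    S.Ψ (t, z.im, S.L (t, z)) = (z.im - z.re) * S.hyp' t (S.L (t, z)) := by
  have hy := S.Z_lt_of_L hz hc
  have h := (S.L_eq_iff_hyp hz hc).1 rfl
  rw [S.Ψ_hyp hc (by linarith [mrg_pos])]
  linear_combination (S.hyp' t (S.L (t, z))) * h

lemma re_le_of_L {t : ℝ} {z : ℂ} (hz : 0 ≤ z.im) (hc : |S.L (t, z)| ≤ wid) :
    z.re ≤ 1 - mrg := by
  have h := (S.L_eq_iff (q := (t, z)) hc).1 rfl
  rw [← h]
  exact S.G_up _ _ _ hc hz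

end Strip

/-! ### Profiles -/

/-- Bump used to build the density profile. -/
def densBump : ContDiffBump (0 : ℝ) := ⟨wid / 4, wid / 2, by norm_num [wid], by norm_num [wid]⟩

/-- Cutoff for the stream function. -/
def cutBump : ContDiffBump (0 : ℝ) := ⟨3 * wid / 4, wid, by norm_num [wid], by norm_num [wid]⟩

/-- The odd density profile. -/
def prof (c : ℝ) : ℝ := c * densBump c

/-- The even cutoff profile. -/
def cut (c : ℝ) : ℝ := cutBump c

lemma prof_contDiff : ContDiff ℝ ∞ prof := contDiff_id.mul densBump.contDiff

lemma cut_contDiff : ContDiff ℝ ∞ cut := cutBump.contDiff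

lemma prof_neg (c : ℝ) : prof (-c) = -prof c := by
  unfold prof; rw [densBump.neg]; ring

lemma cut_neg (c : ℝ) : cut (-c) = cut c := cutBump.neg c

lemma prof_eq_zero {c : ℝ} (h : wid / 2 ≤ |c|) : prof c = 0 := by
  unfold prof
  rw [densBump.zero_of_le_dist, mul_zero]
  rwa [dist_zero_right, Real.norm_eq_abs]

lemma prof_eq_zero' {c : ℝ} (h : ¬ |c| ≤ wid) : prof c = 0 :=
  prof_eq_zero (by push Not at h; linarith [wid_pos])

lemma cut_eq_zero {c : ℝ} (h : ¬ |c| ≤ wid) : cut c = 0 := by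
  refine cutBump.zero_of_le_dist ?_
  rw [dist_zero_right, Real.norm_eq_abs]
  exact (not_le.1 h).le

lemma abs_prof_le (c : ℝ) : |prof c| ≤ 1 := by
  by_cases h : |c| ≤ wid
  · unfold prof
    rw [abs_mul, abs_of_nonneg densBump.nonneg]
    have : wid ≤ 1 := by norm_num [wid]
    exact mul_le_one₀ (h.trans this) densBump.nonneg densBump.le_one
  · rw [prof_eq_zero' h]; simp

lemma prof_ne_zero : prof (wid / 4) ≠ 0 := by
  unfold prof
  rw [densBump.one_of_mem_closedBall]
  · norm_num [wid]
  · rw [Metric.mem_closedBall, dist_zero_right, Real.norm_eq_abs, abs_of_pos (by norm_num [wid])]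
    exact le_rfl

lemma eventually_of_deriv_prof_ne {c : ℝ} (h : deriv prof c ≠ 0) :
    |c| < 3 * wid / 4 := by
  by_contra hc
  push Not at hc
  apply h
  have : prof =ᶠ[𝓝 c] fun _ => 0 := by
    have : ∀ᶠ c' in 𝓝 c, wid / 2 < |c'| :=
      continuous_abs.continuousAt.eventually (lt_mem_nhds (by linarith [wid_pos]))
    filter_upwards [this] with c' hc'
    exact prof_eq_zero hc'.le
  rw [this.deriv_eq]; simp

lemma cut_eq_one {c : ℝ} (h : |c| ≤ 3 * wid / 4) : cut c = 1 := by
  refine cutBump.one_of_mem_closedBall ?_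
  rw [Metric.mem_closedBall, dist_zero_right, Real.norm_eq_abs]
  exact h

/-! ### Density and stream function of a strip -/

/-- The Poisson-bracket form of the transport equation with velocity `∇^⊥ ψ`. -/
def Transport (ρ ψ : ℝ × ℂ → ℝ) (q : ℝ × ℂ) : Prop :=
  fderiv ℝ ρ q (1, 0) + fderiv ℝ ψ q (0, Complex.I) * fderiv ℝ ρ q (0, 1)
    - fderiv ℝ ψ q (0, 1) * fderiv ℝ ρ q (0, Complex.I) = 0

namespace Strip

variable (S : Strip)

/-- Density carried by the strip. -/
def dens (q : ℝ × ℂ) : ℝ := prof (S.L q)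

/-- Stream function moving the strip. -/
def strm (q : ℝ × ℂ) : ℝ := cut (S.L q) * S.Ψ (q.1, q.2.im, S.L q)

lemma dens_smooth : ContDiff ℝ ∞ S.dens := prof_contDiff.comp S.L_smooth

lemma arg_smooth : ContDiff ℝ ∞ fun q : ℝ × ℂ => ((q.1, q.2.im, S.L q) : ℝ × ℝ × ℝ) :=
  contDiff_fst.prodMk ((Complex.imCLM.contDiff.comp contDiff_snd).prodMk S.L_smooth)

lemma strm_smooth : ContDiff ℝ ∞ S.strm :=
  (cut_contDiff.comp S.L_smooth).mul (S.Ψ_smooth.comp S.arg_smooth)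

lemma transport (q : ℝ × ℂ) : Transport S.dens S.strm q := by
  have hL := (S.L_smooth.differentiable (by simp) q).hasFDerivAt
  have hρ : ∀ v, fderiv ℝ S.dens q v = deriv prof (S.L q) * fderiv ℝ S.L q v := by
    intro v
    have h1 := (prof_contDiff.differentiable (by simp) (S.L q)).hasDerivAt.comp_hasFDerivAt q hL
    have : fderiv ℝ S.dens q = deriv prof (S.L q) • fderiv ℝ S.L q := h1.fderiv
    rw [this]; simp
  unfold Transport
  by_cases h0 : deriv prof (S.L q) = 0
  · simp only [hρ, h0]; ring
  have hc := eventually_of_deriv_prof_ne h0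
  have hev : ∀ᶠ q' in 𝓝 q, |S.L q'| < 3 * wid / 4 :=
    (S.L_smooth.continuous.abs.continuousAt (x := q)).eventually (gt_mem_nhds hc)
  -- differentiate `G (t, y, L) = x`
  have harg : HasFDerivAt (fun q : ℝ × ℂ => ((q.1, q.2.im, S.L q) : ℝ × ℝ × ℝ))
      ((ContinuousLinearMap.fst ℝ ℝ ℂ).prod
        ((Complex.imCLM.comp (ContinuousLinearMap.snd ℝ ℝ ℂ)).prod (fderiv ℝ S.L q))) q :=
    hasFDerivAt_fst.prodMk
      ((Complex.imCLM.hasFDerivAt.comp q hasFDerivAt_snd).prodMk hL)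
  set p : ℝ × ℝ × ℝ := (q.1, q.2.im, S.L q) with hp
  have hGd := ((S.G_smooth.differentiable (by simp) p).hasFDerivAt).comp q harg
  have hGx : (S.G ∘ fun q : ℝ × ℂ => ((q.1, q.2.im, S.L q) : ℝ × ℝ × ℝ)) =ᶠ[𝓝 q]
      fun q => q.2.re := by
    filter_upwards [hev] with q' hq'
    exact (S.L_eq_iff (q := q') (by linarith [wid_pos])).1 rfl
  have hx : HasFDerivAt (fun q : ℝ × ℂ => q.2.re)
      (Complex.reCLM.comp (ContinuousLinearMap.snd ℝ ℝ ℂ)) q :=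
    Complex.reCLM.hasFDerivAt.comp q hasFDerivAt_snd
  have hE := (hGd.congr_of_eventuallyEq hGx.symm).unique hx
  have hψe : S.strm =ᶠ[𝓝 q] S.Ψ ∘ fun q : ℝ × ℂ => ((q.1, q.2.im, S.L q) : ℝ × ℝ × ℝ) := by
    filter_upwards [hev] with q' hq'
    simp [strm, cut_eq_one hq'.le]
  have hΨd := ((S.Ψ_smooth.differentiable (by simp) p).hasFDerivAt).comp q harg
  have hψ := (hΨd.congr_of_eventuallyEq hψe).fderiv
  have split : ∀ (B : ℝ × ℝ × ℝ →L[ℝ] ℝ) (a b c : ℝ),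
      B (a, b, c) = a * B (1, 0, 0) + b * B (0, 1, 0) + c * B (0, 0, 1) := by
    intro B a b c
    have : ((a, b, c) : ℝ × ℝ × ℝ) =
        a • ((1 : ℝ), (0 : ℝ), (0 : ℝ)) + b • ((0 : ℝ), (1 : ℝ), (0 : ℝ))
          + c • ((0 : ℝ), (0 : ℝ), (1 : ℝ)) := by ext <;> simp
    rw [this]; simp only [map_add, map_smul, smul_eq_mul]
  have e1 := DFunLike.congr_fun hE (1, 0)
  have e2 := DFunLike.congr_fun hE (0, 1)
  have e3 := DFunLike.congr_fun hE (0, Complex.I)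
  simp only [ContinuousLinearMap.comp_apply, ContinuousLinearMap.prod_apply,
    ContinuousLinearMap.coe_fst', ContinuousLinearMap.coe_snd', Complex.imCLM_apply,
    Complex.reCLM_apply, Complex.zero_im, Complex.zero_re, Complex.one_im, Complex.one_re,
    Complex.I_im, Complex.I_re] at e1 e2 e3
  rw [hψ]
  simp only [hρ, ContinuousLinearMap.comp_apply, ContinuousLinearMap.prod_apply,
    ContinuousLinearMap.coe_fst', ContinuousLinearMap.coe_snd', Complex.imCLM_apply,
    Complex.one_im, Complex.I_im]
  rw [split] at e1 e2 e3
  rw [split (fderiv ℝ S.Ψ p) 0 1, split (fderiv ℝ S.Ψ p) 0 0 (fderiv ℝ S.L q (0, 1)), S.fderiv_Ψ_eq p]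
  set gt := fderiv ℝ S.G p (1, 0, 0)
  set gc := fderiv ℝ S.G p (0, 0, 1)
  set Lt := fderiv ℝ S.L q (1, 0)
  set Lx := fderiv ℝ S.L q (0, 1)
  set Ly := fderiv ℝ S.L q (0, Complex.I)
  set Pc := fderiv ℝ S.Ψ p (0, 0, 1)
  have hgc : gc ≠ 0 := by
    intro h; rw [h] at e2; norm_num at e2
  have key : gc * (Lt + gt * Lx) = 0 := by linear_combination e1 + gt * e2
  have key2 : Lt + gt * Lx = 0 := (mul_eq_zero.1 key).resolve_left hgc
  linear_combination (deriv prof (S.L q)) * key2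

end Strip

/-! ### Tiles: functions on the square with (twisted) dihedral symmetry -/

/-- Extension of a function on the chamber `0 ≤ y ≤ x` by reflections, each with a sign `ε`. -/
def ext (ε : ℝ) (f : ℝ × ℂ → ℝ) (q : ℝ × ℂ) : ℝ :=
  (if q.2.re * q.2.im < 0 then ε else 1) *
    (if |q.2.im| ≤ |q.2.re| then f (q.1, ⟨|q.2.re|, |q.2.im|⟩)
      else ε * f (q.1, ⟨|q.2.im|, |q.2.re|⟩))

/-- Boundary behaviour in the chamber which makes the reflected extension smooth. -/
structure ConeTile (ε : ℝ) (f : ℝ × ℂ → ℝ) : Prop where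
  margins : ∃ δ > 0, (∀ t (z : ℂ), |z.im| < δ → f (t, conj z) = ε * f (t, z)) ∧
    (∀ t (z : ℂ), |z.re - z.im| < δ → f (t, Complex.I * conj z) = ε * f (t, z)) ∧
    (∀ t (z : ℂ), |z.re| < δ → |z.im| < δ → f (t, z) = 0) ∧
    (∀ t (z : ℂ), 0 ≤ z.im → z.im ≤ z.re → 1 - δ ≤ z.re → f (t, z) = 0)

/-- A smooth function with twisted dihedral symmetry, vanishing near the center and near the
boundary of the square `[-1, 1]²`. -/
structure Tile (ε : ℝ) (f : ℝ × ℂ → ℝ) : Prop where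
  smooth : ContDiff ℝ ∞ f
  conj_eq : ∀ t z, f (t, conj z) = ε * f (t, z)
  rot_eq : ∀ t z, f (t, Complex.I * z) = f (t, z)
  margins : ∃ δ > 0, (∀ t (z : ℂ), |z.re| < δ → |z.im| < δ → f (t, z) = 0) ∧
    (∀ t (z : ℂ), 1 - δ ≤ |z.re| → f (t, z) = 0)

lemma I_mul_conj (z : ℂ) : Complex.I * conj z = ⟨z.im, z.re⟩ := by
  apply Complex.ext <;> simp

/-- Every point is carried into the chamber by conjugation and rotation. -/
lemma cone_induction {p : ℂ → Prop} (hc : ∀ z, p (conj z) → p z)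
    (hr : ∀ z, p (Complex.I * z) → p z) (hK : ∀ z : ℂ, 0 ≤ z.im → z.im ≤ z.re → p z) (z : ℂ) :
    p z := by
  have h1 : ∀ z : ℂ, |z.im| ≤ z.re → p z := by
    intro z hz
    rcases le_total 0 z.im with h | h
    · rw [abs_of_nonneg h] at hz; exact hK z h hz
    · rw [abs_of_nonpos h] at hz; exact hc z (hK _ (by simpa using h) (by simpa using hz))
  rcases le_total |z.im| |z.re| with h | h
  · rcases le_total 0 z.re with h0 | h0
    · rw [abs_of_nonneg h0] at h; exact h1 z h
    · rw [abs_of_nonpos h0] at h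
      exact hr _ (hr _ (h1 _ (by simpa using h)))
  · rcases le_total 0 z.im with h0 | h0
    · rw [abs_of_nonneg h0] at h
      exact hr _ (hr _ (hr _ (h1 _ (by simpa using h))))
    · rw [abs_of_nonpos h0] at h
      exact hr _ (h1 _ (by simpa using h))

section ext

variable {ε : ℝ} {f : ℝ × ℂ → ℝ}

lemma ext_of_cone {t : ℝ} {z : ℂ} (h0 : 0 ≤ z.im) (h1 : z.im ≤ z.re) : ext ε f (t, z) = f (t, z) := by
  unfold ext
  have h2 : 0 ≤ z.re := h0.trans h1
  simp only [abs_of_nonneg h0, abs_of_nonneg h2, if_pos h1]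
  rw [if_neg (not_lt.2 (mul_nonneg h2 h0)), one_mul]

lemma ConeTile.ext_conj (hε : ε * ε = 1) (hf : ConeTile ε f) (t : ℝ) (z : ℂ) :
    ext ε f (t, conj z) = ε * ext ε f (t, z) := by
  obtain ⟨δ, hδ, hl, hh, -, -⟩ := hf.margins
  have hl0 : ∀ x : ℝ, f (t, ⟨x, 0⟩) = ε * f (t, ⟨x, 0⟩) := fun x => by
    have := hl t ⟨x, 0⟩ (by simpa using hδ)
    rwa [show conj (⟨x, 0⟩ : ℂ) = ⟨x, 0⟩ by apply Complex.ext <;> simp] at this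
  unfold ext
  simp only [Complex.conj_re, Complex.conj_im, abs_neg]
  rcases lt_trichotomy (z.re * z.im) 0 with h | h | h
  · rw [if_pos h, if_neg (by nlinarith)]
    rw [← mul_assoc, hε]
  · rw [if_neg (by nlinarith), if_neg h.not_lt, one_mul]
    rcases mul_eq_zero.1 h with h | h
    · rw [h]
      by_cases h3 : |z.im| ≤ |(0 : ℝ)|
      · rw [if_pos h3]
        have : z.im = 0 := by simpa using h3
        rw [this]
        simp only [abs_zero]; exact hl0 0
      · rw [if_neg h3]; simp only [abs_zero]; rw [← hl0]; exact hl0 _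
    · rw [h]
      simp only [abs_zero, abs_nonneg, if_true]; exact hl0 _
  · rw [if_neg h.le.not_gt, if_pos (by nlinarith), one_mul]

lemma ConeTile.ext_rot (hε : ε * ε = 1) (hf : ConeTile ε f) (t : ℝ) (z : ℂ) :
    ext ε f (t, Complex.I * z) = ext ε f (t, z) := by
  obtain ⟨δ, hδ, hl, hh, -, -⟩ := hf.margins
  have hl0 : ∀ x : ℝ, f (t, ⟨x, 0⟩) = ε * f (t, ⟨x, 0⟩) := fun x => by
    have := hl t ⟨x, 0⟩ (by simpa using hδ)
    rwa [show conj (⟨x, 0⟩ : ℂ) = ⟨x, 0⟩ by apply Complex.ext <;> simp] at this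
  have hh0 : ∀ x : ℝ, f (t, ⟨x, x⟩) = ε * f (t, ⟨x, x⟩) := fun x => by
    have := hh t ⟨x, x⟩ (by simpa using hδ)
    rwa [I_mul_conj] at this
  unfold ext
  simp only [Complex.mul_re, Complex.mul_im, Complex.I_re, Complex.I_im, zero_mul, one_mul,
    zero_sub, abs_neg, zero_add]
  -- the second factor changes by `ε`, except on the diagonals where it is irrelevant
  have hsec : (if |z.re| ≤ |z.im| then f (t, ⟨|z.im|, |z.re|⟩)
      else ε * f (t, ⟨|z.re|, |z.im|⟩)) =
      ε * (if |z.im| ≤ |z.re| then f (t, ⟨|z.re|, |z.im|⟩)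
      else ε * f (t, ⟨|z.im|, |z.re|⟩)) := by
    rcases lt_trichotomy |z.re| |z.im| with h | h | h
    · rw [if_pos h.le, if_neg h.not_ge, ← mul_assoc, hε, one_mul]
    · rw [if_pos h.le, if_pos h.ge, h]; exact hh0 _
    · rw [if_neg h.not_ge, if_pos h.le]
  rw [hsec]
  rcases lt_trichotomy (z.re * z.im) 0 with h | h | h
  · rw [if_pos h, if_neg (by nlinarith), one_mul]
  · rw [if_neg (by nlinarith), if_neg h.not_lt, one_mul, one_mul]
    have hfix : ∀ v : ℝ, v = ε * v → ε * (ε * v) = ε * v := fun v hv => by rw [← hv, ← hv]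
    rcases mul_eq_zero.1 h with h | h
    · rw [h]
      by_cases h3 : |z.im| ≤ |(0 : ℝ)|
      · rw [if_pos h3]
        have : z.im = 0 := by simpa using h3
        rw [this]
        simp only [abs_zero]; exact (hl0 0).symm
      · rw [if_neg h3]; simp only [abs_zero]; exact hfix _ (hl0 _)
    · rw [h]
      simp only [abs_zero, abs_nonneg, if_true]; exact (hl0 _).symm
  · rw [if_neg h.le.not_gt, if_pos (by nlinarith), ← mul_assoc, hε]

lemma ConeTile.ext_eventuallyEq (hε : ε * ε = 1) (hf : ConeTile ε f) (t : ℝ) {z : ℂ}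
    (h0 : 0 ≤ z.im) (h1 : z.im ≤ z.re) : ext ε f =ᶠ[𝓝 (t, z)] f := by
  obtain ⟨δ, hδ, hl, hh, hz, -⟩ := hf.margins
  have cre : Continuous fun q : ℝ × ℂ => q.2.re := by fun_prop
  have cim : Continuous fun q : ℝ × ℂ => q.2.im := by fun_prop
  have evre : ∀ {a b : ℝ}, a < z.re → z.re < b → ∀ᶠ q : ℝ × ℂ in 𝓝 (t, z), a < q.2.re ∧ q.2.re < b :=
    fun ha hb => cre.continuousAt.eventually (Ioo_mem_nhds ha hb)
  have evim : ∀ {a b : ℝ}, a < z.im → z.im < b → ∀ᶠ q : ℝ × ℂ in 𝓝 (t, z), a < q.2.im ∧ q.2.im < b :=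
    fun ha hb => cim.continuousAt.eventually (Ioo_mem_nhds ha hb)
  have evd : ∀ {a b : ℝ}, a < z.re - z.im → z.re - z.im < b →
      ∀ᶠ q : ℝ × ℂ in 𝓝 (t, z), a < q.2.re - q.2.im ∧ q.2.re - q.2.im < b :=
    fun ha hb => (cre.sub cim).continuousAt.eventually (Ioo_mem_nhds ha hb)
  rcases h0.eq_or_lt with h0' | h0'
  · rcases (h0.trans h1).eq_or_lt with h2 | h2
    · -- the origin
      filter_upwards [evre (a := -δ) (b := δ) (by linarith) (by linarith),
        evim (a := -δ) (b := δ) (by linarith) (by linarith)] with q hq1 hq2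
      have a1 : |q.2.re| < δ := abs_lt.2 hq1
      have a2 : |q.2.im| < δ := abs_lt.2 hq2
      have e : f q = 0 := hz q.1 q.2 a1 a2
      rw [e]
      unfold ext
      rw [hz _ _ (by simpa using a1) (by simpa using a2),
        hz _ _ (by simpa using a2) (by simpa using a1)]
      simp
    · filter_upwards [evre (a := z.re / 2) (b := z.re + 1) (by linarith) (by linarith),
        evim (a := - min δ (z.re / 2)) (b := min δ (z.re / 2))
          (by rw [← h0']; simp [hδ, h2]) (by rw [← h0']; simp [hδ, h2])] with q hq1 hq2
      have b1 := min_le_left δ (z.re / 2)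
      have b2 := min_le_right δ (z.re / 2)
      rcases le_total 0 q.2.im with h3 | h3
      · exact ext_of_cone h3 (by linarith)
      · rcases h3.eq_or_lt with h3 | h3
        · exact ext_of_cone h3.ge (by linarith)
        have h4 : 0 < q.2.re := by linarith
        unfold ext
        rw [if_pos (mul_neg_of_pos_of_neg h4 h3), abs_of_neg h3, abs_of_pos h4,
          if_pos (by linarith)]
        have := hl q.1 q.2 (abs_lt.2 ⟨by linarith, by linarith⟩)
        rw [show conj q.2 = ⟨q.2.re, -q.2.im⟩ by apply Complex.ext <;> simp] at this
        rw [this, ← mul_assoc, hε, one_mul]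
  · rcases h1.eq_or_lt with h1' | h1'
    · filter_upwards [evre (a := 0) (b := z.re + 1) (by linarith) (by linarith),
        evim (a := 0) (b := z.im + 1) (by linarith) (by linarith),
        evd (a := -δ) (b := δ) (by linarith) (by linarith)] with q hq1 hq2 hq3
      rcases le_or_gt q.2.im q.2.re with h3 | h3
      · exact ext_of_cone hq2.1.le h3
      · unfold ext
        rw [if_neg (not_lt.2 (mul_nonneg hq1.1.le hq2.1.le)), abs_of_pos hq1.1, abs_of_pos hq2.1,
          if_neg h3.not_ge, one_mul]
        have := hh q.1 q.2 (abs_lt.2 hq3)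
        rw [I_mul_conj] at this
        rw [this, ← mul_assoc, hε, one_mul]
    · filter_upwards [evim (a := 0) (b := z.im + 1) (by linarith) (by linarith),
        evd (a := 0) (b := z.re - z.im + 1) (by linarith) (by linarith)] with q hq2 hq3
      exact ext_of_cone hq2.1.le (by linarith [hq3.1])

/-- Symmetry reduces smoothness to the chamber. -/
lemma contDiff_of_cone {g : ℝ × ℂ → ℝ} (hε : ε * ε = 1)
    (hc : ∀ t z, g (t, conj z) = ε * g (t, z))
    (hr : ∀ t z, g (t, Complex.I * z) = g (t, z))
    (hK : ∀ t (z : ℂ), 0 ≤ z.im → z.im ≤ z.re → ContDiffAt ℝ ∞ g (t, z)) : ContDiff ℝ ∞ g := by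
  rw [contDiff_iff_contDiffAt]
  rintro ⟨t, z⟩
  refine cone_induction (p := fun z => ContDiffAt ℝ ∞ g (t, z)) ?_ ?_ (fun z => hK t z) z
  · intro z hz
    have h2 : ContDiff ℝ ∞ fun q : ℝ × ℂ => ((q.1, conj q.2) : ℝ × ℂ) :=
      contDiff_fst.prodMk (Complex.conjCLE.contDiff.comp contDiff_snd)
    have h3 : g = fun q => ε * g (q.1, conj q.2) := by
      funext q; rw [hc, ← mul_assoc, hε, one_mul]
    rw [h3]
    exact contDiffAt_const.mul (ContDiffAt.comp (t, z) (g := g) hz h2.contDiffAt)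
  · intro z hz
    have h2 : ContDiff ℝ ∞ fun q : ℝ × ℂ => ((q.1, Complex.I * q.2) : ℝ × ℂ) :=
      contDiff_fst.prodMk (contDiff_const.mul contDiff_snd)
    have h3 : g = fun q => g (q.1, Complex.I * q.2) := by
      funext q; rw [hr]
    rw [h3]
    exact ContDiffAt.comp (t, z) (g := g) hz h2.contDiffAt

lemma ConeTile.tile (hε : ε * ε = 1) (hf : ConeTile ε f)
    (hs : ∀ t (z : ℂ), 0 ≤ z.im → z.im ≤ z.re → ContDiffAt ℝ ∞ f (t, z)) : Tile ε (ext ε f) := by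
  refine ⟨contDiff_of_cone hε (hf.ext_conj hε) (hf.ext_rot hε) fun t z h0 h1 =>
    (hs t z h0 h1).congr_of_eventuallyEq (hf.ext_eventuallyEq hε t h0 h1),
    hf.ext_conj hε, hf.ext_rot hε, ?_⟩
  obtain ⟨δ, hδ, -, -, hz, hfar⟩ := hf.margins
  refine ⟨δ, hδ, fun t z h1 h2 => ?_, fun t z h => ?_⟩
  · unfold ext
    rw [hz _ _ (by simpa using h1) (by simpa using h2),
        hz _ _ (by simpa using h2) (by simpa using h1)]
    simp
  · unfold ext
    by_cases h3 : |z.im| ≤ |z.re|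
    · rw [if_pos h3, hfar _ _ (abs_nonneg _) h3 h, mul_zero]
    · rw [if_neg h3, hfar _ _ (abs_nonneg _) (not_le.1 h3).le (by simp only; linarith), mul_zero,
        mul_zero]

end ext

lemma Tile.margins' {ε : ℝ} {f : ℝ × ℂ → ℝ} (hf : Tile ε f) :
    ∃ δ > 0, δ < 1 / 4 ∧ (∀ t (z : ℂ), |z.re| < δ → |z.im| < δ → f (t, z) = 0) ∧
    (∀ t (z : ℂ), 1 - δ ≤ |z.re| → f (t, z) = 0) ∧
    (∀ t (z : ℂ), 1 - δ ≤ |z.im| → f (t, z) = 0) := by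
  obtain ⟨δ, hδ, h1, h2⟩ := hf.margins
  have a1 := min_le_left δ (1 / 8)
  have a2 := min_le_right δ (1 / 8)
  refine ⟨min δ (1 / 8), by positivity, by linarith, fun t z p q => h1 t z (by linarith)
    (by linarith), fun t z p => h2 t z (by linarith), fun t z p => ?_⟩
  rw [← hf.rot_eq]
  exact h2 t _ (by simp; linarith)

/-! ### The substitution step -/

/-- Similarity carrying the lower half of the chamber to the chamber. -/
def simA (z : ℂ) : ℂ := (1 + Complex.I) * (1 - z)

/-- Similarity carrying the upper half of the chamber to half of the square. -/
def simB (z : ℂ) : ℂ := 2 * z - 1 - Complex.I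

@[simp] lemma simA_re (z : ℂ) : (simA z).re = 1 - z.re + z.im := by simp [simA]
@[simp] lemma simA_im (z : ℂ) : (simA z).im = 1 - z.re - z.im := by simp [simA]; ring
@[simp] lemma simB_re (z : ℂ) : (simB z).re = 2 * z.re - 1 := by simp [simB]
@[simp] lemma simB_im (z : ℂ) : (simB z).im = 2 * z.im - 1 := by simp [simB]

lemma simA_contDiff : ContDiff ℝ ∞ simA := contDiff_const.mul (contDiff_const.sub contDiff_id)
lemma simB_contDiff : ContDiff ℝ ∞ simB :=
  ((contDiff_const.mul contDiff_id).sub contDiff_const).sub contDiff_const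

lemma simA_conj (z : ℂ) : simA (conj z) = Complex.I * conj (simA z) := by
  apply Complex.ext <;> simp; ring

lemma simA_simA (z : ℂ) : simA (simA z) = Complex.I * simB z := by
  apply Complex.ext <;> simp <;> ring

/-- Compatibility of two tiles along the common edge of the subdivision. -/
def Match (lam : ℝ) (F E : ℝ × ℂ → ℝ) : Prop :=
  ∃ δ > 0, ∀ t (w : ℂ), |w.im| < δ → -δ < w.re → w.re < 1 + δ → F (t, w) = lam * E (t, simA w)

/-- The substitution on the chamber. -/
def stepCone (lam : ℝ) (F E : ℝ × ℂ → ℝ) (q : ℝ × ℂ) : ℝ :=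
  if q.2.re + q.2.im ≤ 1 then lam * F (q.1, simA q.2) else lam ^ 2 * E (q.1, simB q.2)

/-- The substitution step on tiles. -/
def step (ε lam : ℝ) (F E : ℝ × ℂ → ℝ) : ℝ × ℂ → ℝ := ext ε (stepCone lam F E)

lemma Tile.swap_eq {ε : ℝ} {f : ℝ × ℂ → ℝ} (hf : Tile ε f) (t : ℝ) (z : ℂ) :
    f (t, Complex.I * conj z) = ε * f (t, z) := by rw [hf.rot_eq, hf.conj_eq]

section step

variable {ε lam : ℝ} {F E : ℝ × ℂ → ℝ}

lemma stepCone_coneTile (hF : Tile ε F) (hE : Tile ε E) : ConeTile ε (stepCone lam F E) := by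
  obtain ⟨δ₁, h1, h1', F0, Fr, Fi⟩ := hF.margins'
  obtain ⟨δ₂, h2, h2', E0, Er, Ei⟩ := hE.margins'
  obtain ⟨δ, hδ, hδ1, hδ2⟩ : ∃ δ > 0, δ < δ₁ ∧ δ < δ₂ :=
    ⟨min δ₁ δ₂ / 2, by positivity, by linarith [min_le_left δ₁ δ₂, lt_min h1 h2],
      by linarith [min_le_right δ₁ δ₂, lt_min h1 h2]⟩
  refine ⟨δ / 4, by positivity, fun t z hz => ?_, fun t z hz => ?_, fun t z h3 h4 => ?_,
    fun t z h3 h4 h5 => ?_⟩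
  · rw [abs_lt] at hz
    -- values close to the corner `1` and beyond vanish
    have hv : ∀ z : ℂ, |z.im| < δ / 4 → 1 - δ / 4 ≤ z.re → stepCone lam F E (t, z) = 0 := by
      intro z hz1 hz2
      rw [abs_lt] at hz1
      unfold stepCone
      split_ifs with h <;> simp only at h ⊢
      · rw [F0, mul_zero] <;> rw [abs_lt] <;> constructor <;> simp <;> linarith
      · rw [Ei, mul_zero]; rw [le_abs]; right; simp; linarith
    rcases le_total (1 - δ / 4) z.re with h | h
    · rw [hv z (abs_lt.2 hz) h, hv _ (by simpa [abs_lt] using ⟨by linarith, by linarith⟩)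
        (by simpa using h), mul_zero]
    · unfold stepCone
      rw [if_pos (by simp; linarith), if_pos (by simp; linarith)]
      simp only
      rw [simA_conj, hF.swap_eq]; ring
  · rw [abs_lt] at hz
    unfold stepCone
    by_cases h : z.re + z.im ≤ 1
    · have h' : z.im + z.re ≤ 1 := by linarith
      rw [I_mul_conj, if_pos h', if_pos h]
      simp only
      rw [Fr, Fr, mul_zero, mul_zero]
      · rw [le_abs]; left; simp; linarith
      · rw [le_abs]; left; simp; linarith
    · have h' : ¬ z.im + z.re ≤ 1 := by linarith
      rw [I_mul_conj, if_neg h', if_neg h]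
      simp only
      rw [show simB ⟨z.im, z.re⟩ = Complex.I * conj (simB z) by
        apply Complex.ext <;> simp, hE.swap_eq]
      ring
  · rw [abs_lt] at h3 h4
    unfold stepCone
    rw [if_pos (by simp only; linarith)]
    simp only
    rw [Fr, mul_zero]; rw [le_abs]; left; simp; linarith
  · unfold stepCone
    split_ifs with h <;> simp only at h ⊢
    · rw [F0, mul_zero] <;> rw [abs_lt] <;> constructor <;> simp <;> linarith
    · rw [Er, mul_zero]; rw [le_abs]; left; simp; linarith

lemma stepCone_eventuallyEq_A (hE : Tile ε E) (hM : Match lam F E) (t : ℝ) {z : ℂ}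
    (h0 : 0 ≤ z.im) (h1 : z.im ≤ z.re) (h : z.re + z.im ≤ 1) :
    stepCone lam F E =ᶠ[𝓝 (t, z)] fun q => lam * F (q.1, simA q.2) := by
  obtain ⟨δ, hδ, hM⟩ := hM
  have cs : Continuous fun q : ℝ × ℂ => q.2.re + q.2.im := by fun_prop
  have cd : Continuous fun q : ℝ × ℂ => 1 - q.2.re + q.2.im := by fun_prop
  rcases h.eq_or_lt with h | h
  · have e1 : ∀ᶠ q : ℝ × ℂ in 𝓝 (t, z), q.2.re + q.2.im ∈ Ioo (1 - δ) (1 + δ) :=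
      cs.continuousAt.eventually (Ioo_mem_nhds (by simp only; linarith) (by simp only; linarith))
    have e2 : ∀ᶠ q : ℝ × ℂ in 𝓝 (t, z), 1 - q.2.re + q.2.im ∈ Ioo (-δ) (1 + δ) :=
      cd.continuousAt.eventually (Ioo_mem_nhds (by simp only; linarith) (by simp only; linarith))
    filter_upwards [e1, e2] with q hq1 hq2
    unfold stepCone
    split_ifs with h3
    · rfl
    · rw [hM q.1 (simA q.2) (by rw [abs_lt]; constructor <;> simp <;> linarith [hq1.1, hq1.2])
        (by simpa using hq2.1) (by simpa using hq2.2), simA_simA, hE.rot_eq]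
      ring
  · have e1 : ∀ᶠ q : ℝ × ℂ in 𝓝 (t, z), q.2.re + q.2.im < 1 :=
      cs.continuousAt.eventually (gt_mem_nhds h)
    filter_upwards [e1] with q hq
    unfold stepCone; rw [if_pos hq.le]

lemma stepCone_eventuallyEq_B (t : ℝ) {z : ℂ} (h : 1 < z.re + z.im) :
    stepCone lam F E =ᶠ[𝓝 (t, z)] fun q => lam ^ 2 * E (q.1, simB q.2) := by
  have cs : Continuous fun q : ℝ × ℂ => q.2.re + q.2.im := by fun_prop
  have e1 : ∀ᶠ q : ℝ × ℂ in 𝓝 (t, z), 1 < q.2.re + q.2.im :=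
    cs.continuousAt.eventually (lt_mem_nhds h)
  filter_upwards [e1] with q hq
  unfold stepCone; rw [if_neg (not_le.2 hq)]

lemma step_eventuallyEq_A (hε : ε * ε = 1) (hF : Tile ε F) (hE : Tile ε E) (hM : Match lam F E)
    (t : ℝ) {z : ℂ} (h0 : 0 ≤ z.im) (h1 : z.im ≤ z.re) (h : z.re + z.im ≤ 1) :
    step ε lam F E =ᶠ[𝓝 (t, z)] fun q => lam * F (q.1, simA q.2) :=
  ((stepCone_coneTile hF hE).ext_eventuallyEq hε t h0 h1).trans
    (stepCone_eventuallyEq_A hE hM t h0 h1 h)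

lemma step_eventuallyEq_B (hε : ε * ε = 1) (hF : Tile ε F) (hE : Tile ε E)
    (t : ℝ) {z : ℂ} (h0 : 0 ≤ z.im) (h1 : z.im ≤ z.re) (h : 1 < z.re + z.im) :
    step ε lam F E =ᶠ[𝓝 (t, z)] fun q => lam ^ 2 * E (q.1, simB q.2) :=
  ((stepCone_coneTile hF hE).ext_eventuallyEq hε t h0 h1).trans (stepCone_eventuallyEq_B t h)

lemma comp_simA_smooth (hF : ContDiff ℝ ∞ F) (a : ℝ) :
    ContDiff ℝ ∞ fun q : ℝ × ℂ => a * F (q.1, simA q.2) :=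
  contDiff_const.mul (hF.comp (contDiff_fst.prodMk (simA_contDiff.comp contDiff_snd)))

lemma comp_simB_smooth (hF : ContDiff ℝ ∞ F) (a : ℝ) :
    ContDiff ℝ ∞ fun q : ℝ × ℂ => a * F (q.1, simB q.2) :=
  contDiff_const.mul (hF.comp (contDiff_fst.prodMk (simB_contDiff.comp contDiff_snd)))

lemma step_tile (hε : ε * ε = 1) (hF : Tile ε F) (hE : Tile ε E) (hM : Match lam F E) :
    Tile ε (step ε lam F E) := by
  refine (stepCone_coneTile hF hE).tile hε fun t z h0 h1 => ?_
  rcases le_or_gt (z.re + z.im) 1 with h | h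
  · exact (comp_simA_smooth hF.smooth _).contDiffAt.congr_of_eventuallyEq
      (stepCone_eventuallyEq_A hE hM t h0 h1 h)
  · exact (comp_simB_smooth hE.smooth _).contDiffAt.congr_of_eventuallyEq
      (stepCone_eventuallyEq_B t h)

/-- By symmetry, tiles need to match only inside the chamber. -/
lemma match_of_cone {N : ℝ × ℂ → ℝ} (hε : ε * ε = 1) (hN : Tile ε N) (hF : Tile ε F)
    (h : ∃ δ > 0, ∀ t (w : ℂ), 0 ≤ w.im → w.im < δ → w.im ≤ w.re → w.re + w.im ≤ 1 →
      N (t, w) = lam * F (t, simA w)) : Match lam N F := by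
  obtain ⟨δ₀, h0, hk⟩ := h
  obtain ⟨δ₁, h1, h1', F0, Fr, Fi⟩ := hF.margins'
  obtain ⟨δ₂, h2, h2', N0, Nr, Ni⟩ := hN.margins'
  obtain ⟨δ, hδ, hδ0, hδ1, hδ2⟩ : ∃ δ > 0, δ < δ₀ ∧ δ < δ₁ ∧ δ < δ₂ :=
    ⟨min δ₀ (min δ₁ δ₂) / 2, by positivity,
      by linarith [min_le_left δ₀ (min δ₁ δ₂), lt_min h0 (lt_min h1 h2)],
      by linarith [min_le_right δ₀ (min δ₁ δ₂), min_le_left δ₁ δ₂, lt_min h0 (lt_min h1 h2)],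
      by linarith [min_le_right δ₀ (min δ₁ δ₂), min_le_right δ₁ δ₂, lt_min h0 (lt_min h1 h2)]⟩
  have key : ∀ t (w : ℂ), 0 ≤ w.im → w.im < δ / 4 → -(δ / 4) < w.re → w.re < 1 + δ / 4 →
      N (t, w) = lam * F (t, simA w) := by
    intro t w a1 a2 a3 a4
    by_cases c1 : w.im ≤ w.re
    · by_cases c2 : w.re + w.im ≤ 1
      · exact hk t w a1 (by linarith) c1 c2
      · rw [Nr, F0, mul_zero]
        · rw [abs_lt]; constructor <;> simp <;> linarith
        · rw [abs_lt]; constructor <;> simp <;> linarith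
        · rw [le_abs]; left; linarith
    · rw [N0, Fr, mul_zero]
      · rw [le_abs]; left; simp; linarith
      · rw [abs_lt]; constructor <;> linarith
      · rw [abs_lt]; constructor <;> linarith
  refine ⟨δ / 4, by positivity, fun t w a1 a2 a3 => ?_⟩
  rw [abs_lt] at a1
  rcases le_total 0 w.im with h | h
  · exact key t w h a1.2 a2 a3
  · have := key t (conj w) (by simpa using h) (by simp; linarith) (by simpa using a2)
      (by simpa using a3)
    rw [hN.conj_eq, simA_conj, hF.swap_eq] at this
    calc N (t, w) = ε * (ε * N (t, w)) := by rw [← mul_assoc, hε, one_mul]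
      _ = (ε * ε) * (lam * F (t, simA w)) := by rw [this]; ring
      _ = _ := by rw [hε, one_mul]

/-- The match condition propagates by itself. -/
lemma step_match (hε : ε * ε = 1) (hF : Tile ε F) (hE : Tile ε E) (hM : Match lam F E) :
    Match lam (step ε lam F E) F := by
  refine match_of_cone hε (step_tile hε hF hE hM) hF ⟨1, one_pos, fun t w a1 _ c1 c2 => ?_⟩
  unfold step
  rw [ext_of_cone a1 c1]; unfold stepCone; rw [if_pos c2]

end step

namespace Strip

variable (S : Strip)

lemma strm_eq_zero {q : ℝ × ℂ} (h : ¬ |S.L q| ≤ wid) : S.strm q = 0 := by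
  unfold strm; rw [cut_eq_zero h, zero_mul]

lemma dens_eq_zero {q : ℝ × ℂ} (h : ¬ |S.L q| ≤ wid) : S.dens q = 0 := prof_eq_zero' h

/-- If two level values agree whenever one of them is small, then so do all profiles. -/
lemma level_cases {a b : ℝ} (h : ∀ c, |c| ≤ wid → (a = c ↔ b = c)) :
    (a = b ∧ |b| ≤ wid) ∨ (¬ |a| ≤ wid ∧ ¬ |b| ≤ wid) := by
  by_cases ha : |a| ≤ wid
  · have := (h a ha).1 rfl
    left; exact ⟨this.symm, by rwa [this]⟩
  · by_cases hb : |b| ≤ wid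
    · left; exact ⟨(h b hb).2 rfl, hb⟩
    · exact Or.inr ⟨ha, hb⟩

lemma L_conj {t : ℝ} {z : ℂ} (hz : |z.im| < mrg) :
    (S.L (t, conj z) = S.L (t, z) ∧ |S.L (t, z)| ≤ wid) ∨
      (¬ |S.L (t, conj z)| ≤ wid ∧ ¬ |S.L (t, z)| ≤ wid) := by
  rw [abs_lt] at hz
  refine level_cases fun c hc => ?_
  rw [S.L_eq_iff_leg (by simp; linarith) hc, S.L_eq_iff_leg hz.2 hc]
  simp

lemma L_swap {t : ℝ} {z : ℂ} (hz : |z.re - z.im| < mrg) :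
    (S.L (t, Complex.I * conj z) = S.L (t, z) ∧ |S.L (t, z)| ≤ wid) ∨
      (¬ |S.L (t, Complex.I * conj z)| ≤ wid ∧ ¬ |S.L (t, z)| ≤ wid) := by
  refine level_cases fun c hc => ?_
  rw [I_mul_conj, S.L_eq_iff_hyp (by simpa [abs_sub_comm] using hz) hc, S.L_eq_iff_hyp hz hc]
  simp [add_comm]

lemma not_abs_L_of_small {t : ℝ} {z : ℂ} (h1 : |z.re| < mrg) (h2 : |z.im| < mrg) :
    ¬ |S.L (t, z)| ≤ wid := by
  intro hc
  have := (S.L_eq_iff_leg (lt_of_abs_lt h2) hc).1 rfl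
  have h3 := S.leg_low t _ hc
  rw [← this] at h3
  have := lt_of_abs_lt h1
  norm_num [mrg] at this
  linarith

lemma not_abs_L_of_far {t : ℝ} {z : ℂ} (h0 : 0 ≤ z.im) (h1 : 1 - mrg / 2 ≤ z.re) :
    ¬ |S.L (t, z)| ≤ wid := by
  intro hc
  have := S.re_le_of_L h0 hc
  linarith [mrg_pos]

lemma dens_coneTile : ConeTile 1 S.dens := by
  refine ⟨mrg / 2, by linarith [mrg_pos], fun t z hz => ?_, fun t z hz => ?_, fun t z h1 h2 => ?_,
    fun t z h0 _ h1 => S.dens_eq_zero (S.not_abs_L_of_far h0 h1)⟩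
  · rw [one_mul]
    rcases S.L_conj (t := t) (hz.trans (by linarith [mrg_pos])) with ⟨h, -⟩ | ⟨h, h'⟩
    · unfold dens; rw [h]
    · rw [S.dens_eq_zero h, S.dens_eq_zero h']
  · rw [one_mul]
    rcases S.L_swap (t := t) (hz.trans (by linarith [mrg_pos])) with ⟨h, -⟩ | ⟨h, h'⟩
    · unfold dens; rw [h]
    · rw [S.dens_eq_zero h, S.dens_eq_zero h']
  · exact S.dens_eq_zero (S.not_abs_L_of_small (by linarith [mrg_pos]) (by linarith [mrg_pos]))

lemma strm_leg {t : ℝ} {z : ℂ} (hz : z.im < mrg) :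
    S.strm (t, z) = cut (S.L (t, z)) * (z.im * S.leg' t (S.L (t, z))) := by
  by_cases h : |S.L (t, z)| ≤ wid
  · unfold strm; simp only; rw [S.Ψ_leg h hz.le]
  · rw [S.strm_eq_zero h, cut_eq_zero h, zero_mul]

lemma strm_hyp {t : ℝ} {z : ℂ} (hz : |z.re - z.im| < mrg) :
    S.strm (t, z) = cut (S.L (t, z)) * ((z.im - z.re) * S.hyp' t (S.L (t, z))) := by
  by_cases h : |S.L (t, z)| ≤ wid
  · unfold strm; simp only; rw [S.Ψ_L_hyp hz h]
  · rw [S.strm_eq_zero h, cut_eq_zero h, zero_mul]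

lemma strm_coneTile : ConeTile (-1) S.strm := by
  refine ⟨mrg / 2, by linarith [mrg_pos], fun t z hz => ?_, fun t z hz => ?_, fun t z h1 h2 => ?_,
    fun t z h0 _ h1 => S.strm_eq_zero (S.not_abs_L_of_far h0 h1)⟩
  · have hz' : |z.im| < mrg := hz.trans (by linarith [mrg_pos])
    rcases S.L_conj (t := t) hz' with ⟨h, -⟩ | ⟨h, h'⟩
    · rw [abs_lt] at hz'
      rw [S.strm_leg hz'.2, S.strm_leg (by simp; linarith), h]; simp
    · rw [S.strm_eq_zero h, S.strm_eq_zero h']; simp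
  · have hz' : |z.re - z.im| < mrg := hz.trans (by linarith [mrg_pos])
    rcases S.L_swap (t := t) hz' with ⟨h, -⟩ | ⟨h, h'⟩
    · rw [S.strm_hyp hz', S.strm_hyp (by rw [I_mul_conj]; simpa [abs_sub_comm] using hz'), h]
      simp; ring
    · rw [S.strm_eq_zero h, S.strm_eq_zero h']; simp
  · exact S.strm_eq_zero (S.not_abs_L_of_small (by linarith [mrg_pos]) (by linarith [mrg_pos]))

/-- Density on the whole square. -/
def ρ : ℝ × ℂ → ℝ := ext 1 S.dens

/-- Stream function on the whole square. -/
def ψ : ℝ × ℂ → ℝ := ext (-1) S.strm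

lemma ρ_tile : Tile 1 S.ρ :=
  S.dens_coneTile.tile (by norm_num) fun _ _ _ _ => S.dens_smooth.contDiffAt

lemma ψ_tile : Tile (-1) S.ψ :=
  S.strm_coneTile.tile (by norm_num) fun _ _ _ _ => S.strm_smooth.contDiffAt

end Strip

/-- Compatibility of the strips of the two base tiles. -/
structure BaseMatch (F E : Strip) : Prop where
  rel : ∀ t c, F.leg t c = 1 - E.hyp t (-c)
  rel' : ∀ t c, F.leg' t c = - E.hyp' t (-c)

namespace BaseMatch

variable {F E : Strip}

lemma level (h : BaseMatch F E) {t : ℝ} {w : ℂ} (hw : |w.im| < mrg / 2) :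
    (F.L (t, w) = -E.L (t, simA w) ∧ |-E.L (t, simA w)| ≤ wid) ∨
      (¬ |F.L (t, w)| ≤ wid ∧ ¬ |-E.L (t, simA w)| ≤ wid) := by
  refine Strip.level_cases fun c hc => ?_
  rw [abs_lt] at hw
  rw [F.L_eq_iff_leg (by linarith [mrg_pos]) hc, neg_eq_iff_eq_neg,
    E.L_eq_iff_hyp (by rw [abs_lt]; constructor <;> simp <;> linarith) (by rwa [abs_neg]), h.rel,
    simA_re, simA_im]
  constructor <;> intro h <;> linarith

lemma match_ρ (h : BaseMatch F E) : Match (-1) F.ρ E.ρ := by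
  refine match_of_cone (by norm_num) F.ρ_tile E.ρ_tile
    ⟨mrg / 2, by linarith [mrg_pos], fun t w a1 a2 c1 c2 => ?_⟩
  unfold Strip.ρ
  rw [ext_of_cone a1 c1, ext_of_cone (by simp; linarith) (by simp; linarith)]
  rcases h.level (t := t) (by rwa [abs_of_nonneg a1] : |w.im| < mrg / 2) with ⟨e, -⟩ | ⟨e, e'⟩
  · unfold Strip.dens; rw [e, prof_neg]; ring
  · rw [abs_neg] at e'
    rw [F.dens_eq_zero e, E.dens_eq_zero e', mul_zero]

lemma match_ψ (h : BaseMatch F E) : Match (1 / 2) F.ψ E.ψ := by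
  refine match_of_cone (by norm_num) F.ψ_tile E.ψ_tile
    ⟨mrg / 2, by linarith [mrg_pos], fun t w a1 a2 c1 c2 => ?_⟩
  unfold Strip.ψ
  rw [ext_of_cone a1 c1, ext_of_cone (by simp; linarith) (by simp; linarith)]
  rcases h.level (t := t) (by rwa [abs_of_nonneg a1] : |w.im| < mrg / 2) with ⟨e, -⟩ | ⟨e, e'⟩
  · rw [F.strm_leg (by linarith [mrg_pos]), E.strm_hyp
      (by rw [abs_lt]; constructor <;> simp <;> linarith), e, cut_neg, h.rel', neg_neg, simA_re,
      simA_im]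
    ring
  · rw [abs_neg] at e'
    rw [F.strm_eq_zero e, E.strm_eq_zero e', mul_zero]

end BaseMatch

/-! ### The first family of strips -/

/-- Position of the first turn. -/
def knot₀ (s : ℝ) : ℝ := (1 + 5 * s) / 20
/-- Half-length of the first turn. -/
def turn₀ (s : ℝ) : ℝ := (1 + 5 * s) / 25
/-- Position of the second turn. -/
def knot₁ (s : ℝ) : ℝ := 7 / 20 + s / 4
/-- Exit position on the diagonal. -/
def exitE (s c : ℝ) : ℝ := 2 / 5 + 3 / 10 * s + (1 - s / 2) * c
/-- Abscissa of the straight part between the turns. -/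
def midE (s c : ℝ) : ℝ :=
  10 / 3 * (areaFn c - exitE s c ^ 2 + 2 * exitE s c * knot₁ s - knot₁ s ^ 2 / 2
    - (3 / 5 + c) * knot₀ s)
/-- Defect of the abscissa at the second turn. -/
def defE (s c : ℝ) : ℝ := 2 * exitE s c - midE s c - knot₁ s
/-- Rounded ramp at the first turn. -/
def ramp₀ (s y : ℝ) : ℝ := turn₀ s * sp ((y - knot₀ s) / turn₀ s)
/-- Rounded ramp at the second turn. -/
def ramp₁ (s y : ℝ) : ℝ := 1 / 25 * sp ((y - knot₁ s) / (1 / 25))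
/-- Slope of `ramp₀`. -/
def slope₀ (s y : ℝ) : ℝ := sp' ((y - knot₀ s) / turn₀ s)
/-- Slope of `ramp₁`. -/
def slope₁ (s y : ℝ) : ℝ := sp' ((y - knot₁ s) / (1 / 25))

/-- The generating function of the first family. -/
def genE (s y c : ℝ) : ℝ :=
  (3 / 5 + c) * y + (midE s c - (3 / 5 + c)) * ramp₀ s y + defE s c * ramp₁ s y
    - ramp₁ s y ^ 2 / 2

/-- The level curves of the first family. -/
def absE (s y c : ℝ) : ℝ :=
  (3 / 5 + c) + (midE s c - (3 / 5 + c)) * slope₀ s y + (defE s c - ramp₁ s y) * slope₁ s y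

/-- Derivative of `midE` in the level. -/
def midE' (s c : ℝ) : ℝ :=
  10 / 3 * (7 / 10 - 2 * (1 - s / 2) * (exitE s c - knot₁ s) - knot₀ s)

/-- Derivative of `absE` in the level. -/
def absE' (s y c : ℝ) : ℝ :=
  1 + (midE' s c - 1) * slope₀ s y + (2 * (1 - s / 2) - midE' s c) * slope₁ s y

section smooth

variable {X : Type*} [NormedAddCommGroup X] [NormedSpace ℝ X] {s y c : X → ℝ}

lemma midE_smooth (hs : ContDiff ℝ ∞ s) (hc : ContDiff ℝ ∞ c) :
    ContDiff ℝ ∞ fun x => midE (s x) (c x) := by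
  unfold midE exitE knot₀ knot₁ areaFn; fun_prop

lemma genE_smooth (hs : ContDiff ℝ ∞ s) (hs0 : ∀ x, 0 ≤ s x) (hy : ContDiff ℝ ∞ y)
    (hc : ContDiff ℝ ∞ c) : ContDiff ℝ ∞ fun x => genE (s x) (y x) (c x) := by
  have hm := midE_smooth hs hc
  have h0 : ContDiff ℝ ∞ fun x => ramp₀ (s x) (y x) := by
    have h1 : ContDiff ℝ ∞ fun x => turn₀ (s x) := by unfold turn₀; fun_prop
    have h2 : ContDiff ℝ ∞ fun x => y x - knot₀ (s x) := by unfold knot₀; fun_prop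
    exact h1.mul (sp_contDiff.comp (h2.div h1 fun x => by
      have := hs0 x; unfold turn₀; positivity))
  have h1 : ContDiff ℝ ∞ fun x => ramp₁ (s x) (y x) := by
    have h2 : ContDiff ℝ ∞ fun x => y x - knot₁ (s x) := by unfold knot₁; fun_prop
    exact contDiff_const.mul (sp_contDiff.comp (h2.div_const _))
  have hd : ContDiff ℝ ∞ fun x => defE (s x) (c x) := by
    unfold defE exitE knot₁; fun_prop
  unfold genE
  fun_prop

end smooth

lemma turn₀_pos {s : ℝ} (hs : 0 ≤ s) : 0 < turn₀ s := by unfold turn₀; positivity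

lemma hasDerivAt_ramp₀ {s : ℝ} (hs : 0 ≤ s) (y : ℝ) : HasDerivAt (ramp₀ s) (slope₀ s y) y := by
  have h := ((hasDerivAt_sp ((y - knot₀ s) / turn₀ s)).comp y
    (((hasDerivAt_id y).sub_const (knot₀ s)).div_const (turn₀ s))).const_mul (turn₀ s)
  have := turn₀_pos hs
  exact h.congr_deriv (by unfold slope₀; field_simp)

lemma hasDerivAt_ramp₁ (s y : ℝ) : HasDerivAt (ramp₁ s) (slope₁ s y) y := by
  have h := ((hasDerivAt_sp ((y - knot₁ s) / (1 / 25))).comp y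
    (((hasDerivAt_id y).sub_const (knot₁ s)).div_const (1 / 25))).const_mul (1 / 25)
  exact h.congr_deriv (by unfold slope₁; field_simp)

lemma hasDerivAt_genE {s : ℝ} (hs : 0 ≤ s) (y c : ℝ) :
    HasDerivAt (fun y => genE s y c) (absE s y c) y := by
  have h0 := hasDerivAt_ramp₀ hs y
  have h1 := hasDerivAt_ramp₁ s y
  have := ((((hasDerivAt_id y).const_mul (3 / 5 + c)).add
    (h0.const_mul (midE s c - (3 / 5 + c)))).add (h1.const_mul (defE s c))).sub
    ((h1.pow 2).div_const 2)
  exact this.congr_deriv (by unfold absE; ring)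

lemma hasDerivAt_absE (s y c : ℝ) : HasDerivAt (fun c => absE s y c) (absE' s y c) c := by
  have hi := hasDerivAt_id c
  have he : HasDerivAt (fun c => exitE s c) (1 - s / 2) c :=
    ((hi.const_mul (1 - s / 2)).const_add (2 / 5 + 3 / 10 * s)).congr_deriv (by ring)
  have ha : HasDerivAt areaFn (7 / 10) c :=
    ((hi.const_mul (7 / 10)).const_add (1 / 4)).congr_deriv (by ring)
  have hm : HasDerivAt (fun c => midE s c) (midE' s c) c := by
    have := ((((ha.sub (he.pow 2)).add ((he.const_mul 2).mul_const (knot₁ s))).sub_const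
      (knot₁ s ^ 2 / 2)).sub ((hi.const_add (3 / 5)).mul_const (knot₀ s))).const_mul (10 / 3)
    exact this.congr_deriv (by unfold midE'; simp; ring)
  have hd : HasDerivAt (fun c => defE s c) (2 * (1 - s / 2) - midE' s c) c :=
    ((he.const_mul 2).sub hm).sub_const _
  have := ((hi.const_add (3 / 5)).add ((hm.sub (hi.const_add (3 / 5))).mul_const
    (slope₀ s y))).add ((hd.sub_const (ramp₁ s y)).mul_const (slope₁ s y))
  exact this.congr_deriv (by unfold absE'; ring)

section zones

variable {s y : ℝ}

lemma ramp₀_of_le (hs : 0 ≤ s) (h : y ≤ (1 + 5 * s) / 100) : ramp₀ s y = 0 := by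
  unfold ramp₀
  rw [sp_of_le, mul_zero]
  rw [div_le_iff₀ (turn₀_pos hs)]
  unfold knot₀ turn₀; linarith

lemma slope₀_of_le (hs : 0 ≤ s) (h : y ≤ (1 + 5 * s) / 100) : slope₀ s y = 0 := by
  unfold slope₀
  rw [sp'_of_le]
  rw [div_le_iff₀ (turn₀_pos hs)]
  unfold knot₀ turn₀; linarith

lemma ramp₀_of_ge (hs : 0 ≤ s) (h : 9 * (1 + 5 * s) / 100 ≤ y) : ramp₀ s y = y - knot₀ s := by
  have h0 := turn₀_pos hs
  unfold ramp₀
  rw [sp_of_ge]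
  · field_simp
  · rw [le_div_iff₀ h0]
    unfold knot₀ turn₀; linarith

lemma slope₀_of_ge (hs : 0 ≤ s) (h : 9 * (1 + 5 * s) / 100 ≤ y) : slope₀ s y = 1 := by
  unfold slope₀
  rw [sp'_of_ge]
  rw [le_div_iff₀ (turn₀_pos hs)]
  unfold knot₀ turn₀; linarith

lemma ramp₁_of_le (h : y ≤ 31 / 100 + s / 4) : ramp₁ s y = 0 := by
  unfold ramp₁
  rw [sp_of_le, mul_zero]
  rw [div_le_iff₀ (by norm_num)]
  unfold knot₁; linarith

lemma slope₁_of_le (h : y ≤ 31 / 100 + s / 4) : slope₁ s y = 0 := by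
  unfold slope₁
  rw [sp'_of_le]
  rw [div_le_iff₀ (by norm_num)]
  unfold knot₁; linarith

lemma ramp₁_of_ge (h : 39 / 100 + s / 4 ≤ y) : ramp₁ s y = y - knot₁ s := by
  unfold ramp₁
  rw [sp_of_ge]
  · ring
  · rw [le_div_iff₀ (by norm_num)]
    unfold knot₁; linarith

lemma slope₁_of_ge (h : 39 / 100 + s / 4 ≤ y) : slope₁ s y = 1 := by
  unfold slope₁
  rw [sp'_of_ge]
  rw [le_div_iff₀ (by norm_num)]
  unfold knot₁; linarith

lemma ramp₁_nonneg : 0 ≤ ramp₁ s y := mul_nonneg (by norm_num) (sp_nonneg _)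

lemma ramp₁_le (h : y ≤ 39 / 100 + s / 4) : ramp₁ s y ≤ 1 / 25 := by
  unfold ramp₁
  have : sp ((y - knot₁ s) / (1 / 25)) ≤ 1 := by
    apply sp_le_one
    rw [div_le_iff₀ (by norm_num)]
    unfold knot₁; linarith
  linarith

lemma slope₀_nonneg : 0 ≤ slope₀ s y := sp'_nonneg _
lemma slope₀_le_one : slope₀ s y ≤ 1 := sp'_le_one _
lemma slope₁_nonneg : 0 ≤ slope₁ s y := sp'_nonneg _
lemma slope₁_le_one : slope₁ s y ≤ 1 := sp'_le_one _

end zones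

section formulas

variable {s y c : ℝ}

lemma genE_leg (hs : 0 ≤ s) (h : y ≤ (1 + 5 * s) / 100) :
    genE s y c = (3 / 5 + c) * y := by
  unfold genE; rw [ramp₀_of_le hs h, ramp₁_of_le (by linarith)]; ring

lemma absE_leg (hs : 0 ≤ s) (h : y ≤ (1 + 5 * s) / 100) :
    absE s y c = 3 / 5 + c := by
  unfold absE; rw [slope₀_of_le hs h, slope₁_of_le (by linarith)]; ring

lemma genE_hyp (hs : 0 ≤ s) (hs1 : s ≤ 1) (h : 39 / 100 + s / 4 ≤ y) :
    genE s y c = areaFn c + y ^ 2 / 2 - (y - exitE s c) ^ 2 := by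
  unfold genE; rw [ramp₀_of_ge hs (by linarith), ramp₁_of_ge h]
  unfold defE midE knot₀ knot₁; ring

lemma absE_hyp (hs : 0 ≤ s) (hs1 : s ≤ 1) (h : 39 / 100 + s / 4 ≤ y) :
    absE s y c = 2 * exitE s c - y := by
  unfold absE; rw [slope₀_of_ge hs (by linarith), slope₁_of_ge h, ramp₁_of_ge h]
  unfold defE; ring

lemma absE'_leg (hs : 0 ≤ s) (h : y ≤ (1 + 5 * s) / 100) : absE' s y c = 1 := by
  unfold absE'; rw [slope₀_of_le hs h, slope₁_of_le (by linarith)]; ring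

lemma absE'_pos (hs : 0 ≤ s) (hs1 : s ≤ 1) (hc : |c| ≤ 6 * wid) : 0 < absE' s y c := by
  rw [abs_le] at hc
  norm_num [wid] at hc
  have hm : 1 / 10 < midE' s c := by
    unfold midE' exitE knot₀ knot₁
    nlinarith [mul_nonneg hs (sub_nonneg.2 hs1), mul_nonneg (mul_nonneg hs hs) (sub_nonneg.2 hs1)]
  have h0 := slope₀_nonneg (s := s) (y := y)
  have h0' := slope₀_le_one (s := s) (y := y)
  have h1 := slope₁_nonneg (s := s) (y := y)
  have h1' := slope₁_le_one (s := s) (y := y)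
  have h01 : slope₁ s y ≤ slope₀ s y := by
    rcases le_total y (31 / 100 + s / 4) with h | h
    · rw [slope₁_of_le h]; exact h0
    · rw [slope₀_of_ge hs (by linarith)]; exact h1'
  have : absE' s y c = (1 - slope₀ s y) + midE' s c * (slope₀ s y - slope₁ s y)
      + (2 - s) * slope₁ s y := by unfold absE'; ring
  rw [this]
  nlinarith [mul_nonneg (sub_nonneg.2 hm.le) (sub_nonneg.2 h01), mul_nonneg (sub_nonneg.2 hs1) h1]

lemma midE_bounds (hs : 0 ≤ s) (hs1 : s ≤ 1) (hc : |c| ≤ 6 * wid) :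
    79 / 100 ≤ midE s c ∧ midE s c ≤ 95 / 100 ∧ defE s c ≤ 1 / 1000 := by
  rw [abs_le] at hc
  norm_num [wid] at hc
  unfold defE midE areaFn exitE knot₀ knot₁
  have := mul_nonneg hs (sub_nonneg.2 hs1)
  have hq : c ^ 2 ≤ 36 / 1000000 := by nlinarith
  refine ⟨?_, ?_, ?_⟩ <;>
    nlinarith [mul_nonneg hs (sub_nonneg.2 hs1), sq_nonneg c,
      mul_nonneg hs (by linarith : 0 ≤ c + 3 / 500), mul_nonneg hs (by linarith : 0 ≤ 3 / 500 - c),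
      mul_nonneg this (by linarith : 0 ≤ c + 3 / 500), mul_nonneg this (by linarith : 0 ≤ 3 / 500 - c),
      mul_nonneg hs (sq_nonneg c), mul_nonneg this (sq_nonneg c)]

lemma absE_le (hs : 0 ≤ s) (hs1 : s ≤ 1) (hc : |c| ≤ 6 * wid) : absE s y c ≤ 1 - 2 * mrg := by
  obtain ⟨h1, h2, h3⟩ := midE_bounds hs hs1 hc
  rw [abs_le] at hc
  norm_num [wid] at hc
  have h0 := slope₀_nonneg (s := s) (y := y)
  have h0' := slope₀_le_one (s := s) (y := y)
  have h4 := slope₁_nonneg (s := s) (y := y)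
  have h4' := slope₁_le_one (s := s) (y := y)
  have h5 := ramp₁_nonneg (s := s) (y := y)
  have e1 : (defE s c - ramp₁ s y) * slope₁ s y ≤ 1 / 1000 := by
    nlinarith [mul_nonneg h5 h4]
  unfold absE mrg
  nlinarith [mul_nonneg (sub_nonneg.2 h0') (by linarith : 0 ≤ midE s c - (3 / 5 + c))]

lemma absE_low (hs : 0 ≤ s) (hs1 : s ≤ 1) (hc : |c| ≤ 2 * wid) (hy : y ≤ 39 / 100 + s / 4) :
    y + 2 * mrg ≤ absE s y c := by
  obtain ⟨h1, h2, h3⟩ := midE_bounds hs hs1 (hc.trans (by norm_num [wid]))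
  rw [abs_le] at hc
  norm_num [wid] at hc
  have h0 := slope₀_nonneg (s := s) (y := y)
  unfold mrg
  rcases le_total y (31 / 100 + s / 4) with h | h
  · unfold absE; rw [slope₁_of_le h]
    nlinarith
  · have h4 := slope₁_nonneg (s := s) (y := y)
    have h4' := slope₁_le_one (s := s) (y := y)
    have h5 := ramp₁_le hy
    have : absE s y c = (1 - slope₁ s y) * midE s c
        + slope₁ s y * (2 * exitE s c - knot₁ s - ramp₁ s y) := by
      unfold absE; rw [slope₀_of_ge hs (by linarith)]; unfold defE; ring
    rw [this]
    have e1 : y + 2 * (1 / 500) ≤ 2 * exitE s c - knot₁ s - ramp₁ s y := by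
      unfold exitE knot₁; nlinarith
    nlinarith [mul_nonneg h4 (sub_nonneg.2 e1),
      mul_nonneg (sub_nonneg.2 h4') (by linarith : 0 ≤ midE s c - (y + 2 * (1 / 500)))]

end formulas

lemma deriv_stepη_hasDerivAt (t : ℝ) : HasDerivAt stepη (deriv stepη t) t :=
  (stepη_contDiff.differentiable (by simp) t).hasDerivAt

/-- The strip which interpolates between the two shapes by moving its exit point. -/
def stripE : Strip where
  A q := genE (stepη q.1) q.2.1 q.2.2
  G q := absE (stepη q.1) q.2.1 q.2.2
  G' q := absE' (stepη q.1) q.2.1 q.2.2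
  leg _ c := 3 / 5 + c
  leg' _ _ := 0
  hyp t c := exitE (stepη t) c
  hyp' t c := deriv stepη t * (3 / 10 - c / 2)
  Z t := 39 / 100 + stepη t / 4
  smooth := genE_smooth (stepη_contDiff.comp contDiff_fst) (fun q => stepη_nonneg _)
    (contDiff_snd.fst) (contDiff_snd.snd)
  hasDerivAt_A t y c := hasDerivAt_genE (stepη_nonneg t) y c
  hasDerivAt_G t y c _ := hasDerivAt_absE (stepη t) y c
  G'_pos t y c hc := absE'_pos (stepη_nonneg t) (stepη_le_one t) (hc.trans (by norm_num [wid]))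
  hasDerivAt_leg t c := hasDerivAt_const t _
  hasDerivAt_hyp t c := by
    have h := deriv_stepη_hasDerivAt t
    have := ((h.const_mul (3 / 10)).const_add (2 / 5)).add
      (((h.div_const 2).const_sub 1).mul_const c)
    exact this.congr_deriv (by ring)
  Z_cont := by have := stepη_contDiff.continuous; fun_prop
  A_leg t y c _ hy := by
    have := stepη_nonneg t
    simp only
    rw [genE_leg this (by norm_num [mrg] at hy; linarith)]; ring
  A_hyp t y c _ hy := genE_hyp (stepη_nonneg t) (stepη_le_one t) hy
  G_low t y c hc hy := by
    have := absE_low (stepη_nonneg t) (stepη_le_one t) (hc.trans (by norm_num [wid])) hy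
    simp only; linarith [mrg_pos]
  G_up t y c hc hy := by
    have := absE_le (y := y) (stepη_nonneg t) (stepη_le_one t) (hc.trans (by norm_num [wid]))
    simp only; linarith [mrg_pos]
  Z_le t c hc := by
    have h0 := stepη_nonneg t
    have h1 := stepη_le_one t
    rw [abs_le] at hc
    norm_num [wid] at hc
    unfold exitE mrg
    nlinarith
  leg_low t c hc := by
    rw [abs_le] at hc
    norm_num [wid] at hc
    linarith

/-! ### The second family of strips -/

/-- Derivative of `absE 1` in the ordinate. -/
def absY (y c : ℝ) : ℝ :=
  (midE 1 c - (3 / 5 + c)) * (spDensity ((y - knot₀ 1) / turn₀ 1) / turn₀ 1)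
    + (defE 1 c - ramp₁ 1 y) * (spDensity ((y - knot₁ 1) / (1 / 25)) / (1 / 25)) - slope₁ 1 y ^ 2

lemma hasDerivAt_absE_comp {Y C : ℝ → ℝ} {Y' C' x : ℝ} (hY : HasDerivAt Y Y' x)
    (hC : HasDerivAt C C' x) :
    HasDerivAt (fun x => absE 1 (Y x) (C x)) (absY (Y x) (C x) * Y' + absE' 1 (Y x) (C x) * C')
      x := by
  have h0 : HasDerivAt (slope₀ 1) (spDensity ((Y x - knot₀ 1) / turn₀ 1) / turn₀ 1) (Y x) := by
    have h := (hasDerivAt_sp' ((Y x - knot₀ 1) / turn₀ 1)).comp (Y x)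
      (((hasDerivAt_id (Y x)).sub_const (knot₀ 1)).div_const (turn₀ 1))
    exact h.congr_deriv (by ring)
  have h1 : HasDerivAt (slope₁ 1) (spDensity ((Y x - knot₁ 1) / (1 / 25)) / (1 / 25)) (Y x) := by
    have h := (hasDerivAt_sp' ((Y x - knot₁ 1) / (1 / 25))).comp (Y x)
      (((hasDerivAt_id (Y x)).sub_const (knot₁ 1)).div_const (1 / 25))
    exact h.congr_deriv (by ring)
  have hr := (hasDerivAt_ramp₁ 1 (Y x)).comp x hY
  have hm : HasDerivAt (fun c => midE 1 c) (midE' 1 (C x)) (C x) := by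
    have h1 : ∀ c, midE 1 c = 4 / 5 + c - 5 / 6 * c ^ 2 := fun c => by
      unfold midE areaFn exitE knot₀ knot₁; ring
    have hi := hasDerivAt_id (C x)
    have := (hi.const_add (4 / 5)).sub ((hi.pow 2).const_mul (5 / 6))
    have e : (fun c => midE 1 c) = fun c => 4 / 5 + c - 5 / 6 * c ^ 2 := funext h1
    rw [e]
    exact this.congr_deriv (by unfold midE' exitE knot₀ knot₁; simp; ring)
  have hd : HasDerivAt (fun c => defE 1 c) (1 - midE' 1 (C x)) (C x) := by
    have he : HasDerivAt (fun c => exitE 1 c) (1 / 2) (C x) :=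
      (((hasDerivAt_id (C x)).const_mul (1 - 1 / 2)).const_add (2 / 5 + 3 / 10 * 1)).congr_deriv
        (by norm_num)
    exact (((he.const_mul 2).sub hm).sub_const _).congr_deriv (by ring)
  have := ((hC.const_add (3 / 5)).add (((hm.comp x hC).sub (hC.const_add (3 / 5))).mul
    (h0.comp x hY))).add (((hd.comp x hC).sub hr).mul (h1.comp x hY))
  exact this.congr_deriv (by unfold absY absE'; simp only [Function.comp, Pi.sub_apply]; ring)

lemma absY_lt {y c : ℝ} (hc : |c| ≤ 6 * wid) : absY y c < 1 := by
  rw [abs_le] at hc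
  norm_num [wid] at hc
  have hq : c ^ 2 ≤ 36 / 1000000 := by nlinarith
  have e1 : midE 1 c - (3 / 5 + c) = 1 / 5 - 5 / 6 * c ^ 2 := by
    unfold midE areaFn exitE knot₀ knot₁; ring
  have e2 : defE 1 c = 5 / 6 * c ^ 2 := by
    unfold defE midE areaFn exitE knot₀ knot₁; ring
  have e3 : turn₀ 1 = 6 / 25 := by unfold turn₀; norm_num
  have h1 := spDensity_nonneg ((y - knot₀ 1) / turn₀ 1)
  have h1' := spDensity_le_one ((y - knot₀ 1) / turn₀ 1)
  have h2 := spDensity_nonneg ((y - knot₁ 1) / (1 / 25))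
  have h2' := spDensity_le_one ((y - knot₁ 1) / (1 / 25))
  have h3 := ramp₁_nonneg (s := 1) (y := y)
  unfold absY
  set u := spDensity ((y - knot₀ 1) / turn₀ 1)
  set v := spDensity ((y - knot₁ 1) / (1 / 25))
  rw [e1, e2, e3]
  nlinarith [sq_nonneg (slope₁ 1 y), mul_nonneg h3 h2, mul_nonneg (sq_nonneg c) h1,
    mul_nonneg (sub_nonneg.2 hq) h2]

/-- Capped level. -/
def capL (c : ℝ) : ℝ := capAt (3 * wid) c

lemma capL_of_abs_le {c : ℝ} (h : |c| ≤ 3 * wid) : capL c = c :=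
  capAt_of_abs_le (by linarith [wid_pos]) h

lemma abs_capL_le (c : ℝ) : |-capL c| ≤ 6 * wid := by
  rw [abs_neg]
  have := abs_capAt_le (a := 3 * wid) (by linarith [wid_pos]) c
  unfold capL; linarith

lemma absE_smooth {X : Type*} [NormedAddCommGroup X] [NormedSpace ℝ X] {s y c : X → ℝ}
    (hs : ContDiff ℝ ∞ s) (hs0 : ∀ x, 0 ≤ s x) (hy : ContDiff ℝ ∞ y)
    (hc : ContDiff ℝ ∞ c) : ContDiff ℝ ∞ fun x => absE (s x) (y x) (c x) := by
  have hm := midE_smooth hs hc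
  have h0 : ContDiff ℝ ∞ fun x => slope₀ (s x) (y x) := by
    have h1 : ContDiff ℝ ∞ fun x => turn₀ (s x) := by unfold turn₀; fun_prop
    have h2 : ContDiff ℝ ∞ fun x => y x - knot₀ (s x) := by unfold knot₀; fun_prop
    exact sp'_contDiff.comp (h2.div h1 fun x => by
      have := hs0 x; unfold turn₀; positivity)
  have h2 : ContDiff ℝ ∞ fun x => y x - knot₁ (s x) := by unfold knot₁; fun_prop
  have h1 : ContDiff ℝ ∞ fun x => ramp₁ (s x) (y x) :=
    contDiff_const.mul (sp_contDiff.comp (h2.div_const _))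
  have h1' : ContDiff ℝ ∞ fun x => slope₁ (s x) (y x) :=
    sp'_contDiff.comp (h2.div_const _)
  have hd : ContDiff ℝ ∞ fun x => defE (s x) (c x) := by
    unfold defE exitE knot₁; fun_prop
  unfold absE
  fun_prop

lemma exists_inner : ∃ Λ : ℝ → ℝ → ℝ, ContDiff ℝ ∞ (fun q : ℝ × ℝ => Λ q.1 q.2) ∧
    ∀ p x Y, Λ p x = Y ↔ Y - absE 1 Y (-capL p) = x := by
  have hcap : ContDiff ℝ ∞ capL := capAt_contDiff _
  have hsm : ContDiff ℝ ∞ fun q : ℝ × ℝ => q.2 - absE 1 q.2 (-capL q.1) :=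
    contDiff_snd.sub (absE_smooth contDiff_const (fun _ => zero_le_one) contDiff_snd
      (hcap.comp contDiff_fst).neg)
  refine exists_smooth_inverse (fun p Y => Y - absE 1 Y (-capL p))
    (fun p Y => 1 - absY Y (-capL p)) hsm ?_ ?_ ?_
  · intro p Y
    have := (hasDerivAt_id Y).sub
      (hasDerivAt_absE_comp (hasDerivAt_id Y) (hasDerivAt_const Y (-capL p)))
    exact this.congr_deriv (by simp)
  · intro p Y
    have := absY_lt (y := Y) (abs_capL_le p)
    linarith
  · intro p
    have hcont : Continuous fun Y => Y - absE 1 Y (-capL p) :=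
      hsm.continuous.comp (Continuous.prodMk_right p)
    refine hcont.surjective ?_ ?_
    · have h1 : Tendsto (fun Y : ℝ => Y + (Y - 2 * exitE 1 (-capL p))) atTop atTop :=
        tendsto_id.atTop_add_atTop (tendsto_atTop_add_const_right _ _ tendsto_id)
      refine h1.congr' ?_
      filter_upwards [eventually_ge_atTop 1] with Y hY
      rw [absE_hyp zero_le_one le_rfl (by linarith)]; ring
    · have h1 : Tendsto (fun Y : ℝ => Y - (3 / 5 + -capL p)) atBot atBot :=
        tendsto_atBot_add_const_right _ _ tendsto_id
      refine h1.congr' ?_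
      filter_upwards [eventually_le_atBot 0] with Y hY
      rw [absE_leg zero_le_one (by linarith)]

/-- The ordinate in the large tile that corresponds to the ordinate `y` in the lower half. -/
def inner (y c : ℝ) : ℝ := exists_inner.choose c (-2 * y)

lemma inner_eq_iff {y c Y : ℝ} : inner y c = Y ↔ absE 1 Y (-capL c) - Y = 2 * y := by
  unfold inner
  rw [exists_inner.choose_spec.2]
  constructor <;> intro h <;> linarith

lemma inner_spec (y c : ℝ) : absE 1 (inner y c) (-capL c) - inner y c = 2 * y :=
  inner_eq_iff.1 rfl

lemma inner_smooth {X : Type*} [NormedAddCommGroup X] [NormedSpace ℝ X] {y c : X → ℝ}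
    (hy : ContDiff ℝ ∞ y) (hc : ContDiff ℝ ∞ c) : ContDiff ℝ ∞ fun x => inner (y x) (c x) :=
  exists_inner.choose_spec.1.comp (hc.prodMk (contDiff_const.mul hy))

/-- Generating function of the lower half. -/
def genLow (y c : ℝ) : ℝ :=
  y - y ^ 2 / 2 - y * inner y c + 1 / 2 * (genE 1 (inner y c) (-capL c) - inner y c ^ 2 / 2)
    - 1 / 2 * areaFn (-capL c)

/-- Generating function of the upper half. -/
def genUp (y c : ℝ) : ℝ :=
  y / 2 + 1 / 4 * (genE 0 (2 * y - 1) c - genE 0 (1 - 2 * y) c - (3 / 5 + c) * (2 * y - 1))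
    - 1 / 2 * areaFn (-c) + 1 / 4 * areaFn c + 1 / 8

/-- Common value of `genLow` and `genUp` in the overlap. -/
def genMid (y c : ℝ) : ℝ :=
  y + y ^ 2 / 2 - (3 / 5 - c) * y + (3 / 5 - c) ^ 2 / 4 - 1 / 2 * areaFn (-c)

/-- Level curves of the upper half. -/
def absUp (y c : ℝ) : ℝ :=
  1 / 2 + 1 / 2 * (absE 0 (2 * y - 1) c + absE 0 (1 - 2 * y) c - (3 / 5 + c))

/-- Level derivative of `absUp`. -/
def absUp' (y c : ℝ) : ℝ := 1 / 2 * (absE' 0 (2 * y - 1) c + absE' 0 (1 - 2 * y) c - 1)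

/-- Generating function of the subdivided strip. -/
def genF (y c : ℝ) : ℝ := genLow y c + genUp y c - genMid y c

/-- Level curves of the subdivided strip. -/
def absF (y c : ℝ) : ℝ := (1 - y - inner y c) + absUp y c - (2 / 5 + c + y)

/-- Level derivative of `absF`. -/
def absF' (y c : ℝ) : ℝ := -deriv (fun c => inner y c) c + absUp' y c - 1

section genF

variable {y c : ℝ}

lemma genUp_eq_mid (hy : y ≤ 61 / 200) : genUp y c = genMid y c := by
  unfold genUp genMid
  rw [genE_leg le_rfl (by linarith), genE_hyp le_rfl zero_le_one (by linarith)]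
  unfold exitE areaFn; ring

lemma absUp_eq_mid (hy : y ≤ 61 / 200) : absUp y c = 2 / 5 + c + y := by
  unfold absUp
  rw [absE_leg le_rfl (by linarith), absE_hyp le_rfl zero_le_one (by linarith)]
  unfold exitE; ring

lemma absUp'_eq_mid (hy : y ≤ 61 / 200) : absUp' y c = 1 := by
  have h1 : HasDerivAt (fun c => absUp y c) (absUp' y c) c := by
    have := (((hasDerivAt_absE 0 (2 * y - 1) c).add (hasDerivAt_absE 0 (1 - 2 * y) c)).sub
      ((hasDerivAt_id c).const_add (3 / 5))).const_mul (1 / 2) |>.const_add (1 / 2)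
    exact this
  have h2 : (fun c => absUp y c) = fun c => 2 / 5 + c + y := funext fun c => absUp_eq_mid hy
  rw [h2] at h1
  exact h1.unique (((hasDerivAt_id c).const_add (2 / 5)).add_const y)

lemma inner_eq_mid (hc : |c| ≤ 3 * wid) (hy : 59 / 200 ≤ y) : inner y c = 3 / 5 - c - 2 * y := by
  rw [inner_eq_iff, capL_of_abs_le hc]
  rw [abs_le] at hc
  norm_num [wid] at hc
  rw [absE_leg zero_le_one (by linarith)]; ring

lemma genLow_eq_mid (hc : |c| ≤ 3 * wid) (hy : 59 / 200 ≤ y) : genLow y c = genMid y c := by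
  unfold genLow genMid
  rw [inner_eq_mid hc hy, capL_of_abs_le hc]
  rw [abs_le] at hc
  norm_num [wid] at hc
  rw [genE_leg zero_le_one (by linarith)]; ring

lemma absF_eq_low (hy : y ≤ 61 / 200) : absF y c = 1 - y - inner y c := by
  unfold absF; rw [absUp_eq_mid hy]; ring

lemma absF_eq_up (hc : |c| ≤ 3 * wid) (hy : 59 / 200 ≤ y) : absF y c = absUp y c := by
  unfold absF; rw [inner_eq_mid hc hy]; ring

lemma absUp_eq_of_le (hy : y ≤ 1 / 2) : absUp y c = 1 / 2 + 1 / 2 * absE 0 (1 - 2 * y) c := by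
  unfold absUp; rw [absE_leg (y := 2 * y - 1) le_rfl (by linarith)]; ring

lemma absUp_eq_of_ge (hy : 1 / 2 ≤ y) : absUp y c = 1 / 2 + 1 / 2 * absE 0 (2 * y - 1) c := by
  unfold absUp; rw [absE_leg (y := 1 - 2 * y) le_rfl (by linarith)]; ring

lemma genF_smooth {X : Type*} [NormedAddCommGroup X] [NormedSpace ℝ X] {y c : X → ℝ}
    (hy : ContDiff ℝ ∞ y) (hc : ContDiff ℝ ∞ c) : ContDiff ℝ ∞ fun x => genF (y x) (c x) := by
  have hi := inner_smooth hy hc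
  have hcap : ContDiff ℝ ∞ fun x => capL (c x) := (capAt_contDiff _).comp hc
  have h1 := genE_smooth (X := X) contDiff_const (fun _ => zero_le_one) hi hcap.neg
  have h2 : ContDiff ℝ ∞ fun x => genE 0 (2 * y x - 1) (c x) :=
    genE_smooth contDiff_const (fun _ => le_rfl) (by fun_prop) hc
  have h3 : ContDiff ℝ ∞ fun x => genE 0 (1 - 2 * y x) (c x) :=
    genE_smooth contDiff_const (fun _ => le_rfl) (by fun_prop) hc
  unfold genF genLow genUp genMid areaFn
  fun_prop

lemma hasDerivAt_genF (y c : ℝ) : HasDerivAt (fun y => genF y c) (absF y c) y := by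
  have hi := hasDerivAt_id y
  have hn : HasDerivAt (fun y => inner y c) (deriv (fun y => inner y c) y) y :=
    ((inner_smooth contDiff_id contDiff_const).differentiable (by simp) y).hasDerivAt
  set n' := deriv (fun y => inner y c) y
  have hsp := inner_spec y c
  have hlow : HasDerivAt (fun y => genLow y c) (1 - y - inner y c) y := by
    have hg := (hasDerivAt_genE zero_le_one (inner y c) (-capL c)).comp y hn
    have := (((hi.sub ((hi.pow 2).div_const 2)).sub (hi.mul hn)).add
      ((hg.sub ((hn.pow 2).div_const 2)).const_mul (1 / 2))).sub_const (1 / 2 * areaFn (-capL c))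
    exact this.congr_deriv (by simp; linear_combination (n' / 2) * hsp)
  have hup : HasDerivAt (fun y => genUp y c) (absUp y c) y := by
    have e1 : HasDerivAt (fun y : ℝ => 2 * y - 1) 2 y :=
      ((hi.const_mul 2).sub_const 1).congr_deriv (by ring)
    have e2 : HasDerivAt (fun y : ℝ => 1 - 2 * y) (-2) y :=
      ((hi.const_mul 2).const_sub 1).congr_deriv (by ring)
    have g1 := (hasDerivAt_genE (s := 0) le_rfl (2 * y - 1) c).comp y e1
    have g2 := (hasDerivAt_genE (s := 0) le_rfl (1 - 2 * y) c).comp y e2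
    have := ((((hi.div_const 2).add (((g1.sub g2).sub (e1.const_mul (3 / 5 + c))).const_mul
      (1 / 4))).sub_const (1 / 2 * areaFn (-c))).add_const (1 / 4 * areaFn c)).add_const (1 / 8)
    exact this.congr_deriv (by unfold absUp; ring)
  have hmid : HasDerivAt (fun y => genMid y c) (2 / 5 + c + y) y := by
    have := ((((hi.add ((hi.pow 2).div_const 2)).sub (hi.const_mul (3 / 5 - c))).add_const
      ((3 / 5 - c) ^ 2 / 4)).sub_const (1 / 2 * areaFn (-c)))
    exact this.congr_deriv (by simp; ring)
  exact (hlow.add hup).sub hmid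

lemma hasDerivAt_inner_level (y c : ℝ) :
    HasDerivAt (fun c => inner y c) (deriv (fun c => inner y c) c) c :=
  ((inner_smooth contDiff_const contDiff_id).differentiable (by simp) c).hasDerivAt

lemma hasDerivAt_absF (y c : ℝ) : HasDerivAt (fun c => absF y c) (absF' y c) c := by
  have h2 : HasDerivAt (fun c => absUp y c) (absUp' y c) c :=
    (((hasDerivAt_absE 0 (2 * y - 1) c).add (hasDerivAt_absE 0 (1 - 2 * y) c)).sub
      ((hasDerivAt_id c).const_add (3 / 5))).const_mul (1 / 2) |>.const_add (1 / 2)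
  have := (((hasDerivAt_inner_level y c).const_sub (1 - y)).add h2).sub
    (((hasDerivAt_id c).const_add (2 / 5)).add_const y)
  exact this

lemma absF'_pos (hc : |c| ≤ 2 * wid) : 0 < absF' y c := by
  have hw := wid_pos
  have h3 : |c| < 3 * wid := by linarith
  unfold absF'
  rcases le_total y (3 / 10) with hy | hy
  · rw [absUp'_eq_mid (by linarith)]
    have hn := hasDerivAt_inner_level y c
    set n' := deriv (fun c => inner y c) c
    have h1 := (hasDerivAt_absE_comp hn (hasDerivAt_neg c)).sub hn
    have h2 : (fun c => absE 1 (inner y c) (-c) - inner y c) =ᶠ[𝓝 c] fun _ => 2 * y := by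
      filter_upwards [continuous_abs.continuousAt.eventually (gt_mem_nhds h3)] with c' hc'
      have := inner_spec y c'
      rwa [capL_of_abs_le (le_of_lt hc')] at this
    have h4 := h1.unique ((hasDerivAt_const c (2 * y)).congr_of_eventuallyEq h2)
    have h6 : |(-c)| ≤ 6 * wid := by rw [abs_neg]; linarith
    have h5 := absY_lt (y := inner y c) h6
    have h7 := absE'_pos (y := inner y c) zero_le_one le_rfl h6
    have h8 : (1 - absY (inner y c) (-c)) * (-n') = absE' 1 (inner y c) (-c) := by
      linear_combination h4
    have : 0 < -n' := by
      by_contra hcon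
      push Not at hcon
      nlinarith [mul_nonneg (sub_nonneg.2 h5.le) (neg_nonneg.2 hcon)]
    linarith
  · have h2 : (fun c => inner y c) =ᶠ[𝓝 c] fun c => 3 / 5 - c - 2 * y := by
      filter_upwards [continuous_abs.continuousAt.eventually (gt_mem_nhds h3)] with c' hc'
      exact inner_eq_mid (le_of_lt hc') (by linarith)
    have h4 : HasDerivAt (fun c : ℝ => 3 / 5 - c - 2 * y) (-1) c :=
      ((hasDerivAt_id c).const_sub (3 / 5)).sub_const _
    rw [h2.deriv_eq, h4.deriv]
    unfold absUp'
    have h6 : |c| ≤ 6 * wid := by linarith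
    rcases le_total y (1 / 2) with h | h
    · rw [absE'_leg (y := 2 * y - 1) le_rfl (by linarith)]
      have := absE'_pos (s := 0) (y := 1 - 2 * y) le_rfl zero_le_one h6
      linarith
    · rw [absE'_leg (y := 1 - 2 * y) le_rfl (by linarith)]
      have := absE'_pos (s := 0) (y := 2 * y - 1) le_rfl zero_le_one h6
      linarith

lemma genF_leg (hc : |c| ≤ wid) (hy : y ≤ mrg) : genF y c = y * (3 / 10 + c / 2) := by
  have hc3 : |c| ≤ 3 * wid := by linarith [wid_pos]
  have hn : inner y c = 7 / 10 - c / 2 - y := by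
    rw [inner_eq_iff, capL_of_abs_le hc3]
    rw [abs_le] at hc
    norm_num [wid] at hc
    norm_num [mrg] at hy
    rw [absE_hyp zero_le_one le_rfl (by linarith)]
    unfold exitE; ring
  rw [abs_le] at hc
  norm_num [wid] at hc
  norm_num [mrg] at hy
  unfold genF
  rw [genUp_eq_mid (by linarith)]
  unfold genLow
  rw [hn, capL_of_abs_le hc3, genE_hyp zero_le_one le_rfl (by linarith)]
  unfold exitE; ring

lemma genF_hyp (hc : |c| ≤ wid) (hy : 139 / 200 ≤ y) :
    genF y c = areaFn c + y ^ 2 / 2 - (y - (7 / 10 + c / 2)) ^ 2 := by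
  have hc3 : |c| ≤ 3 * wid := by linarith [wid_pos]
  unfold genF
  rw [genLow_eq_mid hc3 (by linarith)]
  unfold genUp
  rw [genE_leg (y := 1 - 2 * y) le_rfl (by linarith), genE_hyp le_rfl zero_le_one (by linarith)]
  unfold exitE areaFn; ring

lemma absF_low (hc : |c| ≤ wid) (hy : y ≤ 139 / 200) : y + mrg ≤ absF y c := by
  have hw := wid_pos
  have hc3 : |c| ≤ 3 * wid := by linarith
  have hm := mrg_pos
  have hm' : mrg = 1 / 500 := rfl
  rcases le_total y (61 / 200) with h | h
  · rw [absF_eq_low h]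
    have h1 := inner_spec y c
    have h2 := absE_le (y := inner y c) zero_le_one le_rfl (abs_capL_le c)
    linarith
  · rw [absF_eq_up hc3 (by linarith)]
    rcases le_total y (1 / 2) with h' | h'
    · rw [absUp_eq_of_le h']
      have := absE_low (s := 0) (y := 1 - 2 * y) le_rfl zero_le_one (by linarith : |c| ≤ 2 * wid)
        (by linarith)
      linarith
    · rw [absUp_eq_of_ge h']
      have := absE_low (s := 0) (y := 2 * y - 1) le_rfl zero_le_one (by linarith : |c| ≤ 2 * wid)
        (by linarith)
      linarith

lemma absF_le (hc : |c| ≤ wid) (hy : 0 ≤ y) : absF y c ≤ 1 - mrg := by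
  have hw := wid_pos
  have hc3 : |c| ≤ 3 * wid := by linarith
  have hc6 : |c| ≤ 6 * wid := by linarith
  have hm := mrg_pos
  have hm' : mrg = 1 / 500 := rfl
  rcases le_total y (61 / 200) with h | h
  · rw [absF_eq_low h]
    have h1 := inner_spec y c
    rcases le_total (1 / 100) (inner y c) with h2 | h2
    · linarith
    · rw [absE_leg zero_le_one (by linarith), capL_of_abs_le hc3] at h1
      rw [abs_le] at hc
      norm_num [wid] at hc
      linarith
  · rw [absF_eq_up hc3 (by linarith)]
    rcases le_total y (1 / 2) with h' | h'
    · rw [absUp_eq_of_le h']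
      have := absE_le (s := 0) (y := 1 - 2 * y) le_rfl zero_le_one hc6
      linarith
    · rw [absUp_eq_of_ge h']
      have := absE_le (s := 0) (y := 2 * y - 1) le_rfl zero_le_one hc6
      linarith

lemma absE_one_low (hc : |c| ≤ wid) (hy : y ≤ 139 / 200) : y + mrg ≤ absE 1 y c := by
  have hw := wid_pos
  have hm := mrg_pos
  rcases le_total y (39 / 100 + 1 / 4) with h | h
  · linarith [absE_low zero_le_one le_rfl (by linarith : |c| ≤ 2 * wid) h]
  · rw [absE_hyp zero_le_one le_rfl h]
    rw [abs_le] at hc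
    norm_num [wid] at hc
    unfold exitE mrg
    linarith

end genF

/-- The strip which moves to its own subdivision. -/
def stripF : Strip where
  A q := (1 - stepη q.1) * genE 1 q.2.1 q.2.2 + stepη q.1 * genF q.2.1 q.2.2
  G q := (1 - stepη q.1) * absE 1 q.2.1 q.2.2 + stepη q.1 * absF q.2.1 q.2.2
  G' q := (1 - stepη q.1) * absE' 1 q.2.1 q.2.2 + stepη q.1 * absF' q.2.1 q.2.2
  leg t c := 3 / 5 - 3 / 10 * stepη t + (1 - stepη t / 2) * c
  leg' t c := deriv stepη t * (-3 / 10 - c / 2)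
  hyp _ c := 7 / 10 + c / 2
  hyp' _ _ := 0
  Z _ := 139 / 200
  smooth := by
    have h : ContDiff ℝ ∞ fun q : ℝ × ℝ × ℝ => stepη q.1 := stepη_contDiff.comp contDiff_fst
    exact ((contDiff_const.sub h).mul (genE_smooth contDiff_const (fun _ => zero_le_one)
      contDiff_snd.fst contDiff_snd.snd)).add (h.mul (genF_smooth contDiff_snd.fst
      contDiff_snd.snd))
  hasDerivAt_A t y c := ((hasDerivAt_genE zero_le_one y c).const_mul (1 - stepη t)).add
    ((hasDerivAt_genF y c).const_mul (stepη t))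
  hasDerivAt_G t y c _ := ((hasDerivAt_absE 1 y c).const_mul (1 - stepη t)).add
    ((hasDerivAt_absF y c).const_mul (stepη t))
  G'_pos t y c hc := by
    have h0 := stepη_nonneg t
    have h1 := stepη_le_one t
    have a := absE'_pos (y := y) zero_le_one le_rfl (hc.trans (by norm_num [wid]))
    have b := absF'_pos (y := y) hc
    simp only
    rcases h1.eq_or_lt with h | h
    · rw [h]; linarith
    · nlinarith [mul_nonneg h0 b.le, mul_pos (sub_pos.2 h) a]
  hasDerivAt_leg t c := by
    have h := deriv_stepη_hasDerivAt t
    have := ((h.const_mul (3 / 10)).const_sub (3 / 5)).add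
      (((h.div_const 2).const_sub 1).mul_const c)
    exact this.congr_deriv (by ring)
  hasDerivAt_hyp t c := hasDerivAt_const t _
  Z_cont := continuous_const
  A_leg t y c hc hy := by
    simp only
    rw [genF_leg hc hy, genE_leg zero_le_one (by norm_num [mrg] at hy; linarith)]; ring
  A_hyp t y c hc hy := by
    simp only
    rw [genF_hyp hc hy, genE_hyp zero_le_one le_rfl (by linarith)]
    unfold exitE; ring
  G_low t y c hc hy := by
    have h0 := stepη_nonneg t
    have h1 := stepη_le_one t
    simp only
    nlinarith [mul_nonneg h0 (sub_nonneg.2 (absF_low hc hy)),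
      mul_nonneg (sub_nonneg.2 h1) (sub_nonneg.2 (absE_one_low hc hy))]
  G_up t y c hc hy := by
    have h0 := stepη_nonneg t
    have h1 := stepη_le_one t
    have a := absE_le (y := y) zero_le_one le_rfl (hc.trans (by norm_num [wid] : wid ≤ 6 * wid))
    simp only
    nlinarith [mul_nonneg h0 (sub_nonneg.2 (absF_le hc hy)), mul_nonneg (sub_nonneg.2 h1)
      (sub_nonneg.2 (a.trans (by linarith [mrg_pos] : 1 - 2 * mrg ≤ 1 - mrg)))]
  Z_le t c hc := by
    rw [abs_le] at hc
    norm_num [wid] at hc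
    unfold mrg
    linarith
  leg_low t c hc := by
    have h0 := stepη_nonneg t
    have h1 := stepη_le_one t
    rw [abs_le] at hc
    norm_num [wid] at hc
    nlinarith

lemma baseMatch : BaseMatch stripF stripE := by
  constructor
  · intro t c; simp only [stripF, stripE, exitE]; ring
  · intro t c; simp only [stripF, stripE]; ring

/-! ### Transport under similarities -/

lemma clm_mul_vec (D : ℝ × ℂ →L[ℝ] ℝ) (w : ℂ) :
    D (0, w) = w.re * D (0, 1) + w.im * D (0, Complex.I) := by
  have : ((0, w) : ℝ × ℂ) = w.re • ((0, 1) : ℝ × ℂ) + w.im • ((0, Complex.I) : ℝ × ℂ) := by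
    ext <;> simp
  rw [this, map_add, map_smul, map_smul]; simp

lemma transport_comp {ρ ψ : ℝ × ℂ → ℝ} {w b : ℂ} {a k : ℝ} (hk : k * Complex.normSq w = 1)
    (hρ : Differentiable ℝ ρ) (hψ : Differentiable ℝ ψ) {t : ℝ} {z : ℂ}
    (h : Transport ρ ψ (t, w * z + b)) :
    Transport (fun q => a * ρ (q.1, w * q.2 + b)) (fun q => k * ψ (q.1, w * q.2 + b)) (t, z) := by
  have hT : HasFDerivAt (fun q : ℝ × ℂ => ((q.1, w * q.2 + b) : ℝ × ℂ))
      ((ContinuousLinearMap.fst ℝ ℝ ℂ).prod (w • ContinuousLinearMap.snd ℝ ℝ ℂ)) (t, z) :=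
    hasFDerivAt_fst.prodMk ((hasFDerivAt_snd.const_mul w).add_const b)
  have h1 : ∀ (f : ℝ × ℂ → ℝ) (c : ℝ), Differentiable ℝ f → ∀ v : ℝ × ℂ,
      fderiv ℝ (fun q : ℝ × ℂ => c * f (q.1, w * q.2 + b)) (t, z) v
        = c * fderiv ℝ f (t, w * z + b) (v.1, w * v.2) := by
    intro f c hf v
    have h2 : HasFDerivAt (fun q : ℝ × ℂ => f (q.1, w * q.2 + b)) _ (t, z) :=
      HasFDerivAt.comp (t, z) (g := f) (hf (t, w * z + b)).hasFDerivAt hT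
    rw [(h2.const_mul c).fderiv]
    simp
  unfold Transport at h ⊢
  rw [h1 ρ a hρ, h1 ρ a hρ, h1 ρ a hρ, h1 ψ k hψ, h1 ψ k hψ]
  simp only [mul_zero, mul_one]
  set D := fderiv ℝ ρ (t, w * z + b)
  set D' := fderiv ℝ ψ (t, w * z + b)
  rw [clm_mul_vec D w, clm_mul_vec D' w, clm_mul_vec D (w * Complex.I),
    clm_mul_vec D' (w * Complex.I)]
  simp only [Complex.mul_re, Complex.mul_im, Complex.I_re, Complex.I_im]
  rw [Complex.normSq_apply] at hk
  linear_combination a * h + a * (D' (0, Complex.I) * D (0, 1) - D' (0, 1) * D (0, Complex.I)) * hk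

lemma transport_conj {ρ ψ : ℝ × ℂ → ℝ}
    (hρ : Differentiable ℝ ρ) (hψ : Differentiable ℝ ψ) {t : ℝ} {z : ℂ}
    (h : Transport ρ ψ (t, conj z)) :
    Transport (fun q => ρ (q.1, conj q.2)) (fun q => -ψ (q.1, conj q.2)) (t, z) := by
  have hT : HasFDerivAt (fun q : ℝ × ℂ => ((q.1, conj q.2) : ℝ × ℂ))
      ((ContinuousLinearMap.fst ℝ ℝ ℂ).prod
        ((Complex.conjCLE : ℂ →L[ℝ] ℂ).comp (ContinuousLinearMap.snd ℝ ℝ ℂ))) (t, z) :=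
    hasFDerivAt_fst.prodMk ((Complex.conjCLE : ℂ →L[ℝ] ℂ).hasFDerivAt.comp (t, z) hasFDerivAt_snd)
  have h1 : ∀ f : ℝ × ℂ → ℝ, Differentiable ℝ f → HasFDerivAt (fun q : ℝ × ℂ => f (q.1, conj q.2))
      ((fderiv ℝ f (t, conj z)).comp ((ContinuousLinearMap.fst ℝ ℝ ℂ).prod
        ((Complex.conjCLE : ℂ →L[ℝ] ℂ).comp (ContinuousLinearMap.snd ℝ ℝ ℂ)))) (t, z) :=
    fun f hf => HasFDerivAt.comp (t, z) (g := f) (hf (t, conj z)).hasFDerivAt hT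
  unfold Transport at h ⊢
  have h2 : fderiv ℝ (fun q : ℝ × ℂ => -ψ (q.1, conj q.2)) (t, z) = _ := (h1 ψ hψ).neg.fderiv
  rw [(h1 ρ hρ).fderiv, h2]
  simp
  set D := fderiv ℝ ρ (t, conj z)
  set D' := fderiv ℝ ψ (t, conj z)
  rw [clm_mul_vec D (-Complex.I), clm_mul_vec D' (-Complex.I)]
  simp
  linear_combination h

lemma Transport.congr {ρ ψ ρ' ψ' : ℝ × ℂ → ℝ} {q : ℝ × ℂ} (h : Transport ρ ψ q)
    (h1 : ρ' =ᶠ[𝓝 q] ρ) (h2 : ψ' =ᶠ[𝓝 q] ψ) : Transport ρ' ψ' q := by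
  unfold Transport at *; rw [h1.fderiv_eq, h2.fderiv_eq]; exact h

lemma transport_of_cone {ρ ψ : ℝ × ℂ → ℝ} (hρ : Tile 1 ρ) (hψ : Tile (-1) ψ) {t : ℝ}
    (h : ∀ z : ℂ, 0 ≤ z.im → z.im ≤ z.re → Transport ρ ψ (t, z)) (z : ℂ) :
    Transport ρ ψ (t, z) := by
  have dρ := hρ.smooth.differentiable (by simp)
  have dψ := hψ.smooth.differentiable (by simp)
  refine cone_induction (p := fun z => Transport ρ ψ (t, z)) (fun z hz => ?_) (fun z hz => ?_) h z
  · refine (transport_conj dρ dψ hz).congr (Eventually.of_forall fun q => ?_)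
      (Eventually.of_forall fun q => ?_)
    · simp only; rw [hρ.conj_eq, one_mul]
    · simp only; rw [hψ.conj_eq]; ring
  · have := transport_comp (w := Complex.I) (b := 0) (a := 1) (k := 1) (z := z) (t := t)
      (by simp) dρ dψ (by simpa using hz)
    refine this.congr (Eventually.of_forall fun q => ?_) (Eventually.of_forall fun q => ?_)
    · simp only; rw [add_zero, hρ.rot_eq, one_mul]
    · simp only; rw [add_zero, hψ.rot_eq, one_mul]

lemma simA_eq (z : ℂ) : simA z = (-(1 + Complex.I)) * z + (1 + Complex.I) := by
  unfold simA; ring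

lemma simB_eq (z : ℂ) : simB z = 2 * z + (-1 - Complex.I) := by
  unfold simB; ring

lemma transport_step {ρF ρE ψF ψE : ℝ × ℂ → ℝ} (hF : Tile 1 ρF) (hE : Tile 1 ρE)
    (hM : Match (-1) ρF ρE) (hF' : Tile (-1) ψF) (hE' : Tile (-1) ψE)
    (hM' : Match (1 / 2) ψF ψE) (h1 : ∀ q, Transport ρF ψF q) (h2 : ∀ q, Transport ρE ψE q)
    (q : ℝ × ℂ) : Transport (step 1 (-1) ρF ρE) (step (-1) (1 / 2) ψF ψE) q := by
  have e1 : (1 : ℝ) * 1 = 1 := by norm_num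
  have e2 : (-1 : ℝ) * (-1) = 1 := by norm_num
  obtain ⟨t, z⟩ := q
  refine transport_of_cone (step_tile e1 hF hE hM) (step_tile e2 hF' hE' hM') (fun z h0 h1' => ?_) z
  rcases le_or_gt (z.re + z.im) 1 with h | h
  · refine Transport.congr ?_ (step_eventuallyEq_A e1 hF hE hM t h0 h1' h)
      (step_eventuallyEq_A e2 hF' hE' hM' t h0 h1' h)
    simp only [simA_eq]
    exact transport_comp (by simp [Complex.normSq_apply]; norm_num)
      (hF.smooth.differentiable (by simp)) (hF'.smooth.differentiable (by simp)) (h1 _)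
  · refine Transport.congr ?_ (step_eventuallyEq_B e1 hF hE t h0 h1' h)
      (step_eventuallyEq_B e2 hF' hE' t h0 h1' h)
    simp only [simB_eq]
    exact transport_comp (by simp; norm_num)
      (hE.smooth.differentiable (by simp)) (hE'.smooth.differentiable (by simp)) (h2 _)

lemma Strip.transport_tile (S : Strip) (q : ℝ × ℂ) : Transport S.ρ S.ψ q := by
  obtain ⟨t, z⟩ := q
  exact transport_of_cone S.ρ_tile S.ψ_tile (fun z h0 h1 => (S.transport (t, z)).congr
    (S.dens_coneTile.ext_eventuallyEq (by norm_num) t h0 h1)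
    (S.strm_coneTile.ext_eventuallyEq (by norm_num) t h0 h1)) z

/-! ### Initial and final states of the base tiles -/

lemma ext_congr {ε : ℝ} {f g : ℝ × ℂ → ℝ} {t s : ℝ}
    (h : ∀ z : ℂ, 0 ≤ z.im → z.im ≤ z.re → f (t, z) = g (s, z)) (z : ℂ) :
    ext ε f (t, z) = ext ε g (s, z) := by
  unfold ext
  simp only
  by_cases h1 : |z.im| ≤ |z.re|
  · simp only [if_pos h1]; rw [h _ (abs_nonneg _) h1]
  · simp only [if_neg h1]; rw [h _ (abs_nonneg _) (le_of_not_ge h1)]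

lemma step_congr {ε lam : ℝ} {F E F' E' : ℝ × ℂ → ℝ} {t s : ℝ}
    (h : ∀ z : ℂ, F (t, z) = F' (s, z)) (h' : ∀ z : ℂ, E (t, z) = E' (s, z)) (z : ℂ) :
    step ε lam F E (t, z) = step ε lam F' E' (s, z) :=
  ext_congr (fun z _ _ => by unfold stepCone; simp only [h, h']) z

lemma Strip.dens_congr {S S' : Strip} {t s : ℝ}
    (h : ∀ y c, |c| ≤ wid → S.G (t, y, c) = S'.G (s, y, c)) (z : ℂ) :
    S.dens (t, z) = S'.dens (s, z) := by
  rcases Strip.level_cases (a := S.L (t, z)) (b := S'.L (s, z)) (fun c hc => by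
    rw [S.L_eq_iff hc, S'.L_eq_iff hc]; simp only; rw [h _ _ hc]) with ⟨e, -⟩ | ⟨e, e'⟩
  · unfold Strip.dens; rw [e]
  · rw [S.dens_eq_zero e, S'.dens_eq_zero e']

lemma stripE_ρ_end {t s : ℝ} (ht : 3 / 4 ≤ t) (hs : s ≤ 1 / 4) (z : ℂ) :
    stripE.ρ (t, z) = stripF.ρ (s, z) := by
  refine ext_congr (fun z _ _ => Strip.dens_congr (fun y c _ => ?_) z) z
  simp only [stripE, stripF, stepη_of_ge ht, stepη_of_le hs]; ring

lemma stripF_dens_end {t s : ℝ} (ht : 3 / 4 ≤ t) (hs : s ≤ 1 / 4) {z : ℂ} (h0 : 0 ≤ z.im)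
    (h1 : z.im ≤ z.re) : stripF.dens (t, z) = stepCone (-1) stripF.ρ stripE.ρ (s, z) := by
  have hw := wid_pos
  unfold stepCone
  split_ifs with h <;> simp only at h ⊢
  · have hA : stripF.ρ (s, simA z) = stripF.dens (s, simA z) :=
      ext_of_cone (by simp; linarith) (by simp; linarith)
    rw [hA]
    rcases Strip.level_cases (a := stripF.L (t, z)) (b := -stripF.L (s, simA z)) (fun c hc => by
      rw [neg_eq_iff_eq_neg, stripF.L_eq_iff hc, stripF.L_eq_iff (by rwa [abs_neg])]
      have hc3 : |c| ≤ 3 * wid := by linarith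
      simp only [stripF, stepη_of_ge ht, stepη_of_le hs, simA_re, simA_im]
      have e1 : (1 - (1 : ℝ)) * absE 1 z.im c + 1 * absF z.im c = absF z.im c := by ring
      have e2 : (1 - (0 : ℝ)) * absE 1 (1 - z.re - z.im) (-c) + 0 * absF (1 - z.re - z.im) (-c)
        = absE 1 (1 - z.re - z.im) (-c) := by ring
      rw [e1, e2]
      have e3 := inner_eq_iff (y := z.im) (c := c) (Y := 1 - z.re - z.im)
      rw [capL_of_abs_le hc3] at e3
      have e4 : absE 1 (1 - z.re - z.im) (-c) = 1 - z.re + z.im ↔ inner z.im c = 1 - z.re - z.im := by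
        rw [e3]; constructor <;> intro h <;> linarith
      rw [e4]
      rcases le_total z.im (61 / 200) with hy | hy
      · rw [absF_eq_low hy]; constructor <;> intro h <;> linarith
      · have n1 : absF z.im c ≠ z.re := by
          rw [absF_eq_up hc3 (by linarith), absUp_eq_of_le (by linarith)]
          have := absE_low (s := 0) (y := 1 - 2 * z.im) le_rfl zero_le_one
            (by linarith : |c| ≤ 2 * wid) (by linarith)
          have := mrg_pos
          intro; linarith
        have n2 : inner z.im c ≠ 1 - z.re - z.im := by
          rw [inner_eq_mid hc3 (by linarith)]
          rw [abs_le] at hc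
          norm_num [wid] at hc
          intro; linarith
        tauto) with ⟨e, -⟩ | ⟨e, e'⟩
    · unfold Strip.dens; rw [e, prof_neg]; ring
    · rw [abs_neg] at e'
      rw [stripF.dens_eq_zero e, stripF.dens_eq_zero e', mul_zero]
  · push Not at h
    have key : ∀ w : ℂ, w.re = 2 * z.re - 1 → w.im = |2 * z.im - 1| →
        stripF.dens (t, z) = stripE.dens (s, w) := by
      intro w hre him
      rcases Strip.level_cases (a := stripF.L (t, z)) (b := stripE.L (s, w)) (fun c hc => by
        rw [stripF.L_eq_iff hc, stripE.L_eq_iff hc]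
        have hc3 : |c| ≤ 3 * wid := by linarith
        simp only [stripF, stripE, stepη_of_ge ht, stepη_of_le hs, hre, him]
        have e1 : (1 - (1 : ℝ)) * absE 1 z.im c + 1 * absF z.im c = absF z.im c := by ring
        rw [e1]
        rcases le_total (1 / 2) z.im with hy | hy
        · rw [abs_of_nonneg (by linarith), absF_eq_up hc3 (by linarith), absUp_eq_of_ge hy]
          constructor <;> intro h <;> linarith
        · rw [abs_of_nonpos (by linarith), show -(2 * z.im - 1) = 1 - 2 * z.im by ring]
          rcases le_total (59 / 200) z.im with hy' | hy'
          · rw [absF_eq_up hc3 (by linarith), absUp_eq_of_le hy]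
            constructor <;> intro h <;> linarith
          · have n1 : absF z.im c ≠ z.re := by
              rw [absF_eq_low (by linarith)]
              intro h2
              have hY : inner z.im c < 0 := by linarith
              have hsp := inner_spec z.im c
              rw [capL_of_abs_le hc3, absE_leg zero_le_one (by linarith)] at hsp
              rw [abs_le] at hc
              norm_num [wid] at hc
              linarith
            have n2 : absE 0 (1 - 2 * z.im) c ≠ 2 * z.re - 1 := by
              rw [absE_hyp le_rfl zero_le_one (by linarith)]
              unfold exitE
              rw [abs_le] at hc
              norm_num [wid] at hc
              intro; linarith
            tauto) with ⟨e, -⟩ | ⟨e, e'⟩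
      · unfold Strip.dens; rw [e]
      · rw [stripF.dens_eq_zero e, stripE.dens_eq_zero e']
    rw [show ((-1 : ℝ) ^ 2) = 1 by norm_num, one_mul]
    rcases le_total (1 / 2) z.im with hy | hy
    · rw [key (simB z) (by simp) (by rw [abs_of_nonneg (by linarith)]; simp)]
      exact (ext_of_cone (by simp; linarith) (by simp; linarith)).symm
    · have h2 := stripE.ρ_tile.conj_eq s (simB z)
      rw [one_mul] at h2
      rw [← h2, key (conj (simB z)) (by simp) (by rw [abs_of_nonpos (by linarith)]; simp)]
      exact (ext_of_cone (by simp; linarith) (by simp; linarith)).symm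

lemma stripF_ρ_end {t s : ℝ} (ht : 3 / 4 ≤ t) (hs : s ≤ 1 / 4) (z : ℂ) :
    stripF.ρ (t, z) = step 1 (-1) stripF.ρ stripE.ρ (s, z) :=
  ext_congr (fun _ h0 h1 => stripF_dens_end ht hs h0 h1) z

lemma Strip.ψ_eq_zero {S : Strip} {t : ℝ}
    (h : ∀ y c, (fun s => S.A (s, y, c)) =ᶠ[𝓝 t] fun _ => S.A (t, y, c)) (z : ℂ) :
    S.ψ (t, z) = 0 := by
  have h1 : ∀ y c, S.Ψ (t, y, c) = 0 := fun y c =>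
    (S.hasDerivAt_time t y c).unique ((hasDerivAt_const t _).congr_of_eventuallyEq (h y c))
  unfold Strip.ψ ext Strip.strm
  simp [h1]

lemma stepη_eventually {t : ℝ} (ht : t < 1 / 4 ∨ 3 / 4 < t) : ∀ᶠ s in 𝓝 t, stepη s = stepη t := by
  rcases ht with ht | ht
  · filter_upwards [gt_mem_nhds ht] with s hs
    rw [stepη_of_le hs.le, stepη_of_le ht.le]
  · filter_upwards [lt_mem_nhds ht] with s hs
    rw [stepη_of_ge hs.le, stepη_of_ge ht.le]

lemma stripE_ψ_eq_zero {t : ℝ} (ht : t < 1 / 4 ∨ 3 / 4 < t) (z : ℂ) : stripE.ψ (t, z) = 0 := by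
  refine Strip.ψ_eq_zero (fun y c => ?_) z
  filter_upwards [stepη_eventually ht] with s hs
  simp only [stripE, hs]

lemma stripF_ψ_eq_zero {t : ℝ} (ht : t < 1 / 4 ∨ 3 / 4 < t) (z : ℂ) : stripF.ψ (t, z) = 0 := by
  refine Strip.ψ_eq_zero (fun y c => ?_) z
  filter_upwards [stepη_eventually ht] with s hs
  simp only [stripF, hs]

/-! ### Iterating the substitution -/

/-- The sequence of tiles generated by the substitution. -/
def iter (ε lam : ℝ) (F E : ℝ × ℂ → ℝ) : ℕ → ℝ × ℂ → ℝ
  | 0 => E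
  | 1 => F
  | n + 2 => step ε lam (iter ε lam F E (n + 1)) (iter ε lam F E n)

lemma iter_tile {ε lam : ℝ} {F E : ℝ × ℂ → ℝ} (hε : ε * ε = 1) (hF : Tile ε F) (hE : Tile ε E)
    (hM : Match lam F E) (n : ℕ) :
    Tile ε (iter ε lam F E n) ∧ Tile ε (iter ε lam F E (n + 1)) ∧
      Match lam (iter ε lam F E (n + 1)) (iter ε lam F E n) := by
  induction n with
  | zero => exact ⟨hE, hF, hM⟩
  | succ n ih => exact ⟨ih.2.1, step_tile hε ih.2.1 ih.1 ih.2.2, step_match hε ih.2.1 ih.1 ih.2.2⟩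

/-- The densities of all generations. -/
def R (n : ℕ) : ℝ × ℂ → ℝ := iter 1 (-1) stripF.ρ stripE.ρ n

/-- The stream functions of all generations. -/
def P (n : ℕ) : ℝ × ℂ → ℝ := iter (-1) (1 / 2) stripF.ψ stripE.ψ n

lemma R_succ_succ (n : ℕ) : R (n + 2) = step 1 (-1) (R (n + 1)) (R n) := rfl
lemma P_succ_succ (n : ℕ) : P (n + 2) = step (-1) (1 / 2) (P (n + 1)) (P n) := rfl

lemma R_tile (n : ℕ) : Tile 1 (R n) :=
  (iter_tile (by norm_num) stripF.ρ_tile stripE.ρ_tile baseMatch.match_ρ n).1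

lemma R_match (n : ℕ) : Match (-1) (R (n + 1)) (R n) :=
  (iter_tile (by norm_num) stripF.ρ_tile stripE.ρ_tile baseMatch.match_ρ n).2.2

lemma P_tile (n : ℕ) : Tile (-1) (P n) :=
  (iter_tile (by norm_num) stripF.ψ_tile stripE.ψ_tile baseMatch.match_ψ n).1

lemma P_match (n : ℕ) : Match (1 / 2) (P (n + 1)) (P n) :=
  (iter_tile (by norm_num) stripF.ψ_tile stripE.ψ_tile baseMatch.match_ψ n).2.2

lemma R_transport (n : ℕ) : ∀ q, Transport (R n) (P n) q := by
  induction n using Nat.twoStepInduction with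
  | zero => exact stripE.transport_tile
  | one => exact stripF.transport_tile
  | more n h1 h2 =>
    exact transport_step (R_tile _) (R_tile _) (R_match n) (P_tile _) (P_tile _) (P_match n) h2 h1

lemma R_end (n : ℕ) {t s : ℝ} (ht : 3 / 4 ≤ t) (hs : s ≤ 1 / 4) (z : ℂ) :
    R n (t, z) = R (n + 1) (s, z) := by
  induction n using Nat.twoStepInduction generalizing z with
  | zero => exact stripE_ρ_end ht hs z
  | one => exact stripF_ρ_end ht hs z
  | more n h1 h2 =>
    rw [R_succ_succ, R_succ_succ]
    exact step_congr h2 h1 z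

lemma P_eq_zero (n : ℕ) {t : ℝ} (ht : t < 1 / 4 ∨ 3 / 4 < t) (z : ℂ) : P n (t, z) = 0 := by
  induction n using Nat.twoStepInduction generalizing z with
  | zero => exact stripE_ψ_eq_zero ht z
  | one => exact stripF_ψ_eq_zero ht z
  | more n h1 h2 =>
    rw [P_succ_succ]
    unfold step ext stepCone
    simp [h1, h2]

lemma abs_ext_one_le {f : ℝ × ℂ → ℝ} (h : ∀ q, |f q| ≤ 1) (q : ℝ × ℂ) : |ext 1 f q| ≤ 1 := by
  unfold ext
  split_ifs <;> simp only [one_mul] <;> exact h _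

lemma abs_R_le (n : ℕ) (q : ℝ × ℂ) : |R n q| ≤ 1 := by
  induction n using Nat.twoStepInduction generalizing q with
  | zero => exact abs_ext_one_le (fun q => abs_prof_le _) q
  | one => exact abs_ext_one_le (fun q => abs_prof_le _) q
  | more n h1 h2 =>
    refine abs_ext_one_le (fun q => ?_) q
    unfold stepCone
    split_ifs
    · simpa [R] using h2 _
    · simpa [R] using h1 _

/-! ### Derivative bounds -/

lemma norm_iteratedFDeriv_comp_affine_le {E F G : Type*} [NormedAddCommGroup E] [NormedSpace ℝ E]
    [NormedAddCommGroup F] [NormedSpace ℝ F] [NormedAddCommGroup G] [NormedSpace ℝ G]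
    {f : E → F} (hf : ContDiff ℝ ∞ f) (A : G →L[ℝ] E) (b : E) (k : ℕ) (x : G) :
    ‖iteratedFDeriv ℝ k (fun x => f (A x + b)) x‖
      ≤ ‖A‖ ^ k * ‖iteratedFDeriv ℝ k f (A x + b)‖ := by
  have h1 : ContDiff ℝ ∞ fun y => f (y + b) := hf.comp (contDiff_id.add contDiff_const)
  have h2 := A.iteratedFDeriv_comp_right h1 x (i := k) (by exact_mod_cast le_top)
  have h3 : (fun y => f (y + b)) ∘ A = fun x => f (A x + b) := rfl
  rw [h3, iteratedFDeriv_comp_add_right] at h2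
  rw [h2]
  refine (ContinuousMultilinearMap.norm_compContinuousLinearMap_le _ _).trans (le_of_eq ?_)
  simp [mul_comm]

lemma Tile.slice_smooth {ε : ℝ} {f : ℝ × ℂ → ℝ} (hf : Tile ε f) (t : ℝ) :
    ContDiff ℝ ∞ fun z => f (t, z) := hf.smooth.comp (contDiff_const.prodMk contDiff_id)

lemma norm_iteratedFDeriv_sim_le {f : ℂ → ℝ} (hf : ContDiff ℝ ∞ f) (a : ℝ) (w b : ℂ) (k : ℕ)
    (z : ℂ) : ‖iteratedFDeriv ℝ k (fun z => a * f (w * z + b)) z‖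
      ≤ |a| * ‖w‖ ^ k * ‖iteratedFDeriv ℝ k f (w * z + b)‖ := by
  let A : ℂ →L[ℝ] ℂ := w • ContinuousLinearMap.id ℝ ℂ
  have hA : ∀ z, A z = w * z := fun z => by simp [A]
  have hA' : ‖A‖ ≤ ‖w‖ := A.opNorm_le_bound (norm_nonneg w) fun z => by rw [hA, norm_mul]
  have h1 := norm_iteratedFDeriv_comp_affine_le hf A b k z
  simp only [hA] at h1
  have h2 : ContDiff ℝ k fun z => f (w * z + b) :=
    (hf.comp ((contDiff_const.mul contDiff_id).add contDiff_const)).of_le (by exact_mod_cast le_top)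
  have h3 := iteratedFDeriv_const_smul_apply' (a := a) (h2.contDiffAt (x := z))
  simp only [smul_eq_mul] at h3
  rw [h3, norm_smul, norm_eq_abs, mul_assoc]
  refine mul_le_mul_of_nonneg_left (h1.trans ?_) (abs_nonneg a)
  gcongr

/-- Pointwise bounds for the spatial derivatives of a tile only need to be checked in the
chamber. -/
lemma Tile.norm_iteratedFDeriv_le {ε : ℝ} {f : ℝ × ℂ → ℝ} (hε : ε * ε = 1) (hf : Tile ε f) {t : ℝ}
    {k : ℕ} {C : ℝ}
    (h : ∀ z : ℂ, 0 ≤ z.im → z.im ≤ z.re → ‖iteratedFDeriv ℝ k (fun z => f (t, z)) z‖ ≤ C) (z : ℂ) :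
    ‖iteratedFDeriv ℝ k (fun z => f (t, z)) z‖ ≤ C := by
  have hε' : |ε| = 1 := by
    have : |ε| * |ε| = 1 := by rw [← abs_mul, hε, abs_one]
    nlinarith [abs_nonneg ε]
  refine cone_induction (p := fun z => ‖iteratedFDeriv ℝ k (fun z => f (t, z)) z‖ ≤ C)
    (fun z hz => ?_) (fun z hz => ?_) h z
  · have e : (fun z => f (t, z)) = fun z => ε • (fun z => f (t, z)) (conj z) := by
      funext z; simp only [smul_eq_mul]; rw [hf.conj_eq, ← mul_assoc, hε, one_mul]
    have h2 : ContDiff ℝ k fun z => (fun z => f (t, z)) (conj z) :=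
      ((hf.slice_smooth t).comp Complex.conjCLE.contDiff).of_le (by exact_mod_cast le_top)
    rw [e, iteratedFDeriv_const_smul_apply' h2.contDiffAt, norm_smul, norm_eq_abs, hε', one_mul]
    have := Complex.conjLIE.norm_iteratedFDeriv_comp_right (𝕜 := ℝ) (fun z => f (t, z)) z k
    have e2 : (fun z => f (t, z)) ∘ Complex.conjLIE = fun z => (fun z => f (t, z)) (conj z) := rfl
    rw [e2] at this
    rw [this]; exact hz
  · have e : (fun z => f (t, z)) = fun z => 1 * (fun z => f (t, z)) (Complex.I * z + 0) := by
      funext z; simp only [add_zero, one_mul]; rw [hf.rot_eq]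
    rw [e]
    refine (norm_iteratedFDeriv_sim_le (hf.slice_smooth t) 1 Complex.I 0 k z).trans ?_
    simpa using hz

lemma step_slice_le {ε lam : ℝ} {F E : ℝ × ℂ → ℝ} (hε : ε * ε = 1) (hlam : 0 ≤ lam) (hF : Tile ε F)
    (hE : Tile ε E) (hM : Match lam F E) {t : ℝ} {k : ℕ} {C : ℝ}
    (h1 : ∀ z, lam * √2 ^ k * ‖iteratedFDeriv ℝ k (fun z => F (t, z)) z‖ ≤ C)
    (h2 : ∀ z, (lam * √2 ^ k) ^ 2 * ‖iteratedFDeriv ℝ k (fun z => E (t, z)) z‖ ≤ C) (z : ℂ) :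
    ‖iteratedFDeriv ℝ k (fun z => step ε lam F E (t, z)) z‖ ≤ C := by
  refine (step_tile hε hF hE hM).norm_iteratedFDeriv_le hε (fun z h0 h1' => ?_) z
  have hc : ContinuousAt (fun z : ℂ => ((t, z) : ℝ × ℂ)) z := by fun_prop
  rcases le_or_gt (z.re + z.im) 1 with h | h
  · have e : (fun z => step ε lam F E (t, z)) =ᶠ[𝓝 z]
        fun z => lam * (fun z => F (t, z)) (-(1 + Complex.I) * z + (1 + Complex.I)) := by
      filter_upwards [hc.eventually (step_eventuallyEq_A hε hF hE hM t h0 h1' h)] with w hw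
      simp only [← simA_eq]; exact hw
    rw [(e.iteratedFDeriv ℝ k).eq_of_nhds]
    refine (norm_iteratedFDeriv_sim_le (hF.slice_smooth t) _ _ _ k z).trans ?_
    have hn : ‖-(1 + Complex.I)‖ = √2 := by
      rw [norm_neg, Complex.norm_def, Complex.normSq_apply]; norm_num
    rw [hn, abs_of_nonneg hlam]
    exact h1 _
  · have e : (fun z => step ε lam F E (t, z)) =ᶠ[𝓝 z]
        fun z => lam ^ 2 * (fun z => E (t, z)) (2 * z + (-1 - Complex.I)) := by
      filter_upwards [hc.eventually (step_eventuallyEq_B hε hF hE t h0 h1' h)] with w hw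
      simp only [← simB_eq]; exact hw
    rw [(e.iteratedFDeriv ℝ k).eq_of_nhds]
    refine (norm_iteratedFDeriv_sim_le (hE.slice_smooth t) _ _ _ k z).trans ?_
    rw [abs_of_nonneg (sq_nonneg lam), Complex.norm_ofNat]
    have e2 : (lam * √2 ^ k) ^ 2 = lam ^ 2 * 2 ^ k := by
      rw [mul_pow, ← pow_mul, mul_comm k 2, pow_mul, Real.sq_sqrt (by norm_num)]
    rw [← e2]
    exact h2 _

lemma Tile.hasCompactSupport {ε : ℝ} {f : ℝ × ℂ → ℝ} (hf : Tile ε f)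
    (h : ∀ t z, t < 1 / 4 ∨ 3 / 4 < t → f (t, z) = 0) : HasCompactSupport f := by
  obtain ⟨δ, hδ, -, -, Fr, Fi⟩ := hf.margins'
  refine HasCompactSupport.intro (K := Icc (1 / 4) (3 / 4) ×ˢ Metric.closedBall (0 : ℂ) 2)
    (isCompact_Icc.prod (isCompact_closedBall _ _)) fun q hq => ?_
  obtain ⟨t, z⟩ := q
  by_contra hne
  apply hq
  have ht : ¬ (t < 1 / 4 ∨ 3 / 4 < t) := fun h' => hne (h t z h')
  have hr : |z.re| < 1 := by
    by_contra hr; exact hne (Fr t z (by linarith))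
  have hi : |z.im| < 1 := by
    by_contra hr; exact hne (Fi t z (by linarith))
  push Not at ht
  refine ⟨ht, ?_⟩
  rw [mem_closedBall_zero_iff]
  exact (Complex.norm_le_abs_re_add_abs_im z).trans (by linarith)

lemma Tile.exists_bound {ε : ℝ} {f : ℝ × ℂ → ℝ} (hf : Tile ε f)
    (h : ∀ t z, t < 1 / 4 ∨ 3 / 4 < t → f (t, z) = 0) (k : ℕ) :
    ∃ C, ∀ t z, ‖iteratedFDeriv ℝ k (fun z => f (t, z)) z‖ ≤ C := by
  obtain ⟨C, hC⟩ := ((hf.hasCompactSupport h).iteratedFDeriv (𝕜 := ℝ) k).exists_bound_of_continuous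
    (hf.smooth.continuous_iteratedFDeriv (m := k) (by exact_mod_cast le_top))
  refine ⟨C, fun t z => ?_⟩
  have h1 := norm_iteratedFDeriv_comp_affine_le hf.smooth (ContinuousLinearMap.inr ℝ ℝ ℂ) (t, 0) k z
  have e : (fun z : ℂ => f (ContinuousLinearMap.inr ℝ ℝ ℂ z + (t, 0))) = fun z => f (t, z) := by
    funext z; simp
  rw [e] at h1
  refine h1.trans ((mul_le_of_le_one_left (norm_nonneg _) ?_).trans (hC _))
  exact pow_le_one₀ (norm_nonneg _) (ContinuousLinearMap.norm_inr_le_one ℝ ℝ ℂ)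

lemma P_bound (k : ℕ) : ∃ C, 0 ≤ C ∧ ∀ n t z,
    ‖iteratedFDeriv ℝ k (fun z => P n (t, z)) z‖ ≤ C * (1 / 2 * √2 ^ k) ^ n := by
  obtain ⟨C0, h0⟩ := (P_tile 0).exists_bound (fun t z h => P_eq_zero 0 h z) k
  obtain ⟨C1, h1⟩ := (P_tile 1).exists_bound (fun t z h => P_eq_zero 1 h z) k
  have p0 : 0 ≤ C0 := (norm_nonneg _).trans (h0 0 0)
  have p1 : 0 ≤ C1 := (norm_nonneg _).trans (h1 0 0)
  have hq : 0 < 1 / 2 * √2 ^ k := by positivity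
  set q := 1 / 2 * √2 ^ k with hqdef
  have p2 : 0 ≤ C1 / q := by positivity
  refine ⟨C0 + C1 / q, by positivity, fun n => ?_⟩
  induction n using Nat.twoStepInduction with
  | zero => intro t z; rw [pow_zero]; linarith [h0 t z]
  | one =>
    intro t z
    have : (C0 + C1 / q) * q ^ 1 = C0 * q + C1 := by field_simp
    rw [this]
    have := h1 t z
    nlinarith [mul_nonneg p0 hq.le]
  | more n i1 i2 =>
    intro t z
    rw [P_succ_succ]
    refine step_slice_le (by norm_num) (by norm_num) (P_tile _) (P_tile _) (P_match n) ?_ ?_ z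
    · intro z
      rw [← hqdef]
      calc q * _ ≤ q * ((C0 + C1 / q) * q ^ (n + 1)) := mul_le_mul_of_nonneg_left (i2 t z) hq.le
        _ = _ := by ring
    · intro z
      rw [← hqdef]
      calc q ^ 2 * _ ≤ q ^ 2 * ((C0 + C1 / q) * q ^ n) :=
            mul_le_mul_of_nonneg_left (i1 t z) (by positivity)
        _ = _ := by ring

/-! ### Integration by parts and conservation of mass -/

lemma continuous_fderiv_apply_const {E F : Type*} [NormedAddCommGroup E] [NormedSpace ℝ E] [NormedAddCommGroup F] [NormedSpace ℝ F] {f : E → F}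
    (hf : ContDiff ℝ 1 f) (v : E) : Continuous fun x => fderiv ℝ f x v :=
  (hf.continuous_fderiv one_ne_zero).clm_apply continuous_const

section ibp

variable {E : Type*} [NormedAddCommGroup E] [NormedSpace ℝ E] [FiniteDimensional ℝ E]
  [MeasurableSpace E] [BorelSpace E] {μ : Measure E} [μ.IsAddHaarMeasure]

lemma integral_fderiv_apply_eq_zero {g : E → ℝ} (hg : ContDiff ℝ 1 g) (hc : HasCompactSupport g)
    (v : E) : ∫ x, fderiv ℝ g x v ∂μ = 0 := by
  have h1 : Integrable (fun x => fderiv ℝ g x v) μ :=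
    (continuous_fderiv_apply_const hg v).integrable_of_hasCompactSupport
      (hc.fderiv_apply (𝕜 := ℝ) v)
  have h2 := hg.continuous.integrable_of_hasCompactSupport (μ := μ) hc
  have := integral_mul_fderiv_eq_neg_fderiv_mul_of_integrable (μ := μ) (f := fun _ : E => (1 : ℝ))
    (g := g) (v := v) (by simp) (by simpa using h1) (by simpa using h2)
    (fun _ _ => by fun_prop) (fun x _ => hg.differentiable one_ne_zero x)
  simpa using this

/-- The Poisson bracket of two functions has zero integral. -/
lemma integral_bracket_eq_zero {ψ g : E → ℝ} (hψ : ContDiff ℝ 2 ψ) (hg : ContDiff ℝ 1 g)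
    (hc : HasCompactSupport g) (v w : E) :
    ∫ x, (fderiv ℝ ψ x v * fderiv ℝ g x w - fderiv ℝ ψ x w * fderiv ℝ g x v) ∂μ = 0 := by
  have hd : ∀ v : E, ContDiff ℝ 1 fun x => fderiv ℝ ψ x v := fun v =>
    (hψ.fderiv_right (m := 1) (by norm_num)).clm_apply contDiff_const
  have key : ∀ v w : E, ∀ x, fderiv ℝ (fun x => fderiv ℝ ψ x v * g x) x w =
      fderiv ℝ ψ x v * fderiv ℝ g x w + fderiv ℝ (fderiv ℝ ψ) x w v * g x := by
    intro v w x
    have h1 : HasFDerivAt (fun x => fderiv ℝ ψ x v) ((fderiv ℝ (fderiv ℝ ψ) x).flip v) x := by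
      have := ((hψ.fderiv_right (m := 1) (by norm_num)).differentiable one_ne_zero x).hasFDerivAt
      have h3 := this.clm_apply (hasFDerivAt_const v x)
      refine h3.congr_fderiv ?_
      ext w; simp
    have h2 := (hg.differentiable one_ne_zero x).hasFDerivAt
    have := (h1.mul h2).fderiv
    change fderiv ℝ (fun x => fderiv ℝ ψ x v * g x) x = _ at this
    rw [this]
    simp [mul_comm]
  have hcs : ∀ v : E, HasCompactSupport fun x => fderiv ℝ ψ x v * g x := fun v => hc.mul_left
  have sym : ∀ x, fderiv ℝ (fderiv ℝ ψ) x w v = fderiv ℝ (fderiv ℝ ψ) x v w := fun x =>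
    (hψ.contDiffAt.isSymmSndFDerivAt (by simp)) w v
  have e : (fun x => fderiv ℝ ψ x v * fderiv ℝ g x w - fderiv ℝ ψ x w * fderiv ℝ g x v) = fun x =>
      fderiv ℝ (fun x => fderiv ℝ ψ x v * g x) x w -
        fderiv ℝ (fun x => fderiv ℝ ψ x w * g x) x v := by
    funext x; rw [key, key, sym]; ring
  have hi : ∀ v w : E, Integrable (fun x => fderiv ℝ (fun x => fderiv ℝ ψ x v * g x) x w) μ :=
    fun v w => (continuous_fderiv_apply_const ((hd v).mul hg) w).integrable_of_hasCompactSupport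
      ((hcs v).fderiv_apply (𝕜 := ℝ) w)
  rw [e, integral_sub (hi v w) (hi w v),
    integral_fderiv_apply_eq_zero ((hd v).mul hg) (hcs v),
    integral_fderiv_apply_eq_zero ((hd w).mul hg) (hcs w), sub_zero]

end ibp

lemma Tile.eq_zero_of_two_le {ε : ℝ} {f : ℝ × ℂ → ℝ} (hf : Tile ε f) {t : ℝ} {z : ℂ}
    (hz : 2 ≤ ‖z‖) : f (t, z) = 0 := by
  obtain ⟨δ, hδ, -, -, h1, h2⟩ := hf.margins'
  by_cases h : 1 ≤ |z.re|
  · exact h1 t z (by linarith)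
  · refine h2 t z ?_
    have := Complex.norm_le_abs_re_add_abs_im z
    push Not at h
    linarith

lemma Tile.slice_compact {ε : ℝ} {f : ℝ × ℂ → ℝ} (hf : Tile ε f) (t : ℝ) :
    HasCompactSupport fun z => f (t, z) := by
  refine HasCompactSupport.of_support_subset_isCompact (isCompact_closedBall 0 2) fun z hz => ?_
  by_contra h
  simp only [Metric.mem_closedBall, dist_zero_right, not_le] at h
  exact hz (hf.eq_zero_of_two_le h.le)

lemma fderiv_slice {f : ℝ × ℂ → ℝ} (hf : ContDiff ℝ ∞ f) (t : ℝ) (z v : ℂ) :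
    fderiv ℝ (fun z => f (t, z)) z v = fderiv ℝ f (t, z) (0, v) := by
  have h1 := ((hf.differentiable (by simp)) (t, z)).hasFDerivAt
  have h2 : HasFDerivAt (fun z : ℂ => (t, z)) (ContinuousLinearMap.inr ℝ ℝ ℂ) z :=
    hasFDerivAt_prodMk_right t z
  have := (h1.comp z h2).fderiv
  change fderiv ℝ (fun z => f (t, z)) z = _ at this
  rw [this]; simp

lemma Tile.integral_const {f ψ : ℝ × ℂ → ℝ} (hf : Tile 1 f) (hψ : Tile (-1) ψ)
    (h : ∀ q, Transport f ψ q) (t s : ℝ) : ∫ z, f (t, z) = ∫ z, f (s, z) := by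
  have hd : ∀ t, HasDerivAt (fun t => ∫ z, f (t, z)) 0 t := by
    intro t
    have hfd := hf.smooth.differentiable (by simp)
    have hc1 : Continuous fun q => fderiv ℝ f q (1, 0) :=
      continuous_fderiv_apply_const (contDiff_infty.1 hf.smooth 1) _
    have hz : ∀ x z, 2 ≤ ‖z‖ → 2 < ‖z‖ → fderiv ℝ f (x, z) (1, 0) = 0 := by
      intro x z _ hz
      have : f =ᶠ[𝓝 (x, z)] fun _ => 0 := by
        have : ∀ᶠ q : ℝ × ℂ in 𝓝 (x, z), 2 < ‖q.2‖ :=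
          (continuous_snd.norm.continuousAt).eventually (lt_mem_nhds hz)
        filter_upwards [this] with q hq
        exact hf.eq_zero_of_two_le (t := q.1) hq.le
      rw [this.fderiv_eq]; simp
    obtain ⟨C, hC⟩ := ((isCompact_Icc (a := t - 1) (b := t + 1)).prod
      (isCompact_closedBall (0 : ℂ) 2)).exists_bound_of_continuousOn hc1.continuousOn
    have := hasDerivAt_integral_of_dominated_loc_of_deriv_le (μ := (volume : Measure ℂ))
      (F := fun t z => f (t, z)) (F' := fun t z => fderiv ℝ f (t, z) (1, 0)) (x₀ := t)
      (s := Icc (t - 1) (t + 1)) (bound := (Metric.closedBall (0 : ℂ) 2).indicator fun _ => C)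
      (Icc_mem_nhds (by linarith) (by linarith))
      (Eventually.of_forall fun x => (hf.slice_smooth x).continuous.aestronglyMeasurable)
      ((hf.slice_smooth t).continuous.integrable_of_hasCompactSupport (hf.slice_compact t))
      ((hc1.comp (by fun_prop : Continuous fun z : ℂ => (t, z))).aestronglyMeasurable)
      (Eventually.of_forall fun z x hx => by
        by_cases hz' : ‖z‖ ≤ 2
        · rw [indicator_of_mem (by simpa using hz')]
          exact hC (x, z) ⟨hx, by simpa using hz'⟩
        · push Not at hz'
          rw [hz x z hz'.le hz', indicator_of_notMem (by simpa using hz')]; simp)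
      ((integrable_indicator_iff measurableSet_closedBall).2
        (integrableOn_const (by exact (measure_closedBall_lt_top).ne)))
      (Eventually.of_forall fun z x _ => by
        have h2 : HasDerivAt (fun x : ℝ => (x, z)) ((1 : ℝ), (0 : ℂ)) x :=
          (hasDerivAt_id x).prodMk (hasDerivAt_const x z)
        exact (hfd (x, z)).hasFDerivAt.comp_hasDerivAt x h2)
    refine this.2.congr_deriv ?_
    rw [← neg_eq_zero, ← integral_neg, ← integral_bracket_eq_zero (μ := (volume : Measure ℂ))
      (contDiff_infty.1 (hψ.slice_smooth t) 2)
      (contDiff_infty.1 (hf.slice_smooth t) 1) (hf.slice_compact t) Complex.I 1]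
    congr 1
    funext z
    simp only [fderiv_slice hf.smooth, fderiv_slice hψ.smooth]
    have := h (t, z)
    unfold Transport at this
    linarith
  exact is_const_of_deriv_eq_zero (fun t => (hd t).differentiableAt) (fun t => (hd t).deriv) t s

/-! ### Pairings over the fundamental chamber -/

/-- The fundamental chamber of the dihedral group. -/
def cone : Set ℂ := {z | 0 ≤ z.im ∧ z.im ≤ z.re}

lemma measurableSet_cone : MeasurableSet cone :=
  ((isClosed_le continuous_const Complex.continuous_im).inter
    (isClosed_le Complex.continuous_im Complex.continuous_re)).measurableSet

/-- Pairing over the chamber. -/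
def conePair (f : ℂ → ℝ) (φ : ℂ → ℂ) : ℂ := ∫ z in cone, f z • φ z

lemma volume_line_eq_zero (a b : ℝ) (h : a ≠ 0 ∨ b ≠ 0) :
    volume {z : ℂ | a * z.re + b * z.im = 0} = 0 := by
  set l : ℂ →ₗ[ℝ] ℝ := a • Complex.reLm + b • Complex.imLm with hl
  have e : {z : ℂ | a * z.re + b * z.im = 0} = (LinearMap.ker l : Set ℂ) := by
    ext z; simp [hl]
  rw [e]
  refine Measure.addHaar_submodule _ _ fun htop => ?_
  have h1 : (1 : ℂ) ∈ LinearMap.ker l := htop ▸ Submodule.mem_top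
  have h2 : Complex.I ∈ LinearMap.ker l := htop ▸ Submodule.mem_top
  simp [hl] at h1 h2
  rcases h with h | h
  · exact h h1
  · exact h h2

lemma ae_line_ne_zero (a b : ℝ) (h : a ≠ 0 ∨ b ≠ 0) : ∀ᵐ z : ℂ, a * z.re + b * z.im ≠ 0 := by
  rw [ae_iff]; simpa using volume_line_eq_zero a b h

lemma setIntegral_fold {S H T : Set ℂ} (hH : MeasurableSet H) (σ : ℂ ≃ₗᵢ[ℝ] ℂ)
    (hT : (S ∩ H : Set ℂ) =ᵐ[volume] T) (hσ : σ ⁻¹' (S \ H) =ᵐ[volume] T) {g : ℂ → ℂ} (hg : Integrable g) :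
    ∫ z in S, g z = (∫ z in T, g z) + ∫ z in T, g (σ z) := by
  rw [← integral_inter_add_sdiff hH hg.integrableOn, setIntegral_congr_set hT,
    ← setIntegral_congr_set (f := fun z => g (σ z)) hσ]
  congr 1
  exact (σ.measurePreserving.setIntegral_preimage_emb
    σ.toHomeomorph.measurableEmbedding g (S \ H)).symm

/-- Swapping the coordinates. -/
def swapIso : ℂ ≃ₗᵢ[ℝ] ℂ :=
  Complex.conjLIE.trans (rotation (Circle.ofConjDivSelf (1 - Complex.I) (by
    intro h; simpa using congrArg Complex.re h)))

/-- Reflection in the imaginary axis. -/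
def negConjIso : ℂ ≃ₗᵢ[ℝ] ℂ := Complex.conjLIE.trans (LinearIsometryEquiv.neg ℝ)

lemma swapIso_apply (z : ℂ) : swapIso z = Complex.I * conj z := by
  have h : (1 - Complex.I) ≠ 0 := by intro h; simpa using congrArg Complex.re h
  have e : conj (1 - Complex.I) / (1 - Complex.I) = Complex.I := by
    simp only [map_sub, map_one, Complex.conj_I, sub_neg_eq_add]
    rw [div_eq_iff h]
    linear_combination Complex.I_sq
  change conj (1 - Complex.I) / (1 - Complex.I) * conj z = _
  rw [e]
lemma negConjIso_apply (z : ℂ) : negConjIso z = -conj z := by simp [negConjIso]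

lemma integral_eq_conePair {f : ℂ → ℝ} (hf : Continuous f) (hc : HasCompactSupport f)
    (h1 : ∀ z, f (conj z) = f z) (h2 : ∀ z, f (Complex.I * z) = f z) {φ : ℂ → ℂ}
    (hφ : Continuous φ) : ∃ g : Fin 8 → (ℂ ≃ₗᵢ[ℝ] ℂ),
      ∫ z, f z • φ z = ∑ i, conePair f (fun z => φ (g i z)) := by
  have hn : ∀ z, f (-conj z) = f z := fun z => by
    have : -conj z = Complex.I * (Complex.I * conj z) := by
      rw [← mul_assoc, Complex.I_mul_I, neg_one_mul]
    rw [this, h2, h2, h1]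
  have hs : ∀ z, f (Complex.I * conj z) = f z := fun z => by rw [h2, h1]
  have hi : ∀ φ : ℂ → ℂ, Continuous φ → Integrable fun z => f z • φ z := fun φ hφ =>
    (hf.smul hφ).integrable_of_hasCompactSupport hc.smul_right
  set H1 : Set ℂ := {z | 0 ≤ z.im}
  set H2 : Set ℂ := {z | 0 ≤ z.re}
  set H3 : Set ℂ := {z | z.im ≤ z.re}
  have m1 : MeasurableSet H1 := (isClosed_le continuous_const Complex.continuous_im).measurableSet
  have m2 : MeasurableSet H2 := (isClosed_le continuous_const Complex.continuous_re).measurableSet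
  have m3 : MeasurableSet H3 :=
    (isClosed_le Complex.continuous_im Complex.continuous_re).measurableSet
  have f3 : ∀ φ : ℂ → ℂ, Continuous φ → ∫ z in H1 ∩ H2, f z • φ z =
      conePair f φ + conePair f (fun z => φ (swapIso z)) := by
    intro φ hφ
    have := setIntegral_fold (S := H1 ∩ H2) (T := cone) m3 swapIso
      (Eventually.of_forall fun z => by
        exact propext ⟨fun h => ⟨h.1.1, h.2⟩, fun h => ⟨⟨h.1, h.1.trans h.2⟩, h.2⟩⟩)
      (by
        filter_upwards [ae_line_ne_zero 1 (-1) (by simp)] with z hz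
        simp only [one_mul, neg_mul] at hz
        refine propext ⟨fun h => ?_, fun h => ?_⟩
        · have h' : swapIso z ∈ (H1 ∩ H2) \ H3 := h
          simp [H1, H2, H3, swapIso_apply] at h'
          exact ⟨h'.1.2, h'.2.le⟩
        · change swapIso z ∈ (H1 ∩ H2) \ H3
          have h' : 0 ≤ z.im ∧ z.im ≤ z.re := h
          simp [H1, H2, H3, swapIso_apply]
          refine ⟨⟨h'.1.trans h'.2, h'.1⟩, lt_of_le_of_ne h'.2 fun e => hz (by linarith)⟩) (hi φ hφ)
    rw [this]
    simp only [swapIso_apply, hs]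
    rfl
  have f2 : ∀ φ : ℂ → ℂ, Continuous φ → ∫ z in H1, f z • φ z =
      (∫ z in H1 ∩ H2, f z • φ z) + ∫ z in H1 ∩ H2, f z • φ (negConjIso z) := by
    intro φ hφ
    have := setIntegral_fold (S := H1) (T := H1 ∩ H2) m2 negConjIso (ae_eq_refl _)
      (by
        filter_upwards [ae_line_ne_zero 1 0 (by simp)] with z hz
        simp only [one_mul, zero_mul, add_zero] at hz
        refine propext ⟨fun h => ?_, fun h => ?_⟩
        · have h' : negConjIso z ∈ H1 \ H2 := h
          simp [H1, H2, negConjIso_apply] at h'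
          exact ⟨h'.1, h'.2.le⟩
        · change negConjIso z ∈ H1 \ H2
          have h' : 0 ≤ z.im ∧ 0 ≤ z.re := h
          simp [H1, H2, negConjIso_apply]
          exact ⟨h'.1, lt_of_le_of_ne h'.2 (Ne.symm hz)⟩) (hi φ hφ)
    rw [this]
    simp only [negConjIso_apply, hn]
  have f1 : ∀ φ : ℂ → ℂ, Continuous φ → ∫ z, f z • φ z =
      (∫ z in H1, f z • φ z) + ∫ z in H1, f z • φ (Complex.conjLIE z) := by
    intro φ hφ
    have := setIntegral_fold (S := univ) (T := H1) m1 Complex.conjLIE (by rw [univ_inter]; exact ae_eq_refl _)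
      (by
        filter_upwards [ae_line_ne_zero 0 1 (by simp)] with z hz
        simp only [one_mul, zero_mul, zero_add] at hz
        refine propext ⟨fun h => ?_, fun h => ?_⟩
        · have h' : Complex.conjLIE z ∈ univ \ H1 := h
          simp [H1] at h'
          exact h'.le
        · change Complex.conjLIE z ∈ univ \ H1
          have h' : 0 ≤ z.im := h
          simp [H1]
          exact lt_of_le_of_ne h' (Ne.symm hz)) (hi φ hφ)
    rw [setIntegral_univ] at this
    rw [this]
    simp only [Complex.conjLIE_apply, h1]
  let c : ℂ ≃ₗᵢ[ℝ] ℂ := Complex.conjLIE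
  let i : ℂ ≃ₗᵢ[ℝ] ℂ := LinearIsometryEquiv.refl ℝ ℂ
  refine ⟨![i, swapIso, negConjIso, swapIso.trans negConjIso, c, swapIso.trans c, negConjIso.trans c,
    (swapIso.trans negConjIso).trans c], ?_⟩
  rw [f1 φ hφ, f2 φ hφ, f2 _ (by fun_prop), f3 φ hφ, f3 _ (by fun_prop), f3 _ (by fun_prop),
    f3 _ (by fun_prop)]
  simp [Fin.sum_univ_succ, i, c]
  ring

lemma integral_comp_similarity (w b : ℂ) (hw : w ≠ 0) (G : ℂ → ℂ) :
    ∫ z, G (w * z + b) = (‖w‖ ^ 2)⁻¹ • ∫ z, G z := by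
  have hw' : (‖w‖ : ℂ) ≠ 0 := by simpa using hw
  have hu : w / ‖w‖ ∈ Submonoid.unitSphere ℂ := by
    simp [Submonoid.unitSphere, hw]
  have h1 := (rotation ⟨w / ‖w‖, hu⟩).measurePreserving.integral_comp
    (rotation ⟨w / ‖w‖, hu⟩).toHomeomorph.measurableEmbedding (fun y => G (‖w‖ • y + b))
  have h2 := Measure.integral_comp_smul (volume : Measure ℂ) (fun y => G (y + b)) ‖w‖
  have h3 := integral_add_right_eq_self (μ := (volume : Measure ℂ)) G b
  rw [Complex.finrank_real_complex] at h2
  rw [← h3, ← abs_of_nonneg (a := (‖w‖ ^ 2)⁻¹) (by positivity), ← h2, ← h1]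
  congr 1
  funext z
  have e : (rotation ⟨w / ‖w‖, hu⟩) z = w / ‖w‖ * z := rfl
  rw [e, Complex.real_smul]
  congr 2
  field_simp

/-- Inverse of `simA`. -/
def invA (z : ℂ) : ℂ := 1 - z / (1 + Complex.I)

/-- Inverse of `simB`. -/
def invB (z : ℂ) : ℂ := (z + 1 + Complex.I) / 2

lemma one_add_I_ne_zero : (1 + Complex.I) ≠ 0 := by intro h; simpa using congrArg Complex.re h

lemma invA_simA (z : ℂ) : invA (simA z) = z := by
  have := one_add_I_ne_zero
  unfold invA simA; field_simp; ring

lemma invB_simB (z : ℂ) : invB (simB z) = z := by unfold invB simB; ring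

lemma norm_one_add_I : ‖(1 + Complex.I)‖ = √2 := by
  rw [Complex.norm_def]; congr 1; simp [Complex.normSq]; norm_num

lemma norm_invA_sub (z w : ℂ) : ‖invA z - invA w‖ = (√2)⁻¹ * ‖z - w‖ := by
  have : invA z - invA w = (1 + Complex.I)⁻¹ * -(z - w) := by unfold invA; ring
  rw [this, norm_mul, norm_inv, norm_one_add_I, norm_neg]

lemma norm_invB_sub (z w : ℂ) : ‖invB z - invB w‖ = 1 / 2 * ‖z - w‖ := by
  have : invB z - invB w = (1 / 2) * (z - w) := by unfold invB; ring
  rw [this, norm_mul]; norm_num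

lemma continuous_invA : Continuous invA := by unfold invA; fun_prop
lemma continuous_invB : Continuous invB := by unfold invB; fun_prop

lemma conePair_step {F E : ℝ × ℂ → ℝ} (hF : Tile 1 F) (hE : Tile 1 E) (hM : Match (-1) F E) (t : ℝ)
    {φ : ℂ → ℂ} (hφ : Continuous φ) :
    conePair (fun z => step 1 (-1) F E (t, z)) φ =
      -(1 / 2 : ℝ) • conePair (fun z => F (t, z)) (fun z => φ (invA z)) +
      (1 / 4 : ℝ) • (conePair (fun z => E (t, z)) (fun z => φ (invB z)) +
        conePair (fun z => E (t, z)) (fun z => φ (invB (conj z)))) := by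
  obtain ⟨δ, hδ, -, -, F1, F2⟩ := hF.margins'
  obtain ⟨δ', hδ', -, -, E1, E2⟩ := hE.margins'
  set K' : Set ℂ := {w | w.im ≤ w.re ∧ -w.im < w.re}
  have mK' : MeasurableSet K' :=
    (isClosed_le Complex.continuous_im Complex.continuous_re).measurableSet.inter
      (isOpen_lt Complex.continuous_im.neg Complex.continuous_re).measurableSet
  set gF : ℂ → ℂ := fun z => F (t, z) • φ (invA z) with hgF
  set gE : ℂ → ℂ := fun z => E (t, z) • φ (invB z) with hgE
  have iF : Integrable gF := ((hF.slice_smooth t).continuous.smul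
    (hφ.comp continuous_invA)).integrable_of_hasCompactSupport (hF.slice_compact t).smul_right
  have iE : Integrable gE := ((hE.slice_smooth t).continuous.smul
    (hφ.comp continuous_invB)).integrable_of_hasCompactSupport (hE.slice_compact t).smul_right
  have iS : Integrable fun z => step 1 (-1) F E (t, z) • φ z :=
    have hS := step_tile (by norm_num) hF hE hM
    ((hS.slice_smooth t).continuous.smul hφ).integrable_of_hasCompactSupport
      (hS.slice_compact t).smul_right
  have pt : ∀ z, cone.indicator (fun z => step 1 (-1) F E (t, z) • φ z) z =
      -(cone.indicator gF (simA z)) + K'.indicator gE (simB z) := by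
    intro z
    by_cases hz : z ∈ cone
    · rw [indicator_of_mem hz, step, ext_of_cone hz.1 hz.2, stepCone]
      have hz1 : 0 ≤ z.im := hz.1
      have hz2 : z.im ≤ z.re := hz.2
      by_cases h : z.re + z.im ≤ 1
      · have a1 : simA z ∈ cone := by
          refine ⟨?_, ?_⟩ <;> simp <;> linarith
        have a2 : simB z ∉ K' := by
          rintro ⟨-, h2⟩; simp at h2; linarith
        rw [indicator_of_mem a1, indicator_of_notMem a2]
        simp [h, hgF, invA_simA]
      · have a1 : simA z ∉ cone := by
          rintro ⟨h1, -⟩; simp at h1; linarith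
        have a2 : simB z ∈ K' := by
          push Not at h
          refine ⟨?_, ?_⟩ <;> simp <;> linarith
        rw [indicator_of_notMem a1, indicator_of_mem a2]
        simp [h, hgE, invB_simB]
    · rw [indicator_of_notMem hz]
      have a1 : cone.indicator gF (simA z) = 0 := by
        by_cases h : simA z ∈ cone
        · rw [indicator_of_mem h, hgF]
          have h1 := h.1
          have h2 := h.2
          simp at h1 h2
          have h0 : 0 ≤ z.im := by linarith
          have : z.re < z.im := by
            by_contra h3; push Not at h3; exact hz ⟨h0, h3⟩
          simp only
          rw [F1, zero_smul]
          simp only [simA_re]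
          refine le_trans ?_ (le_abs_self _)
          linarith
        · rw [indicator_of_notMem h]
      have a2 : K'.indicator gE (simB z) = 0 := by
        by_cases h : simB z ∈ K'
        · rw [indicator_of_mem h, hgE]
          have h1 := h.1
          have h2 := h.2
          simp at h1 h2
          have : z.im < 0 := by
            by_contra h3; push Not at h3; exact hz ⟨h3, by linarith⟩
          simp only
          rw [E2, zero_smul]
          simp only [simB_im]
          refine le_trans ?_ (neg_le_abs _)
          linarith
        · rw [indicator_of_notMem h]
      rw [a1, a2]; simp
  have cA := integral_comp_similarity (-(1 + Complex.I)) (1 + Complex.I)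
    (neg_ne_zero.2 one_add_I_ne_zero) (cone.indicator gF)
  have cB := integral_comp_similarity 2 (-1 - Complex.I) two_ne_zero (K'.indicator gE)
  simp only [← simA_eq, ← simB_eq, norm_neg, norm_one_add_I] at cA cB
  have jA : Integrable fun z => cone.indicator gF (simA z) := by
    have := ((hF.slice_smooth t).continuous.comp simA_contDiff.continuous)
    have hc : HasCompactSupport fun z => F (t, simA z) :=
      HasCompactSupport.of_support_subset_isCompact (isCompact_closedBall 1 2) fun z hz => by
        by_contra hn
        simp only [Metric.mem_closedBall, dist_eq_norm, not_le] at hn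
        refine hz (hF.eq_zero_of_two_le ?_)
        rw [simA, norm_mul, norm_one_add_I, norm_sub_rev]
        nlinarith [Real.sqrt_nonneg 2, Real.one_lt_sqrt_two]
    have i0 : Integrable fun z => F (t, simA z) • φ z :=
      (this.smul hφ).integrable_of_hasCompactSupport hc.smul_right
    have := i0.indicator (measurableSet_cone.preimage simA_contDiff.continuous.measurable)
    refine this.congr (Eventually.of_forall fun z => ?_)
    change _ = cone.indicator gF (simA z)
    by_cases h : simA z ∈ cone
    · rw [indicator_of_mem h, indicator_of_mem (show z ∈ simA ⁻¹' cone from h), hgF]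
      simp [invA_simA]
    · rw [indicator_of_notMem h, indicator_of_notMem (show z ∉ simA ⁻¹' cone from h)]
  have jB : Integrable fun z => K'.indicator gE (simB z) := by
    have : (fun z => K'.indicator gE (simB z)) = fun z =>
        cone.indicator (fun z => step 1 (-1) F E (t, z) • φ z) z + cone.indicator gF (simA z) := by
      funext z; rw [pt z]; ring
    rw [this]
    exact (iS.indicator measurableSet_cone).add jA
  have eK : ∫ z in K', gE z = (∫ z in cone, gE z) + ∫ z in cone, gE (Complex.conjLIE z) := by
    refine setIntegral_fold (H := {z : ℂ | 0 ≤ z.im})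
      (isClosed_le continuous_const Complex.continuous_im).measurableSet _ ?_ ?_ iE
    · filter_upwards [ae_line_ne_zero 1 1 (by simp)] with z hz
      simp only [one_mul] at hz
      refine propext ⟨fun h => ⟨h.2, h.1.1⟩, fun h => ⟨⟨h.2, ?_⟩, h.1⟩⟩
      have h1 : 0 ≤ z.im := h.1
      have h2 : z.im ≤ z.re := h.2
      refine lt_of_le_of_ne (by linarith) fun e => hz (by linarith)
    · filter_upwards [ae_line_ne_zero 0 1 (by simp), ae_line_ne_zero 1 (-1) (by simp)] with z hz hz'
      simp only [zero_mul, one_mul, zero_add, neg_mul] at hz hz'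
      refine propext ⟨fun h => ?_, fun h => ?_⟩
      · have h' : Complex.conjLIE z ∈ K' \ {z : ℂ | 0 ≤ z.im} := h
        simp [K'] at h'
        exact ⟨h'.2.le, h'.1.2.le⟩
      · change Complex.conjLIE z ∈ K' \ {z : ℂ | 0 ≤ z.im}
        have h1 : 0 ≤ z.im := h.1
        have h2 : z.im ≤ z.re := h.2
        simp [K']
        refine ⟨⟨by linarith, lt_of_le_of_ne h2 fun e => hz' (by linarith)⟩,
          lt_of_le_of_ne h1 (Ne.symm hz)⟩
  rw [conePair, ← integral_indicator measurableSet_cone]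
  simp_rw [pt]
  rw [integral_add (f := fun z => -cone.indicator gF (simA z)) jA.neg jB, integral_neg, cA, cB, integral_indicator measurableSet_cone,
    integral_indicator mK', eK]
  have hEc : ∀ z, E (t, conj z) = E (t, z) := fun z => by rw [hE.conj_eq]; simp
  simp only [conePair, hgE, hgF, Complex.conjLIE_apply, hEc]
  rw [Real.sq_sqrt (by norm_num)]
  norm_num

lemma continuous_of_norm_sub_le {φ : ℂ → ℂ} {Λ : ℝ} (hΛ : 0 ≤ Λ)
    (hφ : ∀ z w, ‖φ z - φ w‖ ≤ Λ * ‖z - w‖) : Continuous φ := by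
  lift Λ to ℝ≥0 using hΛ
  exact (LipschitzWith.of_dist_le_mul (K := Λ) (by simpa [dist_eq_norm] using hφ)).continuous

/-- The mass over the chamber. -/
lemma Tile.integral_eq {f : ℝ × ℂ → ℝ} (hf : Tile 1 f) (t : ℝ) :
    ((∫ z, f (t, z) : ℝ) : ℂ) = 8 * conePair (fun z => f (t, z)) (fun _ => 1) := by
  obtain ⟨g, hg⟩ := integral_eq_conePair (hf.slice_smooth t).continuous (hf.slice_compact t)
    (fun z => by rw [hf.conj_eq]; simp) (fun z => hf.rot_eq t z) (φ := fun _ => 1) continuous_const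
  rw [Finset.sum_const] at hg
  rw [← integral_complex_ofReal]
  simp only [Finset.card_univ, Fintype.card_fin, nsmul_eq_mul, Complex.real_smul, mul_one] at hg
  rw [hg]; norm_num

lemma conePair_R_one (n : ℕ) (t : ℝ) : conePair (fun z => R n (t, z)) (fun _ => 1) = 0 := by
  have hc : ∀ n t s, conePair (fun z => R n (t, z)) (fun _ => 1) =
      conePair (fun z => R n (s, z)) (fun _ => 1) := by
    intro n t s
    have h1 := (R_tile n).integral_eq t
    rw [(R_tile n).integral_const (P_tile n) (R_transport n) t s, (R_tile n).integral_eq s] at h1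
    exact (mul_left_cancel₀ (by norm_num) h1).symm
  have h0 : ∀ n t, conePair (fun z => R n (t, z)) (fun _ => 1) =
      conePair (fun z => R (n + 1) (t, z)) (fun _ => 1) := by
    intro n t
    rw [hc n t 1, hc (n + 1) t 0]
    congr 1
    funext z
    exact R_end n (by norm_num) (by norm_num) z
  have h2 : conePair (fun z => R 0 (t, z)) (fun _ => 1) = 0 := by
    have := conePair_step (R_tile 1) (R_tile 0) (R_match 0) t (φ := fun _ => 1) continuous_const
    have e : conePair (fun z => step 1 (-1) (R 1) (R 0) (t, z)) (fun _ => 1) =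
      conePair (fun z => R 0 (t, z)) (fun _ => 1) := by rw [h0 0 t, h0 1 t]; rfl
    rw [e, ← h0 0 t] at this
    simp only [Complex.real_smul] at this
    push_cast at this
    linear_combination this
  induction n with
  | zero => exact h2
  | succ n ih => rw [← h0, ih]

lemma conePair_R_base (n : ℕ) (t : ℝ) {φ : ℂ → ℂ} {Λ : ℝ}
    (hφ : ∀ z w, ‖φ z - φ w‖ ≤ Λ * ‖z - w‖) :
    ‖conePair (fun z => R n (t, z)) φ‖ ≤ 2 * Λ * volume.real (Metric.closedBall (0 : ℂ) 2) := by
  have hΛ : 0 ≤ Λ := by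
    have := (norm_nonneg _).trans (hφ 1 0); simpa using this
  have hc : Continuous φ := continuous_of_norm_sub_le hΛ hφ
  have hf := (R_tile n).slice_smooth t
  have hi : ∀ φ : ℂ → ℂ, Continuous φ → Integrable fun z => R n (t, z) • φ z := fun φ hφ =>
    (hf.continuous.smul hφ).integrable_of_hasCompactSupport
      ((R_tile n).slice_compact t).smul_right
  have e : conePair (fun z => R n (t, z)) φ = ∫ z in cone, R n (t, z) • (φ z - φ 0) := by
    have h1 : ∫ z in cone, R n (t, z) • φ 0 = 0 := by
      have := conePair_R_one n t
      unfold conePair at this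
      have e : (fun z => R n (t, z) • φ 0) = fun z => (R n (t, z) • (1 : ℂ)) * φ 0 := by
        funext z; simp
      rw [e, integral_mul_const, this, zero_mul]
    unfold conePair
    simp_rw [smul_sub]
    rw [integral_sub (hi φ hc).integrableOn (hi _ continuous_const).integrableOn, h1, sub_zero]
  rw [e, ← integral_indicator measurableSet_cone]
  have hb : ∀ z, ‖cone.indicator (fun z => R n (t, z) • (φ z - φ 0)) z‖ ≤
      (Metric.closedBall (0 : ℂ) 2).indicator (fun _ => 2 * Λ) z := by
    intro z
    refine (norm_indicator_le_norm_self _ _).trans ?_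
    by_cases hz : ‖z‖ ≤ 2
    · rw [indicator_of_mem (by simpa using hz), norm_smul, Real.norm_eq_abs]
      have h1 := abs_R_le n (t, z)
      have h2 := hφ z 0
      rw [sub_zero] at h2
      calc _ ≤ 1 * (Λ * ‖z‖) := mul_le_mul h1 h2 (norm_nonneg _) zero_le_one
        _ ≤ _ := by nlinarith
    · push Not at hz
      rw [indicator_of_notMem (by simpa using hz), (R_tile n).eq_zero_of_two_le hz.le]; simp
  refine (norm_integral_le_of_norm_le ?_ (Eventually.of_forall hb)).trans ?_
  · exact (integrable_indicator_iff measurableSet_closedBall).2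
      (integrableOn_const (measure_closedBall_lt_top).ne)
  · rw [integral_indicator measurableSet_closedBall, setIntegral_const, smul_eq_mul, mul_comm]

/-- The pairings with Lipschitz functions decay exponentially in the generation. -/
lemma conePair_R_le : ∃ C, 0 ≤ C ∧ ∀ n t (φ : ℂ → ℂ) (Λ : ℝ), 0 ≤ Λ →
    (∀ z w, ‖φ z - φ w‖ ≤ Λ * ‖z - w‖) →
    ‖conePair (fun z => R n (t, z)) φ‖ ≤ C * Λ * (√2)⁻¹ ^ n := by
  set V := volume.real (Metric.closedBall (0 : ℂ) 2)
  have hV : 0 ≤ V := measureReal_nonneg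
  have s1 : 1 ≤ √2 := Real.one_lt_sqrt_two.le
  have s2 : √2 * √2 = 2 := Real.mul_self_sqrt (by norm_num)
  have s3 : (√2)⁻¹ * (√2)⁻¹ = 1 / 2 := by rw [← mul_inv, s2]; norm_num
  have s4 : √2 ≤ 2 := by nlinarith
  refine ⟨4 * V, by positivity, fun n t => ?_⟩
  induction n using Nat.twoStepInduction with
  | zero =>
    intro φ Λ hΛ hφ
    refine (conePair_R_base 0 t hφ).trans ?_
    rw [pow_zero]
    nlinarith [mul_nonneg hΛ hV]
  | one =>
    intro φ Λ hΛ hφ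
    refine (conePair_R_base 1 t hφ).trans ?_
    rw [pow_one]
    have : 1 / 2 ≤ (√2)⁻¹ := by rw [one_div]; exact inv_anti₀ (by positivity) s4
    nlinarith [mul_nonneg hΛ hV, mul_nonneg (mul_nonneg hΛ hV) (sub_nonneg.2 this)]
  | more n i1 i2 =>
    intro φ Λ hΛ hφ
    have hc : Continuous φ := continuous_of_norm_sub_le hΛ hφ
    have hA := i2 (fun z => φ (invA z)) (Λ * (√2)⁻¹) (by positivity) (fun z w => by
      refine (hφ _ _).trans_eq ?_
      rw [norm_invA_sub, mul_assoc])
    have hB := i1 (fun z => φ (invB z)) (Λ * (1 / 2)) (by positivity) (fun z w => by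
      refine (hφ _ _).trans_eq ?_
      rw [norm_invB_sub, mul_assoc])
    have hB' := i1 (fun z => φ (invB (conj z))) (Λ * (1 / 2)) (by positivity) (fun z w => by
      refine (hφ _ _).trans_eq ?_
      rw [norm_invB_sub, mul_assoc, ← map_sub, RCLike.norm_conj])
    have := conePair_step (R_tile (n + 1)) (R_tile n) (R_match n) t hc
    rw [← R_succ_succ] at this
    rw [this]
    refine (norm_add_le _ _).trans ?_
    rw [norm_smul, norm_smul]
    have h3 := norm_add_le (conePair (fun z => R n (t, z)) (fun z => φ (invB z)))
      (conePair (fun z => R n (t, z)) (fun z => φ (invB (conj z))))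
    have e : (√2)⁻¹ ^ (n + 2) = 1 / 2 * (√2)⁻¹ ^ n := by rw [pow_add, sq, s3]; ring
    have e' : (√2)⁻¹ * (√2)⁻¹ ^ (n + 1) = 1 / 2 * (√2)⁻¹ ^ n := by
      rw [pow_succ, mul_comm ((√2)⁻¹ ^ n), ← mul_assoc, s3]
    rw [e]
    have hA' : ‖conePair (fun z => R (n + 1) (t, z)) (fun z => φ (invA z))‖ ≤
        4 * V * Λ * (1 / 2 * (√2)⁻¹ ^ n) := by
      rw [← e']; refine hA.trans_eq ?_; ring
    norm_num
    norm_num at hA' hB hB'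
    linarith

/-- The densities, viewed as functionals on Lipschitz functions, decay exponentially. -/
lemma integral_R_mul_le : ∃ C, 0 ≤ C ∧ ∀ n t (φ : ℂ → ℂ) (Λ : ℝ), 0 ≤ Λ →
    (∀ z w, ‖φ z - φ w‖ ≤ Λ * ‖z - w‖) →
    ‖∫ z, R n (t, z) • φ z‖ ≤ C * Λ * (√2)⁻¹ ^ n := by
  obtain ⟨C, hC, h⟩ := conePair_R_le
  refine ⟨8 * C, by positivity, fun n t φ Λ hΛ hφ => ?_⟩
  have hc : Continuous φ := continuous_of_norm_sub_le hΛ hφ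
  have hf := R_tile n
  obtain ⟨g, hg⟩ := integral_eq_conePair (hf.slice_smooth t).continuous (hf.slice_compact t)
    (fun z => by rw [hf.conj_eq]; simp) (fun z => hf.rot_eq t z) hc
  rw [hg]
  refine (norm_sum_le_of_le _ (fun i _ => h n t (fun z => φ (g i z)) Λ hΛ fun z w => ?_)).trans_eq ?_
  · refine (hφ _ _).trans_eq ?_
    rw [← map_sub, LinearIsometryEquiv.norm_map]
  · simp; ring

/-! ### Concatenation in time -/

/-- Gluing a sequence of functions over the consecutive unit time intervals. -/
def glue (f : ℕ → ℝ × ℂ → ℝ) (q : ℝ × ℂ) : ℝ := f ⌊q.1⌋₊ (q.1 - ⌊q.1⌋₊, q.2)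

lemma glue_eq {f : ℕ → ℝ × ℂ → ℝ}
    (hf : ∀ n t s z, 3 / 4 < t → s < 1 / 4 → f n (t, z) = f (n + 1) (s, z))
    (n : ℕ) {t : ℝ} (h1 : n = 0 ∨ n - 1 / 4 < t) (h2 : t < n + 1) (z : ℂ) :
    glue f (t, z) = f n (t - n, z) := by
  unfold glue
  simp only
  rcases le_or_gt (n : ℝ) t with h | h
  · rw [(Nat.floor_eq_iff (by linarith [n.cast_nonneg (α := ℝ)])).2 ⟨h, h2⟩]
  · rcases n with _ | m
    · rw [Nat.floor_of_nonpos (by simpa using h.le)]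
    · push_cast at *
      have h3 : (m : ℝ) + 1 - 1 / 4 < t := by simpa using h1
      have e : ⌊t⌋₊ = m := (Nat.floor_eq_iff (by linarith [m.cast_nonneg (α := ℝ)])).2
        ⟨by linarith, h⟩
      rw [e]
      exact hf m _ _ z (by linarith) (by linarith)

lemma exists_glue_eventuallyEq (t : ℝ) : ∃ n : ℕ, ∀ f : ℕ → ℝ × ℂ → ℝ,
    (∀ n t s z, 3 / 4 < t → s < 1 / 4 → f n (t, z) = f (n + 1) (s, z)) → ∀ z,
    glue f =ᶠ[𝓝 (t, z)] fun q => f n (q.1 - n, q.2) := by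
  refine ⟨⌊t⌋₊, fun f hf z => ?_⟩
  have h2 : ∀ᶠ q : ℝ × ℂ in 𝓝 (t, z), q.1 < ⌊t⌋₊ + 1 :=
    continuous_fst.continuousAt.eventually (gt_mem_nhds (Nat.lt_floor_add_one t))
  have h1 : ∀ᶠ q : ℝ × ℂ in 𝓝 (t, z), ⌊t⌋₊ = 0 ∨ (⌊t⌋₊ : ℝ) - 1 / 4 < q.1 := by
    rcases Nat.eq_zero_or_pos ⌊t⌋₊ with h | h
    · exact Eventually.of_forall fun _ => Or.inl h
    · have : (⌊t⌋₊ : ℝ) - 1 / 4 < t := by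
        have := Nat.floor_le (Nat.pos_of_floor_pos h).le
        linarith
      exact (continuous_fst.continuousAt.eventually (lt_mem_nhds this)).mono fun _ h => Or.inr h
  filter_upwards [h1, h2] with q h1 h2
  exact glue_eq hf _ h1 h2 q.2

/-- The planar density. -/
def planeρ : ℝ × ℂ → ℝ := glue R

/-- The planar stream function. -/
def planeψ : ℝ × ℂ → ℝ := glue P

lemma R_glue (n : ℕ) (t s : ℝ) (z : ℂ) (ht : 3 / 4 < t) (hs : s < 1 / 4) :
    R n (t, z) = R (n + 1) (s, z) := R_end n ht.le hs.le z

lemma P_glue (n : ℕ) (t s : ℝ) (z : ℂ) (ht : 3 / 4 < t) (hs : s < 1 / 4) :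
    P n (t, z) = P (n + 1) (s, z) := by
  rw [P_eq_zero n (Or.inr ht), P_eq_zero (n + 1) (Or.inl hs)]

lemma glue_contDiff {f : ℕ → ℝ × ℂ → ℝ}
    (hf : ∀ n t s z, 3 / 4 < t → s < 1 / 4 → f n (t, z) = f (n + 1) (s, z))
    (hs : ∀ n, ContDiff ℝ ∞ (f n)) : ContDiff ℝ ∞ (glue f) := by
  rw [contDiff_iff_contDiffAt]
  rintro ⟨t, z⟩
  obtain ⟨n, hn⟩ := exists_glue_eventuallyEq t
  refine ContDiffAt.congr_of_eventuallyEq ?_ (hn f hf z)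
  exact ((hs n).comp (by fun_prop : ContDiff ℝ ∞ fun q : ℝ × ℂ => (q.1 - n, q.2))).contDiffAt

lemma planeρ_contDiff : ContDiff ℝ ∞ planeρ := glue_contDiff R_glue fun n => (R_tile n).smooth
lemma planeψ_contDiff : ContDiff ℝ ∞ planeψ := glue_contDiff P_glue fun n => (P_tile n).smooth

lemma plane_transport (q : ℝ × ℂ) : Transport planeρ planeψ q := by
  obtain ⟨t, z⟩ := q
  obtain ⟨n, hn⟩ := exists_glue_eventuallyEq t
  refine Transport.congr ?_ (hn R R_glue z) (hn P P_glue z)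
  have h := R_transport n (t - n, z)
  have e : ∀ f : ℝ × ℂ → ℝ, fderiv ℝ (fun q : ℝ × ℂ => f (q.1 - n, q.2)) (t, z) =
      fderiv ℝ f (t - n, z) := by
    intro f
    have := fderiv_comp_sub (𝕜 := ℝ) (f := f) (x := (t, z)) ((n : ℝ), (0 : ℂ))
    simpa [Prod.mk_sub_mk, Prod.sub_def] using this
  unfold Transport at h ⊢
  rw [e, e]; exact h

lemma planeρ_ne_zero : ∃ z, planeρ (0, z) ≠ 0 := by
  refine ⟨((3 / 5 + wid / 4 : ℝ) : ℂ), ?_⟩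
  have h : planeρ (0, ((3 / 5 + wid / 4 : ℝ) : ℂ)) = stripE.ρ (0, ((3 / 5 + wid / 4 : ℝ) : ℂ)) := by
    simp [planeρ, glue, R, iter]
  have hw := wid_pos
  rw [h, Strip.ρ, ext_of_cone (by simp) (by rw [Complex.ofReal_re, Complex.ofReal_im]; positivity)]
  have hL : stripE.L (0, ((3 / 5 + wid / 4 : ℝ) : ℂ)) = wid / 4 := by
    rw [stripE.L_eq_iff_leg (by simp [mrg]) (by rw [abs_of_pos] <;> linarith)]
    rw [Complex.ofReal_re]; rfl
  rw [Strip.dens, hL]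
  exact prof_ne_zero

lemma abs_planeρ_le (q : ℝ × ℂ) : |planeρ q| ≤ 1 := abs_R_le _ _

lemma planeρ_eq_zero {t : ℝ} {z : ℂ} (h : 1 ≤ |z.re| ∨ 1 ≤ |z.im|) : planeρ (t, z) = 0 := by
  obtain ⟨δ, hδ, -, -, h1, h2⟩ := (R_tile ⌊t⌋₊).margins'
  rcases h with h | h
  · exact h1 _ z (by linarith)
  · exact h2 _ z (by linarith)

lemma planeψ_eq_zero {t : ℝ} {z : ℂ} (h : 1 ≤ |z.re| ∨ 1 ≤ |z.im|) : planeψ (t, z) = 0 := by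
  obtain ⟨δ, hδ, -, -, h1, h2⟩ := (P_tile ⌊t⌋₊).margins'
  rcases h with h | h
  · exact h1 _ z (by linarith)
  · exact h2 _ z (by linarith)

/-- The length scale at a given time. -/
def scale (t : ℝ) : ℝ := (√2)⁻¹ ^ ⌊t⌋₊

lemma scale_pos (t : ℝ) : 0 < scale t := by unfold scale; positivity

lemma scale_le_one (t : ℝ) : scale t ≤ 1 :=
  pow_le_one₀ (by positivity) (inv_le_one_of_one_le₀ Real.one_lt_sqrt_two.le)

lemma planeψ_bound (k : ℕ) : ∃ C, 0 ≤ C ∧ ∀ t z,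
    ‖iteratedFDeriv ℝ k (fun z => planeψ (t, z)) z‖ ≤ C * (scale t ^ 2 * (scale t)⁻¹ ^ k) := by
  obtain ⟨C, hC, h⟩ := P_bound k
  refine ⟨C, hC, fun t z => (h ⌊t⌋₊ (t - ⌊t⌋₊) z).trans_eq ?_⟩
  have s2 : 1 / 2 = (√2)⁻¹ ^ 2 := by
    rw [inv_pow, Real.sq_sqrt (by norm_num)]; norm_num
  rw [s2]
  unfold scale
  rw [← inv_pow, inv_inv, mul_pow, ← pow_mul, ← pow_mul, ← pow_mul, ← pow_mul, mul_comm 2,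
    mul_comm k]

lemma integral_planeρ_mul_le : ∃ C, 0 ≤ C ∧ ∀ t (φ : ℂ → ℂ) (Λ : ℝ), 0 ≤ Λ →
    (∀ z w, ‖φ z - φ w‖ ≤ Λ * ‖z - w‖) →
    ‖∫ z, planeρ (t, z) • φ z‖ ≤ C * Λ * scale t := by
  obtain ⟨C, hC, h⟩ := integral_R_mul_le
  exact ⟨C, hC, fun t => h ⌊t⌋₊ (t - ⌊t⌋₊)⟩

/-! ### The construction in arbitrary dimension -/

section dimension

variable {m : ℕ}

/-- The first two coordinates as a complex number. -/
def headC : Euc (m + 2) →L[ℝ] ℂ :=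
  (EuclideanSpace.proj 0 : Euc (m + 2) →L[ℝ] ℝ).smulRight 1 +
    (EuclideanSpace.proj 1 : Euc (m + 2) →L[ℝ] ℝ).smulRight Complex.I

/-- The remaining coordinates. -/
def tailC : Euc (m + 2) →L[ℝ] Euc m :=
  (PiLp.continuousLinearEquiv 2 ℝ (fun _ : Fin m => ℝ)).symm.toContinuousLinearMap.comp
    (ContinuousLinearMap.pi fun i => (EuclideanSpace.proj i.succ.succ : Euc (m + 2) →L[ℝ] ℝ))

/-- The point with given head and tail. -/
def comb (z : ℂ) (y : Fin m → ℝ) : Euc (m + 2) :=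
  WithLp.toLp 2 (Fin.cons z.re (Fin.cons z.im y : Fin (m + 1) → ℝ) : Fin (m + 2) → ℝ)

lemma headC_apply (x : Euc (m + 2)) : headC x = ⟨x 0, x 1⟩ := by
  apply Complex.ext <;> simp [headC]

lemma tailC_apply (x : Euc (m + 2)) (i : Fin m) : tailC x i = x i.succ.succ := by
  simp [tailC]

lemma headC_comb (z : ℂ) (y : Fin m → ℝ) : headC (comb z y) = z := by
  rw [headC_apply]; rfl

lemma tailC_comb (z : ℂ) (y : Fin m → ℝ) : tailC (comb z y) = WithLp.toLp 2 y := by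
  ext i; rw [tailC_apply]; rfl

lemma norm_comb_sub (z w : ℂ) (y : Fin m → ℝ) : ‖comb z y - comb w y‖ = ‖z - w‖ := by
  rw [EuclideanSpace.norm_eq, Complex.norm_def, Complex.normSq_apply]
  congr 1
  rw [Fin.sum_univ_succ, Fin.sum_univ_succ]
  simp [comb, sq]

lemma measurePreserving_comb :
    ∃ e : ℂ × (Fin m → ℝ) ≃ᵐ Euc (m + 2), MeasurePreserving e ∧ ∀ p, e p = comb p.1 p.2 := by
  let e1 := (MeasurableEquiv.toLp 2 (Fin (m + 2) → ℝ))
  have h1 : MeasurePreserving e1 := PiLp.volume_preserving_toLp _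
  let e2 := (MeasurableEquiv.piFinSuccAbove (fun _ : Fin (m + 2) => ℝ) 0).symm
  have h2 : MeasurePreserving e2 := (volume_preserving_piFinSuccAbove (fun _ : Fin (m + 2) => ℝ) 0).symm
  let e3 := (MeasurableEquiv.piFinSuccAbove (fun _ : Fin (m + 1) => ℝ) 0).symm
  have h3 : MeasurePreserving e3 := (volume_preserving_piFinSuccAbove (fun _ : Fin (m + 1) => ℝ) 0).symm
  let e4 : ℝ × ℝ × (Fin m → ℝ) ≃ᵐ ℝ × (Fin (m + 1) → ℝ) := (MeasurableEquiv.refl ℝ).prodCongr e3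
  have h4 : MeasurePreserving e4 := (MeasurePreserving.id volume).prod h3
  let e5 : (ℝ × ℝ) × (Fin m → ℝ) ≃ᵐ ℝ × ℝ × (Fin m → ℝ) := MeasurableEquiv.prodAssoc
  have h5 : MeasurePreserving e5 := volume_preserving_prodAssoc
  let e6 : ℂ × (Fin m → ℝ) ≃ᵐ (ℝ × ℝ) × (Fin m → ℝ) :=
    Complex.measurableEquivRealProd.prodCongr (MeasurableEquiv.refl _)
  have h6 : MeasurePreserving e6 :=
    Complex.volume_preserving_equiv_real_prod.prod (MeasurePreserving.id volume)
  refine ⟨e6.trans (e5.trans (e4.trans (e2.trans e1))),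
    (h1.comp (h2.comp (h4.comp (h5.comp h6)))), fun p => ?_⟩
  ext i
  refine Fin.cases ?_ (fun i => Fin.cases ?_ (fun i => ?_) i) i <;> rfl

lemma integral_eq_integral_comb {f : Euc (m + 2) → ℂ} (hf : Integrable f) :
    ∫ x, f x = ∫ y : Fin m → ℝ, ∫ z : ℂ, f (comb z y) := by
  obtain ⟨e, he, h⟩ := measurePreserving_comb (m := m)
  rw [← he.integral_comp e.measurableEmbedding]
  have hi : Integrable (fun p => f (e p)) := (he.integrable_comp_emb e.measurableEmbedding).2 hf
  rw [Measure.volume_eq_prod, integral_prod_symm _ hi]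
  simp only [h]

/-- Cutoff for the density in the tail variables. -/
def tailBump (m : ℕ) : ContDiffBump (0 : Euc m) := ⟨1 / 8, 1 / 4, by norm_num, by norm_num⟩

/-- Cutoff for the stream function in the tail variables. -/
def tailBump' (m : ℕ) : ContDiffBump (0 : Euc m) := ⟨1 / 4, 3 / 8, by norm_num, by norm_num⟩

/-- The density. -/
def den (q : ℝ × Euc (m + 2)) : ℝ := planeρ (q.1, (4 : ℝ) • headC q.2) * tailBump m (tailC q.2)

/-- The stream function. -/
def str (q : ℝ × Euc (m + 2)) : ℝ :=
  1 / 16 * planeψ (q.1, (4 : ℝ) • headC q.2) * tailBump' m (tailC q.2)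

/-- The first basis vector. -/
def dir0 : Euc (m + 2) := EuclideanSpace.single 0 1

/-- The second basis vector. -/
def dir1 : Euc (m + 2) := EuclideanSpace.single 1 1

lemma headC_dir0 : headC (dir0 : Euc (m + 2)) = 1 := by
  rw [headC_apply]; apply Complex.ext <;> simp [dir0]
lemma headC_dir1 : headC (dir1 : Euc (m + 2)) = Complex.I := by
  rw [headC_apply]; apply Complex.ext <;> simp [dir1]
lemma tailC_dir0 : tailC (dir0 : Euc (m + 2)) = 0 := by
  ext i; rw [tailC_apply]; simp [dir0]
lemma tailC_dir1 : tailC (dir1 : Euc (m + 2)) = 0 := by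
  ext i; rw [tailC_apply]; simp [dir1, Fin.ext_iff]

/-- The velocity field. -/
def vel (q : ℝ × Euc (m + 2)) : Euc (m + 2) :=
  fderiv ℝ str q (0, dir1) • dir0 - fderiv ℝ str q (0, dir0) • dir1

lemma headMap_contDiff :
    ContDiff ℝ ∞ fun q : ℝ × Euc (m + 2) => ((q.1, (4 : ℝ) • headC q.2) : ℝ × ℂ) := by fun_prop

lemma den_contDiff : ContDiff ℝ ∞ (den : ℝ × Euc (m + 2) → ℝ) :=
  (planeρ_contDiff.comp headMap_contDiff).mul
    ((tailBump m).contDiff.comp (tailC.contDiff.comp contDiff_snd))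

lemma str_contDiff : ContDiff ℝ ∞ (str : ℝ × Euc (m + 2) → ℝ) :=
  (contDiff_const.mul (planeψ_contDiff.comp headMap_contDiff)).mul
    ((tailBump' m).contDiff.comp (tailC.contDiff.comp contDiff_snd))

lemma vel_contDiff : ContDiff ℝ ∞ (vel : ℝ × Euc (m + 2) → Euc (m + 2)) := by
  have h : ContDiff ℝ ∞ (fderiv ℝ (str : ℝ × Euc (m + 2) → ℝ)) :=
    str_contDiff.fderiv_right (by simp)
  exact ((h.clm_apply contDiff_const).smul contDiff_const).sub
    ((h.clm_apply contDiff_const).smul contDiff_const)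

lemma fderiv_planar {f : ℝ × ℂ → ℝ} (hf : ContDiff ℝ ∞ f) (a : ℝ) {b : Euc m → ℝ}
    (hb : ContDiff ℝ ∞ b) (q : ℝ × Euc (m + 2)) (v : ℝ × Euc (m + 2)) (hv : tailC v.2 = 0) :
    fderiv ℝ (fun q : ℝ × Euc (m + 2) => a * f (q.1, (4 : ℝ) • headC q.2) * b (tailC q.2)) q v =
      a * fderiv ℝ f (q.1, (4 : ℝ) • headC q.2) (v.1, (4 : ℝ) • headC v.2) * b (tailC q.2) := by
  have h1 : HasFDerivAt (fun q : ℝ × Euc (m + 2) => ((q.1, (4 : ℝ) • headC q.2) : ℝ × ℂ))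
      ((ContinuousLinearMap.fst ℝ ℝ (Euc (m + 2))).prod
        ((4 : ℝ) • headC.comp (ContinuousLinearMap.snd ℝ ℝ (Euc (m + 2))))) q :=
    hasFDerivAt_fst.prodMk ((headC.hasFDerivAt.comp q hasFDerivAt_snd).const_smul (4 : ℝ))
  have h2 := (((hf.differentiable (by simp)) _).hasFDerivAt.comp q h1).const_mul a
  have h3 : HasFDerivAt (fun q : ℝ × Euc (m + 2) => tailC q.2)
      (tailC.comp (ContinuousLinearMap.snd ℝ ℝ (Euc (m + 2)))) q :=
    tailC.hasFDerivAt.comp q hasFDerivAt_snd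
  have h4 := ((hb.differentiable (by simp)) _).hasFDerivAt.comp q h3
  have := (h2.mul h4).fderiv
  change fderiv ℝ (fun q : ℝ × Euc (m + 2) => a * f (q.1, (4 : ℝ) • headC q.2) * b (tailC q.2)) q = _
    at this
  rw [this]
  simp [hv]
  ring

lemma fderiv_den (q v : ℝ × Euc (m + 2)) (hv : tailC v.2 = 0) : fderiv ℝ den q v =
    fderiv ℝ planeρ (q.1, (4 : ℝ) • headC q.2) (v.1, (4 : ℝ) • headC v.2) *
      tailBump m (tailC q.2) := by
  have h := fderiv_planar planeρ_contDiff 1 (tailBump m).contDiff q v hv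
  simp only [one_mul] at h
  exact h

lemma fderiv_str (q v : ℝ × Euc (m + 2)) (hv : tailC v.2 = 0) : fderiv ℝ str q v =
    1 / 16 * fderiv ℝ planeψ (q.1, (4 : ℝ) • headC q.2) (v.1, (4 : ℝ) • headC v.2) *
      tailBump' m (tailC q.2) :=
  fderiv_planar planeψ_contDiff (1 / 16) (tailBump' m).contDiff q v hv

lemma tailBump_mul (y : Euc m) : tailBump m y * tailBump' m y = tailBump m y := by
  by_cases h : y ∈ Metric.ball 0 (1 / 4)
  · rw [(tailBump' m).one_of_mem_closedBall (Metric.ball_subset_closedBall h), mul_one]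
  · have : tailBump m y = 0 := (tailBump m).zero_of_le_dist (by
      simpa [tailBump] using h)
    rw [this, zero_mul]

/-- The continuity equation holds classically. -/
lemma den_transport (q : ℝ × Euc (m + 2)) : fderiv ℝ den q (1, 0) +
    (fderiv ℝ str q (0, dir1) * fderiv ℝ den q (0, dir0) -
      fderiv ℝ str q (0, dir0) * fderiv ℝ den q (0, dir1)) = 0 := by
  rw [fderiv_den q _ (by simp), fderiv_den q _ tailC_dir0, fderiv_den q _ tailC_dir1,
    fderiv_str q _ tailC_dir0, fderiv_str q _ tailC_dir1, headC_dir0, headC_dir1]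
  have h := plane_transport (q.1, (4 : ℝ) • headC q.2)
  unfold Transport at h
  have hs : ∀ (D : ℝ × ℂ →L[ℝ] ℝ) (w : ℂ), D (0, (4 : ℝ) • w) = 4 * D (0, w) := fun D w => by
    have : ((0, (4 : ℝ) • w) : ℝ × ℂ) = (4 : ℝ) • (0, w) := by ext <;> simp
    rw [this, map_smul, smul_eq_mul]
  simp only [hs, map_zero, smul_zero]
  have hb := tailBump_mul (tailC q.2)
  linear_combination (tailBump m (tailC q.2)) * h +
    (fderiv ℝ planeψ (q.1, (4 : ℝ) • headC q.2) (0, Complex.I) *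
      fderiv ℝ planeρ (q.1, (4 : ℝ) • headC q.2) (0, 1) -
      fderiv ℝ planeψ (q.1, (4 : ℝ) • headC q.2) (0, 1) *
      fderiv ℝ planeρ (q.1, (4 : ℝ) • headC q.2) (0, Complex.I)) * hb

end dimension

/-! ### Supports, equation and estimates in arbitrary dimension -/

section dimension

variable {m : ℕ}

/-- The closed box containing all supports. -/
def box (d : ℕ) : Set (Euc d) := {x | ∀ i, |x i| ≤ 3 / 8}

lemma isClosed_box (d : ℕ) : IsClosed (box d) := by
  have : box d = ⋂ i, {x : Euc d | |x i| ≤ 3 / 8} := by ext; simp [box]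
  rw [this]
  exact isClosed_iInter fun i => isClosed_le (by fun_prop) continuous_const

lemma box_subset_unitCube (d : ℕ) : box d ⊆ unitCube d := fun x hx i => by
  have := hx i; linarith

lemma norm_le_of_mem_box {d : ℕ} {x : Euc d} (hx : x ∈ box d) : ‖x‖ ≤ d := by
  rw [EuclideanSpace.norm_eq]
  apply Real.sqrt_le_iff.2
  refine ⟨by positivity, ?_⟩
  calc ∑ i, ‖x i‖ ^ 2 ≤ ∑ _i : Fin d, (1 : ℝ) := Finset.sum_le_sum fun i _ => by
        have := hx i
        rw [Real.norm_eq_abs]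
        nlinarith [abs_nonneg (x i)]
    _ = d := by simp
    _ ≤ (d : ℝ) ^ 2 := by exact_mod_cast Nat.le_self_pow two_ne_zero d

lemma isCompact_box (d : ℕ) : IsCompact (box d) :=
  (isCompact_closedBall (0 : Euc d) d).of_isClosed_subset (isClosed_box d) fun x hx => by
    simpa using norm_le_of_mem_box hx

lemma eq_zero_of_notMem_box {x : Euc (m + 2)} (hx : x ∉ box (m + 2)) :
    (1 ≤ |((4 : ℝ) • headC x).re| ∨ 1 ≤ |((4 : ℝ) • headC x).im|) ∨ 3 / 8 ≤ ‖tailC x‖ := by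
  simp only [box, mem_ofPred_eq, not_forall, not_le] at hx
  obtain ⟨i, hi⟩ := hx
  rw [headC_apply]
  simp only [Complex.real_smul, Complex.mul_re, Complex.mul_im, Complex.ofReal_re,
    Complex.ofReal_im, zero_mul, sub_zero, add_zero, abs_mul]
  have h4 : |(4 : ℝ)| = 4 := by norm_num
  rw [h4]
  revert hi
  refine Fin.cases (fun hi => ?_) (fun i => Fin.cases (fun hi => ?_) (fun i hi => ?_) i) i
  · left; left; linarith
  · left; right
    have : |x 1| > 3 / 8 := hi
    linarith
  · right
    have := PiLp.norm_apply_le (tailC x) i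
    rw [tailC_apply, Real.norm_eq_abs] at this
    linarith

lemma den_eq_zero (t : ℝ) {x : Euc (m + 2)} (hx : x ∉ box (m + 2)) : den (t, x) = 0 := by
  unfold den
  rcases eq_zero_of_notMem_box hx with h | h
  · rw [planeρ_eq_zero h, zero_mul]
  · rw [(tailBump m).zero_of_le_dist (by
      change (1 / 4 : ℝ) ≤ dist (tailC x) 0
      rw [dist_zero_right]; linarith), mul_zero]

lemma str_eq_zero (t : ℝ) {x : Euc (m + 2)} (hx : x ∉ box (m + 2)) : str (t, x) = 0 := by
  unfold str
  rcases eq_zero_of_notMem_box hx with h | h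
  · rw [planeψ_eq_zero h, mul_zero, zero_mul]
  · rw [(tailBump' m).zero_of_le_dist (by
      change (3 / 8 : ℝ) ≤ dist (tailC x) 0
      rw [dist_zero_right]; exact h), mul_zero]

lemma fderiv_timeSlice {E F : Type*} [NormedAddCommGroup E] [NormedSpace ℝ E]
    [NormedAddCommGroup F] [NormedSpace ℝ F] {f : ℝ × E → F} (hf : Differentiable ℝ f) (t : ℝ)
    (x v : E) : fderiv ℝ (fun x => f (t, x)) x v = fderiv ℝ f (t, x) (0, v) := by
  have h := (hf (t, x)).hasFDerivAt.comp x ((hasFDerivAt_const t x).prodMk (hasFDerivAt_id x))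
  have := h.fderiv
  change fderiv ℝ (fun x => f (t, x)) x = _ at this
  rw [this]
  simp

lemma str_differentiable : Differentiable ℝ (str : ℝ × Euc (m + 2) → ℝ) :=
  str_contDiff.differentiable (by simp)

lemma den_differentiable : Differentiable ℝ (den : ℝ × Euc (m + 2) → ℝ) :=
  den_contDiff.differentiable (by simp)

/-- The spatial slice of the stream function. -/
def strAt (t : ℝ) (x : Euc (m + 2)) : ℝ := str (t, x)

lemma strAt_contDiff (t : ℝ) : ContDiff ℝ ∞ (strAt t : Euc (m + 2) → ℝ) :=
  str_contDiff.comp (contDiff_const.prodMk contDiff_id)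

/-- The rotated gradient. -/
def perp (m : ℕ) : (Euc (m + 2) →L[ℝ] ℝ) →L[ℝ] Euc (m + 2) :=
  (ContinuousLinearMap.apply ℝ ℝ (dir1 : Euc (m + 2))).smulRight dir0 -
    (ContinuousLinearMap.apply ℝ ℝ (dir0 : Euc (m + 2))).smulRight dir1

lemma vel_eq (t : ℝ) (x : Euc (m + 2)) : vel (t, x) = perp m (fderiv ℝ (strAt t) x) := by
  unfold vel strAt
  simp only [perp, sub_apply, ContinuousLinearMap.smulRight_apply,
    ContinuousLinearMap.apply_apply, fderiv_timeSlice str_differentiable]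

lemma tsupport_den_subset (t : ℝ) : tsupport (fun x : Euc (m + 2) => den (t, x)) ⊆ box (m + 2) :=
  closure_minimal (fun x hx => by
    by_contra h; exact hx (den_eq_zero t h)) (isClosed_box _)

lemma tsupport_strAt_subset (t : ℝ) : tsupport (strAt t : Euc (m + 2) → ℝ) ⊆ box (m + 2) :=
  closure_minimal (fun x hx => by
    by_contra h; exact hx (str_eq_zero t h)) (isClosed_box _)

lemma tsupport_vel_subset (t : ℝ) : tsupport (fun x : Euc (m + 2) => vel (t, x)) ⊆ box (m + 2) :=
  closure_minimal (fun x hx => by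
    by_contra h
    refine hx ?_
    change vel (t, x) = 0
    have : x ∉ tsupport (fderiv ℝ (strAt t)) := fun h' =>
      h (tsupport_strAt_subset t (tsupport_fderiv_subset ℝ h'))
    rw [vel_eq, image_eq_zero_of_notMem_tsupport this, map_zero]) (isClosed_box _)

lemma den_compact (t : ℝ) : HasCompactSupport (fun x : Euc (m + 2) => den (t, x)) :=
  (isCompact_box _).of_isClosed_subset (isClosed_tsupport _) (tsupport_den_subset t)

lemma vel_divFree (t : ℝ) (ψ : Euc (m + 2) → ℝ) (hψ : ContDiff ℝ ∞ ψ) (hc : HasCompactSupport ψ) :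
    ∫ x, fderiv ℝ ψ x (vel (t, x)) = 0 := by
  have h := integral_bracket_eq_zero (μ := (volume : Measure (Euc (m + 2))))
    (contDiff_infty.1 (strAt_contDiff t) 2) (contDiff_infty.1 hψ 1) hc dir1 dir0
  rw [← h]
  congr 1; funext x
  rw [vel_eq]
  simp [perp]

lemma den_weak (φ : ℝ × Euc (m + 2) → ℝ) (hφ : ContDiff ℝ ∞ φ) (hc : HasCompactSupport φ) :
    ∫ q : ℝ × Euc (m + 2),
      den q * (fderiv ℝ φ q (1, 0) + fderiv ℝ φ q (0, vel q)) = 0 := by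
  have : (volume : Measure (ℝ × Euc (m + 2))).IsAddHaarMeasure :=
    inferInstanceAs ((volume : Measure ℝ).prod (volume : Measure (Euc (m + 2)))).IsAddHaarMeasure
  have hg : ContDiff ℝ 1 fun q => den q * φ q := contDiff_infty.1 (den_contDiff.mul hφ) 1
  have hgc : HasCompactSupport fun q => den q * φ q := hc.mul_left
  have hs : ContDiff ℝ 2 (str : ℝ × Euc (m + 2) → ℝ) := contDiff_infty.1 str_contDiff 2
  have h1 := integral_fderiv_apply_eq_zero (μ := (volume : Measure (ℝ × Euc (m + 2)))) hg hgc (1, 0)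
  have h2 := integral_bracket_eq_zero (μ := (volume : Measure (ℝ × Euc (m + 2))))
    hs hg hgc (0, dir1) (0, dir0)
  have hd : ∀ q v, fderiv ℝ (fun q => den q * φ q) q v =
      den q * fderiv ℝ φ q v + φ q * fderiv ℝ den q v := fun q v => by
    have := ((den_differentiable q).hasFDerivAt.mul
      ((hφ.differentiable (by simp)) q).hasFDerivAt).fderiv
    change fderiv ℝ (fun q => den q * φ q) q = _ at this
    rw [this]; simp
  have i1 : Integrable (fun q => fderiv ℝ (fun q => den q * φ q) q (1, 0)) :=
    (continuous_fderiv_apply_const hg _).integrable_of_hasCompactSupport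
      (hgc.fderiv_apply (𝕜 := ℝ) _)
  have cs : ∀ v, Continuous fun q : ℝ × Euc (m + 2) => fderiv ℝ str q v := fun v =>
    continuous_fderiv_apply_const (contDiff_infty.1 str_contDiff 1) v
  have i2 : Integrable (fun q : ℝ × Euc (m + 2) =>
      fderiv ℝ str q (0, dir1) * fderiv ℝ (fun q => den q * φ q) q (0, dir0) -
      fderiv ℝ str q (0, dir0) * fderiv ℝ (fun q => den q * φ q) q (0, dir1)) :=
    (((cs _).mul (continuous_fderiv_apply_const hg _)).integrable_of_hasCompactSupport
      (hgc.fderiv_apply (𝕜 := ℝ) _).mul_left).sub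
    (((cs _).mul (continuous_fderiv_apply_const hg _)).integrable_of_hasCompactSupport
      (hgc.fderiv_apply (𝕜 := ℝ) _).mul_left)
  have h3 := integral_add i1 i2
  rw [h1, h2, add_zero] at h3
  refine Eq.trans ?_ h3
  congr 1; funext q
  rw [hd, hd, hd]
  have hv : ((0, vel q) : ℝ × Euc (m + 2)) =
      fderiv ℝ str q (0, dir1) • (0, dir0) - fderiv ℝ str q (0, dir0) • (0, dir1) := by
    ext <;> simp [vel]
  rw [hv, map_sub, map_smul, map_smul, smul_eq_mul, smul_eq_mul]
  linear_combination (-φ q) * den_transport q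

lemma den_abs_le (q : ℝ × Euc (m + 2)) : |den q| ≤ 1 := by
  unfold den
  rw [abs_mul, abs_of_nonneg (tailBump m).nonneg]
  exact mul_le_one₀ (abs_planeρ_le _) (tailBump m).nonneg (tailBump m).le_one

lemma den_ne_zero : ∃ x : Euc (m + 2), den (0, x) ≠ 0 := by
  obtain ⟨z, hz⟩ := planeρ_ne_zero
  refine ⟨comb ((4 : ℝ)⁻¹ • z) 0, ?_⟩
  unfold den
  rw [headC_comb, tailC_comb, smul_inv_smul₀ four_ne_zero]
  refine mul_ne_zero hz ?_
  have : tailBump m (WithLp.toLp 2 0) = 1 := (tailBump m).one_of_mem_closedBall (by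
    simpa using (tailBump m).rIn_pos.le)
  rw [this]; exact one_ne_zero

/-- Pairing of the density with a Lipschitz function. -/
lemma integral_den_mul_le (m : ℕ) : ∃ C, 0 ≤ C ∧ ∀ t (φ : Euc (m + 2) → ℂ) (Λ : ℝ), 0 ≤ Λ →
    (∀ x y, ‖φ x - φ y‖ ≤ Λ * ‖x - y‖) →
    ‖∫ x, den (t, x) • φ x‖ ≤ C * Λ * scale t := by
  obtain ⟨C, hC, h⟩ := integral_planeρ_mul_le
  set I : ℝ := ∫ y : Fin m → ℝ, tailBump m (WithLp.toLp 2 y) with hI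
  have hI0 : 0 ≤ I := integral_nonneg fun y => (tailBump m).nonneg
  have hInt : Integrable fun y : Fin m → ℝ => tailBump m (WithLp.toLp 2 y) :=
    (PiLp.volume_preserving_toLp (Fin m)).integrable_comp_of_integrable
      ((tailBump m).continuous.integrable_of_hasCompactSupport (tailBump m).hasCompactSupport)
  refine ⟨C * I, by positivity, fun t φ Λ hΛ hφ => ?_⟩
  have hcont : Continuous φ := by
    lift Λ to ℝ≥0 using hΛ
    exact (LipschitzWith.of_dist_le_mul fun x y => by
      simpa [dist_eq_norm] using hφ x y : LipschitzWith Λ φ).continuous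
  have hdc : Continuous fun x : Euc (m + 2) => den (t, x) :=
    den_contDiff.continuous.comp (by fun_prop)
  have hf : Integrable fun x => den (t, x) • φ x :=
    (hdc.smul hcont).integrable_of_hasCompactSupport (den_compact t).smul_right
  rw [integral_eq_integral_comb hf]
  have inner : ∀ y : Fin m → ℝ, ‖∫ z : ℂ, den (t, comb z y) • φ (comb z y)‖ ≤
      (C * Λ * scale t) * tailBump m (WithLp.toLp 2 y) := fun y => by
    set G : ℂ → ℂ := fun z => planeρ (t, z) • φ (comb ((4 : ℝ)⁻¹ • z) y) with hG
    have e : ∀ z : ℂ, den (t, comb z y) • φ (comb z y) =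
        tailBump m (WithLp.toLp 2 y) • G ((4 : ℂ) * z + 0) := fun z => by
      have e1 : (4 : ℂ) * z + 0 = (4 : ℝ) • z := by simp
      rw [hG, e1]
      simp only [den, headC_comb, tailC_comb, inv_smul_smul₀ (four_ne_zero (α := ℝ))]
      rw [smul_smul, mul_comm]
    simp only [e]
    rw [integral_smul, integral_comp_similarity 4 0 (by norm_num), norm_smul, norm_smul,
      Real.norm_of_nonneg (tailBump m).nonneg]
    have hb := h t (fun z => φ (comb ((4 : ℝ)⁻¹ • z) y)) (Λ / 4) (by positivity) fun z w => by
      refine (hφ _ _).trans ?_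
      rw [norm_comb_sub, ← smul_sub, norm_smul]
      apply le_of_eq; norm_num; ring
    have h16 : ‖(‖(4 : ℂ)‖ ^ 2)⁻¹‖ = (1 / 16 : ℝ) := by norm_num
    rw [h16, mul_comm]
    refine mul_le_mul_of_nonneg_right ?_ (tailBump m).nonneg
    have hs := (scale_pos t).le
    have : 0 ≤ C * Λ * scale t := by positivity
    have e2 : C * (Λ / 4) * scale t = (C * Λ * scale t) / 4 := by ring
    rw [e2] at hb
    change 1 / 16 * ‖∫ z, planeρ (t, z) • φ (comb ((4 : ℝ)⁻¹ • z) y)‖ ≤ _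
    linarith
  refine (norm_integral_le_of_norm_le (hInt.const_mul _) (Eventually.of_forall inner)).trans ?_
  rw [integral_const_mul, ← hI]
  apply le_of_eq; ring

end dimension

/-! ### Derivative bounds for the velocity -/

section dimension

variable {m : ℕ}

lemma strAt_bound (m k : ℕ) : ∃ C, 0 ≤ C ∧ ∀ t (x : Euc (m + 2)),
    ‖iteratedFDeriv ℝ k (strAt t) x‖ ≤ C * (scale t ^ 2 * (scale t)⁻¹ ^ k) := by
  choose a ha0 ha using planeψ_bound
  have hb : ∀ j, ∃ C, 0 ≤ C ∧ ∀ y, ‖iteratedFDeriv ℝ j (tailBump' m) y‖ ≤ C := fun j => by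
    obtain ⟨C, hC⟩ := ((tailBump' m).contDiff (n := (⊤ : ℕ∞)) |>.continuous_iteratedFDeriv (m := j)
      (by exact_mod_cast le_top)).bounded_above_of_compact_support
      ((tailBump' m).hasCompactSupport.iteratedFDeriv j)
    exact ⟨C, (norm_nonneg _).trans (hC 0), hC⟩
  choose b hb0 hb using hb
  set A : Euc (m + 2) →L[ℝ] ℂ := (4 : ℝ) • headC with hA
  refine ⟨∑ i ∈ Finset.range (k + 1), (k.choose i : ℝ) * (1 / 16 * (‖A‖ ^ i * a i)) *
    (‖(tailC : Euc (m + 2) →L[ℝ] Euc m)‖ ^ (k - i) * b (k - i)), Finset.sum_nonneg fun i _ => mul_nonneg (mul_nonneg (by positivity)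
    (mul_nonneg (by norm_num) (mul_nonneg (by positivity) (ha0 i))))
    (mul_nonneg (by positivity) (hb0 _)), fun t x => ?_⟩
  have hF : ContDiff ℝ ∞ fun z => planeψ (t, z) :=
    planeψ_contDiff.comp (contDiff_const.prodMk contDiff_id)
  have h1 : ContDiff ℝ ∞ fun x : Euc (m + 2) => (1 / 16 : ℝ) • planeψ (t, A x + 0) :=
    (hF.comp (A.contDiff.add contDiff_const)).const_smul _
  have h2 : ContDiff ℝ ∞ fun x : Euc (m + 2) => tailBump' m (tailC x + 0) :=
    (tailBump' m).contDiff.comp (tailC.contDiff.add contDiff_const)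
  have e : (strAt t : Euc (m + 2) → ℝ) = fun x =>
      ((1 / 16 : ℝ) • planeψ (t, A x + 0)) * tailBump' m (tailC x + 0) := by
    funext x; simp [strAt, str, hA]
  rw [e]
  refine (norm_iteratedFDeriv_mul_le h1 h2 x (n := k) (by exact_mod_cast le_top)).trans ?_
  rw [Finset.sum_mul]
  refine Finset.sum_le_sum fun i hi => ?_
  have hi : i ≤ k := Nat.lt_succ_iff.1 (Finset.mem_range.1 hi)
  have hs := scale_pos t
  have b1 : ‖iteratedFDeriv ℝ i (fun x : Euc (m + 2) => (1 / 16 : ℝ) • planeψ (t, A x + 0)) x‖ ≤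
      1 / 16 * (‖A‖ ^ i * (a i * (scale t ^ 2 * (scale t)⁻¹ ^ k))) := by
    have := iteratedFDeriv_const_smul_apply (𝕜 := ℝ) (a := (1 / 16 : ℝ)) (i := i) (x := x)
      (f := fun x : Euc (m + 2) => planeψ (t, A x + 0))
      ((hF.comp (A.contDiff.add contDiff_const)).of_le (by exact_mod_cast le_top)).contDiffAt
    change iteratedFDeriv ℝ i (fun x : Euc (m + 2) => (1 / 16 : ℝ) • planeψ (t, A x + 0)) x = _
      at this
    rw [this, norm_smul, Real.norm_of_nonneg (by norm_num)]
    refine mul_le_mul_of_nonneg_left ?_ (by norm_num)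
    refine (norm_iteratedFDeriv_comp_affine_le hF A 0 i x).trans ?_
    refine mul_le_mul_of_nonneg_left ?_ (by positivity)
    refine (ha i t _).trans ?_
    refine mul_le_mul_of_nonneg_left ?_ (ha0 i)
    refine mul_le_mul_of_nonneg_left ?_ (by positivity)
    exact pow_le_pow_right₀ (one_le_inv_iff₀.2 ⟨hs, scale_le_one t⟩) hi
  have b2 : ‖iteratedFDeriv ℝ (k - i) (fun x : Euc (m + 2) => tailBump' m (tailC x + 0)) x‖ ≤
      ‖(tailC : Euc (m + 2) →L[ℝ] Euc m)‖ ^ (k - i) * b (k - i) :=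
    (norm_iteratedFDeriv_comp_affine_le (tailBump' m).contDiff tailC 0 (k - i) x).trans
      (mul_le_mul_of_nonneg_left (hb _ _) (by positivity))
  have hai := ha0 i
  calc _ ≤ (k.choose i : ℝ) * (1 / 16 * (‖A‖ ^ i * (a i * (scale t ^ 2 * (scale t)⁻¹ ^ k)))) *
        (‖(tailC : Euc (m + 2) →L[ℝ] Euc m)‖ ^ (k - i) * b (k - i)) := by
        gcongr
    _ = _ := by ring

lemma vel_slice_contDiff (t : ℝ) : ContDiff ℝ ∞ fun x : Euc (m + 2) => vel (t, x) :=
  vel_contDiff.comp (contDiff_const.prodMk contDiff_id)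

lemma vel_bound (m k : ℕ) : ∃ C, 0 ≤ C ∧ ∀ t (x : Euc (m + 2)),
    ‖iteratedFDeriv ℝ k (fun x => vel (t, x)) x‖ ≤ C * (scale t * (scale t)⁻¹ ^ k) := by
  obtain ⟨C, hC, h⟩ := strAt_bound m (k + 1)
  refine ⟨‖perp m‖ * C, by positivity, fun t x => ?_⟩
  have e : (fun x : Euc (m + 2) => vel (t, x)) = perp m ∘ fderiv ℝ (strAt t) := by
    funext x; exact vel_eq t x
  have hd : ContDiff ℝ ∞ (fderiv ℝ (strAt t : Euc (m + 2) → ℝ)) :=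
    (strAt_contDiff t).fderiv_right (by simp)
  rw [e]
  refine ((perp m).norm_iteratedFDeriv_comp_left hd.contDiffAt (n := k)
    (by exact_mod_cast le_top)).trans ?_
  rw [norm_iteratedFDeriv_fderiv, mul_assoc]
  refine mul_le_mul_of_nonneg_left ((h t x).trans (le_of_eq ?_)) (norm_nonneg _)
  have := (scale_pos t).ne'
  have h1 : scale t * (scale t)⁻¹ = 1 := mul_inv_cancel₀ this
  linear_combination (C * scale t * (scale t)⁻¹ ^ k) * h1

/-- Smooth functions supported in the box, with derivatives governed by the length scale `μ`. -/
structure Controlled {d : ℕ} (A : ℕ → ℝ) (μ : ℝ) (f : Euc d → ℂ) : Prop where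
  smooth : ContDiff ℝ ∞ f
  supp : ∀ x ∉ box d, f x = 0
  bound : ∀ k x, ‖iteratedFDeriv ℝ k f x‖ ≤ A k * (μ * μ⁻¹ ^ k)

lemma vel_controlled (m : ℕ) : ∃ A : ℕ → ℝ, (∀ k, 0 ≤ A k) ∧ ∀ t (i : Fin (m + 2)),
    Controlled A (scale t) fun x : Euc (m + 2) => (vel (t, x) i : ℂ) := by
  choose C hC h using vel_bound m
  let L : Fin (m + 2) → Euc (m + 2) →L[ℝ] ℂ := fun i =>
    Complex.ofRealCLM.comp (EuclideanSpace.proj i)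
  refine ⟨fun k => (∑ i, ‖L i‖) * C k, fun k => mul_nonneg (by positivity) (hC k), fun t i => ?_⟩
  have e : (fun x : Euc (m + 2) => (vel (t, x) i : ℂ)) = L i ∘ fun x => vel (t, x) := by
    funext x; simp [L]
  refine ⟨?_, fun x hx => ?_, fun k x => ?_⟩
  · rw [e]; exact (L i).contDiff.comp (vel_slice_contDiff t)
  · have : vel (t, x) = 0 := by
      by_contra h
      exact hx (tsupport_vel_subset t (subset_tsupport _ h))
    simp [this]
  · rw [e]
    refine ((L i).norm_iteratedFDeriv_comp_left (vel_slice_contDiff t).contDiffAt (n := k)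
      (by exact_mod_cast le_top)).trans ?_
    rw [mul_assoc]
    exact mul_le_mul (Finset.single_le_sum (f := fun i => ‖L i‖) (fun _ _ => norm_nonneg _)
      (Finset.mem_univ i)) (h k t x) (norm_nonneg _) (by positivity)

lemma vel_norm_le (m : ℕ) : ∃ M, ∀ t (x : Euc (m + 2)), ‖vel (t, x)‖ ≤ M := by
  obtain ⟨C, hC, h⟩ := vel_bound m 0
  refine ⟨C, fun t x => ?_⟩
  have := h t x
  rw [norm_iteratedFDeriv_zero, pow_zero, mul_one] at this
  exact this.trans (mul_le_of_le_one_right hC (scale_le_one t))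

lemma vel_lipschitz (m : ℕ) : ∃ L : ℝ≥0, ∀ t, LipschitzWith L fun x : Euc (m + 2) => vel (t, x) := by
  obtain ⟨C, hC, h⟩ := vel_bound m 1
  lift C to ℝ≥0 using hC
  refine ⟨C, fun t => lipschitzWith_of_nnnorm_fderiv_le
    ((vel_slice_contDiff t).differentiable (by simp)) fun x => ?_⟩
  have := h t x
  rw [pow_one, mul_inv_cancel₀ (scale_pos t).ne', mul_one, norm_iteratedFDeriv_one] at this
  exact_mod_cast this

end dimension

/-! ### Negative Sobolev norms -/

open scoped SchwartzMap

lemma hsNormSqE_neg_le {d : ℕ} (hd : 2 ≤ d) {s a V : ℝ} (hs : 0 < s) (hs2 : s < 2)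
    (hV : 0 ≤ V) : ∃ K, 0 ≤ K ∧ ∀ (f : 𝓢(Euc d, ℂ)) (σ : ℝ), 0 < σ → σ ≤ 1 →
      (∀ ξ, ‖𝓕 f ξ‖ ≤ a * σ * ‖ξ‖) → ∫ x, ‖f x‖ ^ 2 ≤ V →
      hsNormSqE d (-s) f ≤ ENNReal.ofReal (K * σ ^ (2 * s / (d + 2))) := by
  have hdim : Module.finrank ℝ (Euc d) = d := by simp
  have hInt : IntegrableOn (fun ξ : Euc d => ‖ξ‖ ^ (2 - 2 * s)) (Metric.ball 0 1) := by
    refine integrableOn_ball_of_norm_le_rpow (C := 1) (α := 2 * s - 2) (by rw [hdim]; omega)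
      (by rw [hdim]; have : (2 : ℝ) ≤ d := by exact_mod_cast hd
          linarith) (Eventually.of_forall fun x => ?_) ?_
    · rw [Real.norm_of_nonneg (by positivity), one_mul, neg_sub]
    · exact (measurable_norm.pow_const _).aestronglyMeasurable
  set I := ∫ ξ in Metric.ball (0 : Euc d) 1, ‖ξ‖ ^ (2 - 2 * s) with hI
  have hI0 : 0 ≤ I := integral_nonneg fun ξ => by positivity
  set κ := volume.real (Metric.ball (0 : Euc d) 1) with hκ
  refine ⟨a ^ 2 * I + a ^ 2 * κ + V, by positivity, fun f σ hσ hσ1 hf hfV => ?_⟩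
  set R : ℝ := σ ^ (-(1 / ((d : ℝ) + 2))) with hR
  have hR0 : 0 < R := by positivity
  have hR1 : 1 ≤ R := Real.one_le_rpow_of_pos_of_le_one_of_nonpos hσ hσ1 (by
    rw [neg_nonpos]; positivity)
  have hRd : R ^ (d + 2) = σ⁻¹ := by
    rw [← Real.rpow_natCast, hR, ← Real.rpow_mul hσ.le, ← Real.rpow_neg_one]
    congr 1; push_cast; field_simp
  have hRs : R ^ (-(2 * s)) = σ ^ (2 * s / (d + 2)) := by
    rw [hR, ← Real.rpow_mul hσ.le]; congr 1; field_simp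
  have hσs : σ ≤ σ ^ (2 * s / (d + 2)) := by
    conv_lhs => rw [← Real.rpow_one σ]
    apply Real.rpow_le_rpow_of_exponent_ge hσ hσ1
    have : (2 : ℝ) ≤ d := by exact_mod_cast hd
    rw [div_le_one (by positivity)]; linarith
  set g1 : Euc d → ℝ := (Metric.ball (0 : Euc d) 1).indicator
    (fun ξ => a ^ 2 * σ ^ 2 * ‖ξ‖ ^ (2 - 2 * s)) with hg1
  set g2 : Euc d → ℝ := (Metric.ball (0 : Euc d) R).indicator
    (fun _ => a ^ 2 * σ ^ 2 * R ^ 2) with hg2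
  set g3 : Euc d → ℝ := fun ξ => R ^ (-(2 * s)) * ‖𝓕 f ξ‖ ^ 2 with hg3
  have i1 : Integrable g1 := by
    rw [hg1, integrable_indicator_iff measurableSet_ball]; exact hInt.const_mul _
  have i2 : Integrable g2 := by
    rw [hg2, integrable_indicator_iff measurableSet_ball]
    exact integrableOn_const (measure_ball_lt_top.ne)
  have i3 : Integrable g3 := ((𝓕 f).memLp 2).integrable_norm_pow two_ne_zero |>.const_mul _
  have p1 : ∀ ξ, 0 ≤ g1 ξ := fun ξ => indicator_nonneg (fun _ _ => by positivity) _
  have p2 : ∀ ξ, 0 ≤ g2 ξ := fun ξ => indicator_nonneg (fun _ _ => by positivity) _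
  have p3 : ∀ ξ, 0 ≤ g3 ξ := fun ξ => by rw [hg3]; positivity
  have pt : ∀ ξ : Euc d, ‖ξ‖ ^ (2 * -s) * ‖𝓕 f ξ‖ ^ 2 ≤ g1 ξ + g2 ξ + g3 ξ := fun ξ => by
    have hsq : ‖𝓕 f ξ‖ ^ 2 ≤ a ^ 2 * σ ^ 2 * ‖ξ‖ ^ 2 := by
      calc _ ≤ (a * σ * ‖ξ‖) ^ 2 := by gcongr; exact hf ξ
        _ = _ := by ring
    rcases eq_or_ne ξ 0 with rfl | h0
    · have : ‖(0 : Euc d)‖ ^ (2 * -s) = 0 := by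
        rw [norm_zero, Real.zero_rpow]; linarith
      rw [this, zero_mul]
      linarith [p1 0, p2 0, p3 0]
    have hn : 0 < ‖ξ‖ := norm_pos_iff.2 h0
    rcases lt_or_ge ‖ξ‖ 1 with h1 | h1
    · have : g1 ξ = a ^ 2 * σ ^ 2 * ‖ξ‖ ^ (2 - 2 * s) := by
        rw [hg1, indicator_of_mem (by simpa using h1)]
      have e : ‖ξ‖ ^ (2 - 2 * s) = ‖ξ‖ ^ (2 * -s) * ‖ξ‖ ^ 2 := by
        rw [← Real.rpow_natCast, ← Real.rpow_add hn]; congr 1; push_cast; ring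
      have : ‖ξ‖ ^ (2 * -s) * ‖𝓕 f ξ‖ ^ 2 ≤ g1 ξ := by
        rw [this, e]
        calc _ ≤ ‖ξ‖ ^ (2 * -s) * (a ^ 2 * σ ^ 2 * ‖ξ‖ ^ 2) := by gcongr
          _ = _ := by ring
      linarith [p2 ξ, p3 ξ]
    rcases lt_or_ge ‖ξ‖ R with h2 | h2
    · have : g2 ξ = a ^ 2 * σ ^ 2 * R ^ 2 := by
        rw [hg2, indicator_of_mem (by simpa using h2)]
      have : ‖ξ‖ ^ (2 * -s) * ‖𝓕 f ξ‖ ^ 2 ≤ g2 ξ := by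
        rw [this]
        have : ‖ξ‖ ^ (2 * -s) ≤ 1 := Real.rpow_le_one_of_one_le_of_nonpos h1 (by linarith)
        calc _ ≤ 1 * (a ^ 2 * σ ^ 2 * ‖ξ‖ ^ 2) := by gcongr
          _ ≤ 1 * (a ^ 2 * σ ^ 2 * R ^ 2) := by gcongr
          _ = _ := by ring
      linarith [p1 ξ, p3 ξ]
    · have : ‖ξ‖ ^ (2 * -s) ≤ R ^ (-(2 * s)) := by
        rw [show 2 * -s = -(2 * s) by ring]
        exact Real.rpow_le_rpow_of_nonpos hR0 h2 (by linarith)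
      have : ‖ξ‖ ^ (2 * -s) * ‖𝓕 f ξ‖ ^ 2 ≤ g3 ξ := by
        exact mul_le_mul_of_nonneg_right this (by positivity)
      linarith [p1 ξ, p2 ξ]
  have hle : hsNormSqE d (-s) f ≤ ENNReal.ofReal (∫ ξ, (g1 ξ + g2 ξ + g3 ξ)) := by
    rw [ofReal_integral_eq_lintegral_ofReal (f := fun ξ => g1 ξ + g2 ξ + g3 ξ)
      ((i1.add i2).add i3)
      (Eventually.of_forall fun ξ => add_nonneg (add_nonneg (p1 ξ) (p2 ξ)) (p3 ξ))]
    refine lintegral_mono fun ξ => ?_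
    refine le_trans (le_of_eq ?_) (ENNReal.ofReal_le_ofReal (pt ξ))
    rw [ENNReal.ofReal_mul (by positivity), ← SchwartzMap.fourier_coe,
      ENNReal.ofReal_pow (norm_nonneg _), ofReal_norm]
    rfl
  refine hle.trans (ENNReal.ofReal_le_ofReal ?_)
  rw [integral_add (f := fun ξ => g1 ξ + g2 ξ) (i1.add i2) i3, integral_add i1 i2]
  have e1 : ∫ ξ, g1 ξ = a ^ 2 * σ ^ 2 * I := by
    rw [hg1, integral_indicator measurableSet_ball, integral_const_mul]
  have e2 : ∫ ξ, g2 ξ = a ^ 2 * σ * κ := by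
    rw [hg2, integral_indicator measurableSet_ball, setIntegral_const, smul_eq_mul]
    have : volume.real (Metric.ball (0 : Euc d) R) = R ^ d * κ := by
      rw [hκ, measureReal_def, measureReal_def, Measure.addHaar_ball_of_pos _ _ hR0, hdim,
        ENNReal.toReal_mul, ENNReal.toReal_ofReal (by positivity)]
    rw [this]
    have h' : σ * R ^ (d + 2) = 1 := by rw [hRd]; exact mul_inv_cancel₀ hσ.ne'
    linear_combination (a ^ 2 * σ * κ) * h'
  have e3 : ∫ ξ, g3 ξ ≤ σ ^ (2 * s / (d + 2)) * V := by
    rw [hg3, integral_const_mul, hRs, SchwartzMap.integral_norm_sq_fourier]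
    gcongr
  rw [e1, e2]
  have q1 : a ^ 2 * σ ^ 2 * I ≤ a ^ 2 * I * σ ^ (2 * s / (d + 2)) := by
    have : σ ^ 2 ≤ σ ^ (2 * s / (d + 2)) := by nlinarith
    calc _ = a ^ 2 * I * σ ^ 2 := by ring
      _ ≤ _ := by gcongr
  have q2 : a ^ 2 * σ * κ ≤ a ^ 2 * κ * σ ^ (2 * s / (d + 2)) := by
    have : 0 ≤ κ := measureReal_nonneg
    calc _ = a ^ 2 * κ * σ := by ring
      _ ≤ _ := by gcongr
  linarith

lemma scale_le_exp (t : ℝ) : scale t ≤ √2 * Real.exp (-(Real.log 2 / 2) * t) := by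
  have h2 : (√2)⁻¹ = Real.exp (-(Real.log 2 / 2)) := by
    rw [Real.exp_neg, ← Real.log_sqrt (by norm_num), Real.exp_log (by positivity)]
  have h3 : √2 = Real.exp (Real.log 2 / 2) := by
    rw [← Real.log_sqrt (by norm_num), Real.exp_log (by positivity)]
  rw [scale, h2, h3, ← Real.exp_nat_mul, ← Real.exp_add, Real.exp_le_exp]
  have := Nat.lt_floor_add_one t
  have hl := Real.log_pos one_lt_two
  nlinarith

lemma exp_le_scale {t : ℝ} (ht : 0 ≤ t) : Real.exp (-(Real.log 2 / 2) * t) ≤ scale t := by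
  have h2 : (√2)⁻¹ = Real.exp (-(Real.log 2 / 2)) := by
    rw [Real.exp_neg, ← Real.log_sqrt (by norm_num), Real.exp_log (by positivity)]
  rw [scale, h2, ← Real.exp_nat_mul, Real.exp_le_exp]
  have := Nat.floor_le ht
  have hl := Real.log_pos one_lt_two
  nlinarith

lemma den_slice_contDiff {m : ℕ} (t : ℝ) : ContDiff ℝ ∞ fun x : Euc (m + 2) => (den (t, x) : ℂ) :=
  Complex.ofRealCLM.contDiff.comp (den_contDiff.comp (contDiff_const.prodMk contDiff_id))

lemma den_slice_compact {m : ℕ} (t : ℝ) :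
    HasCompactSupport fun x : Euc (m + 2) => (den (t, x) : ℂ) :=
  (den_compact t).comp_left (g := fun y : ℝ => (y : ℂ)) Complex.ofReal_zero

lemma norm_fourier_den_le (m : ℕ) : ∃ a, 0 ≤ a ∧ ∀ t (ξ : Euc (m + 2)),
    ‖𝓕 (fun x : Euc (m + 2) => (den (t, x) : ℂ)) ξ‖ ≤ a * scale t * ‖ξ‖ := by
  obtain ⟨C, hC, h⟩ := integral_den_mul_le m
  refine ⟨C * (2 * π), by positivity, fun t ξ => ?_⟩
  have := h t (fun x => (𝐞 (-Inner.inner ℝ x ξ) : ℂ)) (2 * π * ‖ξ‖) (by positivity) fun x y => by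
    have e : (𝐞 (-Inner.inner ℝ x ξ) : ℂ) = 𝐞 (-Inner.inner ℝ y ξ) * 𝐞 (-Inner.inner ℝ (x - y) ξ) := by
      rw [← Circle.coe_mul, ← AddChar.map_add_eq_mul, ← neg_add, ← inner_add_left,
        add_sub_cancel]
    rw [e, ← mul_sub_one, norm_mul, Circle.norm_coe, one_mul, Real.fourierChar_apply, mul_comm _ Complex.I]
    refine (Real.norm_exp_I_mul_ofReal_sub_one_le).trans ?_
    rw [Real.norm_eq_abs, abs_mul, abs_neg, abs_of_pos Real.two_pi_pos]
    have := abs_real_inner_le_norm (x - y) ξ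
    calc _ ≤ 2 * π * (‖x - y‖ * ‖ξ‖) := by gcongr
      _ = _ := by ring
  rw [Real.fourier_eq]
  calc _ = ‖∫ x : Euc (m + 2), den (t, x) • (𝐞 (-Inner.inner ℝ x ξ) : ℂ)‖ := by
        congr 2; funext x
        rw [Circle.smul_def, Complex.real_smul, smul_eq_mul, mul_comm]
    _ ≤ _ := this
    _ = _ := by ring

lemma integral_den (m : ℕ) (t : ℝ) : ∫ x : Euc (m + 2), den (t, x) = 0 := by
  obtain ⟨C, hC, h⟩ := integral_den_mul_le m
  have := h t (fun _ => 1) 0 le_rfl (by simp)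
  rw [mul_zero, zero_mul, norm_le_zero_iff] at this
  simp only [Complex.real_smul, mul_one] at this
  rw [integral_complex_ofReal] at this
  exact_mod_cast this

lemma den_hsNormE_le (m : ℕ) {s : ℝ} (hs : 0 < s) (hs2 : s < 2) :
    ∃ c : ℝ, 0 < c ∧ ∃ Chat : ℝ, 0 < Chat ∧ ∀ t ≥ (0 : ℝ),
      hsNormE (m + 2) (-s) (fun x => (den (t, x) : ℂ)) ≤
        ENNReal.ofReal (Chat * Real.exp (-(s * c * t))) := by
  obtain ⟨a, ha, h⟩ := norm_fourier_den_le m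
  obtain ⟨K, hK, hb⟩ := hsNormSqE_neg_le (d := m + 2) (by omega) hs hs2
    (V := volume.real (box (m + 2))) measureReal_nonneg
  set θ : ℝ := s / ((m + 2 : ℕ) + 2) with hθ
  have hθ0 : 0 < θ := by positivity
  refine ⟨Real.log 2 / 2 / ((m + 2 : ℕ) + 2), by have := Real.log_pos one_lt_two; positivity,
    (K ^ (1 / 2 : ℝ) + 1) * √2 ^ θ, by positivity, fun t ht => ?_⟩
  have h1 := hb ((den_slice_compact t).toSchwartzMap (den_slice_contDiff t)) (scale t) (scale_pos t)
    (scale_le_one t) (h t) (by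
      have : ∀ x : Euc (m + 2), ‖((den (t, x) : ℝ) : ℂ)‖ ^ 2 ≤
          (box (m + 2)).indicator (fun _ => (1 : ℝ)) x := fun x => by
        by_cases hx : x ∈ box (m + 2)
        · rw [indicator_of_mem hx, Complex.norm_real, Real.norm_eq_abs]
          have := den_abs_le (t, x)
          nlinarith [abs_nonneg (den (t, x))]
        · rw [indicator_of_notMem hx, den_eq_zero t hx]; simp
      have hi : Integrable ((box (m + 2)).indicator (fun _ : Euc (m + 2) => (1 : ℝ))) :=
        (integrable_indicator_iff (isClosed_box _).measurableSet).2
          (integrableOn_const (isCompact_box _).measure_lt_top.ne)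
      refine (integral_mono_of_nonneg (Eventually.of_forall fun x => by positivity) hi
        (Eventually.of_forall this)).trans (le_of_eq ?_)
      rw [integral_indicator (isClosed_box _).measurableSet]
      simp)
  have h2 : hsNormE (m + 2) (-s) (fun x => (den (t, x) : ℂ)) ≤
      ENNReal.ofReal (K * scale t ^ (2 * s / ((m + 2 : ℕ) + 2))) ^ (1 / 2 : ℝ) :=
    ENNReal.rpow_le_rpow h1 (by norm_num)
  have hsc := scale_pos t
  refine h2.trans ?_
  rw [ENNReal.ofReal_rpow_of_nonneg (by positivity) (by norm_num)]
  refine ENNReal.ofReal_le_ofReal ?_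
  rw [Real.mul_rpow hK (by positivity), ← Real.rpow_mul hsc.le]
  have e : 2 * s / (((m + 2 : ℕ) : ℝ) + 2) * (1 / 2) = θ := by rw [hθ]; ring
  rw [e]
  have h3 : scale t ^ θ ≤ √2 ^ θ * Real.exp (-(s * (Real.log 2 / 2 / ((m + 2 : ℕ) + 2)) * t)) := by
    calc _ ≤ (√2 * Real.exp (-(Real.log 2 / 2) * t)) ^ θ := by
          gcongr; exact scale_le_exp t
      _ = _ := by
        rw [Real.mul_rpow (by positivity) (by positivity), ← Real.exp_mul]
        congr 2; rw [hθ]; ring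
  calc _ ≤ (K ^ (1 / 2 : ℝ) + 1) *
        (√2 ^ θ * Real.exp (-(s * (Real.log 2 / 2 / ((m + 2 : ℕ) + 2)) * t))) := by
        gcongr; linarith
    _ = _ := by ring

/-! ### The kernel of the fractional Laplacian -/

section kernel

variable {d : ℕ}

/-- The kernel `‖h‖ ^ (-(d + r))`. -/
def ker (d : ℕ) (r : ℝ) (h : Euc d) : ℝ := ‖h‖ ^ (-((d : ℝ) + r))

lemma ker_nonneg (r : ℝ) (h : Euc d) : 0 ≤ ker d r h := by unfold ker; positivity

lemma measurable_ker (r : ℝ) : Measurable (ker d r) := measurable_norm.pow_const _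

lemma ker_smul (r : ℝ) {a : ℝ} (ha : 0 < a) (h : Euc d) :
    ker d r (a • h) = a ^ (-((d : ℝ) + r)) * ker d r h := by
  unfold ker
  rw [norm_smul, Real.norm_of_nonneg ha.le, Real.mul_rpow ha.le (norm_nonneg _)]

/-- The truncated kernel at length scale `μ`. -/
def trunc (d : ℕ) (r μ : ℝ) (h : Euc d) : ℝ := min 1 ((‖h‖ / μ) ^ 2) * ker d r h

lemma trunc_nonneg (r μ : ℝ) (h : Euc d) : 0 ≤ trunc d r μ h :=
  mul_nonneg (le_min zero_le_one (sq_nonneg _)) (ker_nonneg r h)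

lemma integrable_trunc_one (hd : 0 < d) {r : ℝ} (hr : 0 < r) (hr2 : r < 2) :
    Integrable (trunc d r 1) := by
  have : Nonempty (Fin d) := ⟨⟨0, hd⟩⟩
  have : Nontrivial (Euc d) := by infer_instance
  have hdim : Module.finrank ℝ (Euc d) = d := by simp
  have e : trunc d r 1 = fun h => (fun y : ℝ => min 1 ((y / 1) ^ 2) * y ^ (-((d : ℝ) + r))) ‖h‖ := rfl
  rw [e, integrable_fun_norm_addHaar (volume : Measure (Euc d))
    (f := fun y : ℝ => min 1 ((y / 1) ^ 2) * y ^ (-((d : ℝ) + r))), hdim]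
  have hpow : ∀ y : ℝ, 0 < y → ∀ a : ℝ, y ^ (d - 1) * (y ^ a * y ^ (-((d : ℝ) + r))) =
      y ^ (a - 1 - r) := fun y hy a => by
    rw [← Real.rpow_natCast, ← Real.rpow_add hy, ← Real.rpow_add hy, Nat.cast_sub hd]
    congr 1; push_cast; ring
  rw [← Ioc_union_Ioi_eq_Ioi (zero_le_one (α := ℝ))]
  refine IntegrableOn.union ?_ ?_
  · have h1 : IntegrableOn (fun y : ℝ => y ^ (2 - 1 - r)) (Ioc 0 1) :=
      (intervalIntegrable_iff_integrableOn_Ioc_of_le zero_le_one).1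
        (intervalIntegral.intervalIntegrable_rpow' (by linarith))
    refine h1.congr_fun (fun y hy => ?_) measurableSet_Ioc
    have : min 1 ((y / 1) ^ 2) = y ^ (2 : ℝ) := by
      rw [div_one, min_eq_right (by nlinarith [hy.1, hy.2]), ← Real.rpow_natCast]; norm_num
    rw [smul_eq_mul]; beta_reduce
    rw [this, hpow y hy.1]
  · have h1 : IntegrableOn (fun y : ℝ => y ^ (0 - 1 - r)) (Ioi 1) :=
      integrableOn_Ioi_rpow_of_lt (by linarith) one_pos
    refine h1.congr_fun (fun y hy => ?_) measurableSet_Ioi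
    have hy : 1 < y := hy
    have : min 1 ((y / 1) ^ 2) = y ^ (0 : ℝ) := by
      rw [div_one, min_eq_left (by nlinarith), Real.rpow_zero]
    rw [smul_eq_mul]; beta_reduce
    rw [this, hpow y (by linarith)]

lemma trunc_eq (r : ℝ) {μ : ℝ} (hμ : 0 < μ) :
    trunc d r μ = fun h => μ ^ (-((d : ℝ) + r)) * trunc d r 1 (μ⁻¹ • h) := by
  funext h
  unfold trunc
  rw [ker_smul r (inv_pos.2 hμ), norm_smul, Real.norm_of_nonneg (inv_pos.2 hμ).le, div_one,
    Real.inv_rpow hμ.le, div_eq_inv_mul]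
  have : μ ^ (-((d : ℝ) + r)) ≠ 0 := by positivity
  field_simp

lemma integrable_trunc (hd : 0 < d) {r μ : ℝ} (hr : 0 < r) (hr2 : r < 2) (hμ : 0 < μ) :
    Integrable (trunc d r μ) := by
  rw [trunc_eq r hμ]
  exact ((integrable_trunc_one hd hr hr2).comp_smul (inv_ne_zero hμ.ne')).const_mul _

lemma integral_trunc (r : ℝ) {μ : ℝ} (hμ : 0 < μ) :
    ∫ h, trunc d r μ h = μ ^ (-r) * ∫ h, trunc d r 1 h := by
  have hdim : Module.finrank ℝ (Euc d) = d := by simp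
  rw [trunc_eq r hμ, integral_const_mul, Measure.integral_comp_smul, hdim, smul_eq_mul,
    abs_of_pos (by positivity), inv_pow, inv_inv, ← mul_assoc, ← Real.rpow_natCast,
    ← Real.rpow_add hμ]
  congr 2; ring

/-- The symbol generated by the kernel. -/
def symb (d : ℕ) (r : ℝ) (ξ : Euc d) : ℝ :=
  ∫ h, (1 - Real.cos (2 * π * Inner.inner ℝ h ξ)) * ker d r h

lemma one_sub_cos_le (h ξ : Euc d) : 1 - Real.cos (2 * π * Inner.inner ℝ h ξ) ≤
    2 * π ^ 2 * (1 + ‖ξ‖ ^ 2) * min 1 ((‖h‖ / 1) ^ 2) := by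
  have h1 := Real.neg_one_le_cos (2 * π * Inner.inner ℝ h ξ)
  have h2 := Real.one_sub_sq_div_two_le_cos (x := 2 * π * Inner.inner ℝ h ξ)
  have h3 := abs_real_inner_le_norm h ξ
  have h4 : (Inner.inner ℝ h ξ : ℝ) ^ 2 ≤ (‖h‖ * ‖ξ‖) ^ 2 := sq_le_sq' (by
    linarith [neg_abs_le (Inner.inner ℝ h ξ : ℝ)]) ((le_abs_self _).trans h3)
  have hpi := Real.pi_gt_three
  rw [div_one]
  rcases le_total 1 (‖h‖ ^ 2) with h5 | h5
  · rw [min_eq_left h5]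
    nlinarith [sq_nonneg ‖ξ‖, mul_nonneg (sq_nonneg π) (sq_nonneg ‖ξ‖)]
  · rw [min_eq_right h5]
    have : 1 - Real.cos (2 * π * Inner.inner ℝ h ξ) ≤ 2 * π ^ 2 * (‖h‖ * ‖ξ‖) ^ 2 := by
      nlinarith [mul_le_mul_of_nonneg_left h4 (sq_nonneg π)]
    refine this.trans ?_
    have : 0 ≤ 2 * π ^ 2 * ‖h‖ ^ 2 := by positivity
    nlinarith

lemma one_sub_cos_mul_ker_le (r : ℝ) (h ξ : Euc d) :
    (1 - Real.cos (2 * π * Inner.inner ℝ h ξ)) * ker d r h ≤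
      2 * π ^ 2 * (1 + ‖ξ‖ ^ 2) * trunc d r 1 h := by
  unfold trunc
  rw [← mul_assoc]
  exact mul_le_mul_of_nonneg_right (one_sub_cos_le h ξ) (ker_nonneg r h)

lemma one_sub_cos_nonneg (x : ℝ) : 0 ≤ 1 - Real.cos x := sub_nonneg.2 (Real.cos_le_one x)

lemma measurable_symb_integrand (r : ℝ) : Measurable fun q : Euc d × Euc d =>
    (1 - Real.cos (2 * π * Inner.inner ℝ q.1 q.2)) * ker d r q.1 := by
  refine Measurable.mul ?_ ((measurable_ker r).comp measurable_fst)
  have : Continuous fun q : Euc d × Euc d => 1 - Real.cos (2 * π * Inner.inner ℝ q.1 q.2) := by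
    fun_prop
  exact this.measurable

lemma integrable_symb (hd : 0 < d) {r : ℝ} (hr : 0 < r) (hr2 : r < 2) (ξ : Euc d) :
    Integrable fun h => (1 - Real.cos (2 * π * Inner.inner ℝ h ξ)) * ker d r h :=
  ((integrable_trunc_one hd hr hr2).const_mul (2 * π ^ 2 * (1 + ‖ξ‖ ^ 2))).mono'
    ((measurable_symb_integrand r).comp (measurable_id.prodMk measurable_const)).aestronglyMeasurable
    (Eventually.of_forall fun h => by
      rw [Real.norm_of_nonneg (mul_nonneg (one_sub_cos_nonneg _) (ker_nonneg r h))]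
      exact one_sub_cos_mul_ker_le r h ξ)

lemma symb_isometry (r : ℝ) (L : Euc d ≃ₗᵢ[ℝ] Euc d) (ξ : Euc d) : symb d r (L ξ) = symb d r ξ := by
  unfold symb
  rw [← L.measurePreserving.integral_comp L.toHomeomorph.measurableEmbedding]
  simp only [LinearIsometryEquiv.inner_map_map, ker, LinearIsometryEquiv.norm_map]

lemma symb_smul (r : ℝ) {a : ℝ} (ha : 0 < a) (ξ : Euc d) :
    symb d r (a • ξ) = a ^ r * symb d r ξ := by
  have hdim : Module.finrank ℝ (Euc d) = d := by simp
  have e : ∀ h : Euc d, (1 - Real.cos (2 * π * Inner.inner ℝ h (a • ξ))) * ker d r h =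
      a ^ ((d : ℝ) + r) * (fun h => (1 - Real.cos (2 * π * Inner.inner ℝ h ξ)) * ker d r h) (a • h) := by
    intro h
    beta_reduce
    rw [ker_smul r ha, inner_smul_left, inner_smul_right, Real.rpow_neg ha.le]
    simp only [conj_trivial]
    field_simp
  unfold symb
  simp_rw [e]
  rw [integral_const_mul, Measure.integral_comp_smul volume
    (fun h : Euc d => (1 - Real.cos (2 * π * Inner.inner ℝ h ξ)) * ker d r h), hdim, smul_eq_mul,
    abs_of_pos (by positivity), ← mul_assoc, ← Real.rpow_natCast, ← Real.rpow_neg ha.le,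
    ← Real.rpow_add ha]
  congr 2; ring

lemma exists_isometry_map {x y : Euc d} (h : ‖x‖ = ‖y‖) : ∃ L : Euc d ≃ₗᵢ[ℝ] Euc d, L x = y :=
  ⟨(ℝ ∙ (x - y))ᗮ.reflection, Submodule.reflection_sub h⟩

lemma symb_eq (r : ℝ) (hr : 0 < r) {e : Euc d} (he : ‖e‖ = 1) (ξ : Euc d) :
    symb d r ξ = ‖ξ‖ ^ r * symb d r e := by
  rcases eq_or_ne ξ 0 with rfl | h0
  · rw [norm_zero, Real.zero_rpow hr.ne', zero_mul]
    simp [symb]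
  have hn := norm_pos_iff.2 h0
  obtain ⟨L, hL⟩ := exists_isometry_map (x := ξ) (y := ‖ξ‖ • e) (by
    rw [norm_smul, he, norm_norm, mul_one])
  rw [← symb_isometry r L, hL, symb_smul r hn]

lemma symb_pos (hd : 0 < d) {r : ℝ} (hr : 0 < r) (hr2 : r < 2) {e : Euc d} (he : ‖e‖ = 1) :
    0 < symb d r e := by
  unfold symb
  rw [integral_pos_iff_support_of_nonneg (fun h =>
    mul_nonneg (one_sub_cos_nonneg _) (ker_nonneg r h)) (integrable_symb hd hr hr2 e)]
  set U : Set (Euc d) := {h | 0 < (Inner.inner ℝ h e : ℝ)} ∩ {h | (Inner.inner ℝ h e : ℝ) < 1}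
  have hU : IsOpen U := (isOpen_lt continuous_const (by fun_prop)).inter
    (isOpen_lt (by fun_prop) continuous_const)
  have hne : U.Nonempty := ⟨(1 / 2 : ℝ) • e, by
    constructor <;> (simp [inner_smul_left, he]; try norm_num)⟩
  refine (hU.measure_pos volume hne).trans_le (measure_mono fun h hh => ?_)
  have h1 : (0 : ℝ) < Inner.inner ℝ h e := hh.1
  have h2 : (Inner.inner ℝ h e : ℝ) < 1 := hh.2
  have hpi := Real.two_pi_pos
  refine mul_ne_zero (fun hc => ?_) ?_
  · have : Real.cos (2 * π * Inner.inner ℝ h e) = 1 := by linarith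
    rw [Real.cos_eq_one_iff_of_lt_of_lt (by nlinarith) (by nlinarith)] at this
    have := mul_pos hpi h1
    linarith
  · unfold ker
    have : h ≠ 0 := by rintro rfl; simp at h1
    have := norm_pos_iff.2 this
    positivity

end kernel

/-! ### Sobolev norms of order less than two -/

section fractional

variable {d : ℕ}

open scoped SchwartzMap

/-- Half the negative symmetric second difference. -/
def diff2 (f : Euc d → ℂ) (h x : Euc d) : ℂ := f x - (1 / 2 : ℝ) • (f (x + h) + f (x - h))

lemma fourierInv_fourier_apply (f : 𝓢(Euc d, ℂ)) (x : Euc d) :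
    ∫ ξ, 𝐞 (Inner.inner ℝ ξ x) • 𝓕 f ξ = f x := by
  have := congrFun (f.continuous.fourierInv_fourier_eq f.integrable (𝓕 f).integrable) x
  rw [Real.fourierInv_eq] at this
  exact this

lemma cos_eq_fourierChar (y : ℝ) : ((Real.cos (2 * π * y) : ℝ) : ℂ) = (1 / 2 : ℝ) • ((𝐞 y : ℂ) + 𝐞 (-y)) := by
  rw [Real.fourierChar_apply, Real.fourierChar_apply, Complex.ofReal_cos, Complex.cos,
    Complex.real_smul]
  push_cast
  ring_nf

lemma integral_fourier_diff2 (f : 𝓢(Euc d, ℂ)) (h x : Euc d) :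
    ∫ ξ, 𝐞 (Inner.inner ℝ ξ x) • ((1 - Real.cos (2 * π * Inner.inner ℝ h ξ)) • 𝓕 f ξ) =
      diff2 f h x := by
  have hi : ∀ x, Integrable fun ξ => 𝐞 (Inner.inner ℝ ξ x) • 𝓕 f ξ := fun x => by
    refine (𝓕 f).integrable.mono ?_ (Eventually.of_forall fun ξ => by rw [Circle.norm_smul])
    have : Continuous fun ξ => 𝐞 (Inner.inner ℝ ξ x) • 𝓕 f ξ := by
      simp only [Circle.smul_def]
      exact (Continuous.subtype_val (Real.continuous_fourierChar.comp (by fun_prop))).smul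
        (𝓕 f).continuous
    exact this.aestronglyMeasurable
  have e : ∀ ξ, 𝐞 (Inner.inner ℝ ξ x) • ((1 - Real.cos (2 * π * Inner.inner ℝ h ξ)) • 𝓕 f ξ) =
      𝐞 (Inner.inner ℝ ξ x) • 𝓕 f ξ - (1 / 2 : ℝ) • (𝐞 (Inner.inner ℝ ξ (x + h)) • 𝓕 f ξ +
        𝐞 (Inner.inner ℝ ξ (x - h)) • 𝓕 f ξ) := fun ξ => by
    have hc := cos_eq_fourierChar (Inner.inner ℝ h ξ)
    rw [inner_add_right, inner_sub_right, sub_eq_add_neg (Inner.inner ℝ ξ x : ℝ), AddChar.map_add_eq_mul,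
      AddChar.map_add_eq_mul, real_inner_comm h ξ]
    simp only [Circle.smul_def, Circle.coe_mul, Complex.real_smul, smul_eq_mul] at hc ⊢
    rw [Complex.ofReal_sub, hc]
    push_cast
    ring
  simp_rw [e]
  have hi2 : Integrable fun ξ => (1 / 2 : ℝ) • (𝐞 (Inner.inner ℝ ξ (x + h)) • 𝓕 f ξ +
      𝐞 (Inner.inner ℝ ξ (x - h)) • 𝓕 f ξ) := ((hi _).add (hi _)).smul (1 / 2 : ℝ)
  rw [integral_sub (hi x) hi2, integral_smul, integral_add (hi _) (hi _)]
  simp only [fourierInv_fourier_apply]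
  rfl

lemma fracLap_eq (hd : 0 < d) {r : ℝ} (hr : 0 < r) (hr2 : r < 2) {e : Euc d} (he : ‖e‖ = 1)
    (f : 𝓢(Euc d, ℂ)) (x : Euc d) :
    symb d r e • 𝓕⁻ (fun ξ : Euc d => (‖ξ‖ ^ r : ℝ) • 𝓕 (f : Euc d → ℂ) ξ) x =
      ∫ h, ker d r h • diff2 f h x := by
  rw [Real.fourierInv_eq, ← integral_smul]
  have e1 : ∀ ξ, symb d r e • 𝐞 (Inner.inner ℝ ξ x) • ((‖ξ‖ ^ r : ℝ) • 𝓕 (f : Euc d → ℂ) ξ) =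
      ∫ h, ker d r h •
        𝐞 (Inner.inner ℝ ξ x) • ((1 - Real.cos (2 * π * Inner.inner ℝ h ξ)) • 𝓕 f ξ) := fun ξ => by
    have : ∀ h : Euc d, ker d r h •
        𝐞 (Inner.inner ℝ ξ x) • ((1 - Real.cos (2 * π * Inner.inner ℝ h ξ)) • 𝓕 f ξ) =
        ((1 - Real.cos (2 * π * Inner.inner ℝ h ξ)) * ker d r h) •
          (𝐞 (Inner.inner ℝ ξ x) • 𝓕 f ξ) := fun h => by
      simp only [Circle.smul_def, Complex.real_smul, smul_eq_mul]
      push_cast; ring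
    simp_rw [this]
    rw [integral_smul_const]
    change _ = symb d r ξ • _
    rw [symb_eq r hr he ξ, ← SchwartzMap.fourier_coe]
    simp only [Circle.smul_def, Complex.real_smul, smul_eq_mul]
    push_cast; ring
  simp_rw [e1]
  rw [integral_integral_swap]
  · congr 1; funext h
    rw [integral_smul, integral_fourier_diff2]
  · have hb : Integrable (fun q : Euc d × Euc d =>
        (2 * π ^ 2 * (‖𝓕 f q.1‖ + ‖q.1‖ ^ 2 * ‖𝓕 f q.1‖)) * trunc d r 1 q.2) (volume.prod volume) :=
      (((𝓕 f).integrable.norm.add ((𝓕 f).integrable_pow_mul volume 2)).const_mul _).mul_prod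
        (integrable_trunc_one hd hr hr2)
    refine hb.mono' ?_ (Eventually.of_forall fun q => ?_)
    · refine Measurable.aestronglyMeasurable ?_
      refine Measurable.smul ((measurable_ker r).comp measurable_snd) ?_
      have : Continuous fun q : Euc d × Euc d => 𝐞 (Inner.inner ℝ q.1 x) •
          ((1 - Real.cos (2 * π * Inner.inner ℝ q.2 q.1)) • 𝓕 f q.1) := by
        simp only [Circle.smul_def]
        have hc : Continuous fun q : Euc d × Euc d => (Inner.inner ℝ q.1 x : ℝ) := by fun_prop
        have hcos : Continuous fun q : Euc d × Euc d =>
            1 - Real.cos (2 * π * (Inner.inner ℝ q.2 q.1 : ℝ)) := by fun_prop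
        exact (Continuous.subtype_val (Real.continuous_fourierChar.comp hc)).smul
          (hcos.smul ((𝓕 f).continuous.comp continuous_fst))
      exact this.measurable
    · change ‖ker d r q.2 • 𝐞 (Inner.inner ℝ q.1 x) •
          ((1 - Real.cos (2 * π * Inner.inner ℝ q.2 q.1)) • 𝓕 f q.1)‖ ≤ _
      rw [norm_smul, Circle.norm_smul, norm_smul, Real.norm_of_nonneg (ker_nonneg _ _),
        Real.norm_of_nonneg (one_sub_cos_nonneg _)]
      have := mul_le_mul_of_nonneg_right (one_sub_cos_mul_ker_le r q.2 q.1) (norm_nonneg (𝓕 f q.1))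
      nlinarith

/-- A second difference is controlled by the sup norm and by the second derivative. -/
lemma norm_diff2_le {f : Euc d → ℂ} (hf : ContDiff ℝ ∞ f) {μ S T : ℝ} (hμ : 0 < μ)
    (hS : ∀ x, ‖f x‖ ≤ S * μ) (hT : ∀ x, ‖iteratedFDeriv ℝ 2 f x‖ ≤ T * μ⁻¹) (h x : Euc d) :
    ‖diff2 f h x‖ ≤ (2 * S + T) * μ * min 1 ((‖h‖ / μ) ^ 2) := by
  have hS0 : 0 ≤ S := by
    have := (norm_nonneg _).trans (hS 0)
    exact nonneg_of_mul_nonneg_left this hμ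
  have hT0 : 0 ≤ T := by
    have := (norm_nonneg _).trans (hT 0)
    exact nonneg_of_mul_nonneg_left this (inv_pos.2 hμ)
  have b1 : ‖diff2 f h x‖ ≤ 2 * S * μ := by
    unfold diff2
    refine (norm_sub_le _ _).trans ?_
    rw [norm_smul]
    have := norm_add_le (f (x + h)) (f (x - h))
    have e : ‖(1 / 2 : ℝ)‖ = 1 / 2 := by norm_num
    rw [e]
    linarith [hS x, hS (x + h), hS (x - h)]
  have b2 : ‖diff2 f h x‖ ≤ T * μ⁻¹ * ‖h‖ ^ 2 := by
    have hf1 : Differentiable ℝ f := hf.differentiable (by simp)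
    have hd : ContDiff ℝ ∞ (fderiv ℝ f) := hf.fderiv_right (by simp)
    have lip1 : ∀ y z, ‖fderiv ℝ f y - fderiv ℝ f z‖ ≤ T * μ⁻¹ * ‖y - z‖ := fun y z =>
      convex_univ.norm_image_sub_le_of_norm_fderiv_le
        (fun y _ => hd.differentiable (by simp) y) (fun y _ => by
          have := hT y
          rw [show (2 : ℕ) = 1 + 1 from rfl, ← norm_iteratedFDeriv_fderiv,
            norm_iteratedFDeriv_one] at this
          exact this) (mem_univ _) (mem_univ _)
    have lip2 := convex_univ.norm_image_sub_le_of_norm_hasFDerivWithin_le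
      (f := fun y => f (y + h) - f y) (f' := fun y => fderiv ℝ f (y + h) - fderiv ℝ f y)
      (C := T * μ⁻¹ * ‖h‖) (s := univ) (x := x - h) (y := x)
      (fun y _ => (((hasFDerivAt_comp_add_right h).2 (hf1 (y + h)).hasFDerivAt).sub
        (hf1 y).hasFDerivAt).hasFDerivWithinAt)
      (fun y _ => by simpa using lip1 (y + h) y) (mem_univ _) (mem_univ _)
    have e : diff2 f h x = -((1 / 2 : ℝ) • ((f (x + h) - f x) - (f (x - h + h) - f (x - h)))) := by
      unfold diff2
      rw [sub_add_cancel]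
      simp only [Complex.real_smul]
      push_cast; ring
    rw [e, norm_neg, norm_smul]
    have e2 : ‖(1 / 2 : ℝ)‖ = 1 / 2 := by norm_num
    rw [e2]
    simp only [sub_sub_cancel] at lip2
    have := norm_nonneg ((f (x + h) - f x) - (f (x - h + h) - f (x - h)))
    nlinarith
  rcases le_total 1 ((‖h‖ / μ) ^ 2) with h1 | h1
  · rw [min_eq_left h1, mul_one]
    have : 0 ≤ T * μ := by positivity
    linarith
  · rw [min_eq_right h1]
    have e : T * μ⁻¹ * ‖h‖ ^ 2 = T * μ * (‖h‖ / μ) ^ 2 := by field_simp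
    rw [e] at b2
    have : 0 ≤ 2 * S * μ * (‖h‖ / μ) ^ 2 := by positivity
    linarith

lemma Controlled.compact {A : ℕ → ℝ} {μ : ℝ} {f : Euc d → ℂ} (hf : Controlled A μ f) :
    HasCompactSupport f :=
  HasCompactSupport.intro (isCompact_box d) hf.supp

lemma Controlled.diff2_le {A : ℕ → ℝ} {μ : ℝ} (hμ : 0 < μ) {f : Euc d → ℂ}
    (hf : Controlled A μ f) (h x : Euc d) :
    ‖diff2 f h x‖ ≤ (2 * A 0 + A 2) * μ * min 1 ((‖h‖ / μ) ^ 2) := by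
  refine norm_diff2_le hf.smooth hμ (fun x => ?_) (fun x => ?_) h x
  · have := hf.bound 0 x
    rwa [norm_iteratedFDeriv_zero, pow_zero, mul_one] at this
  · refine (hf.bound 2 x).trans (le_of_eq ?_)
    field_simp

lemma Controlled.lintegral_diff2_le {A : ℕ → ℝ} {μ : ℝ} (hμ : 0 < μ) {f : Euc d → ℂ}
    (hf : Controlled A μ f) (h : Euc d) :
    ∫⁻ x, ENNReal.ofReal ‖diff2 f h x‖ ≤
      ENNReal.ofReal ((2 * A 0 + A 2) * μ * min 1 ((‖h‖ / μ) ^ 2)) * (3 * volume (box d)) := by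
  set c := ENNReal.ofReal ((2 * A 0 + A 2) * μ * min 1 ((‖h‖ / μ) ^ 2))
  set b : Set (Euc d) := box d ∪ ((· + h) ⁻¹' box d ∪ (· - h) ⁻¹' box d) with hb
  have hm : MeasurableSet (box d) := (isClosed_box d).measurableSet
  have hbm : MeasurableSet b := hm.union ((hm.preimage (by fun_prop)).union (hm.preimage (by fun_prop)))
  calc ∫⁻ x, ENNReal.ofReal ‖diff2 f h x‖ ≤ ∫⁻ x, b.indicator (fun _ => c) x := by
        refine lintegral_mono fun x => ?_
        by_cases hx : x ∈ b
        · rw [indicator_of_mem hx]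
          exact ENNReal.ofReal_le_ofReal (hf.diff2_le hμ h x)
        · simp only [hb, mem_union, not_or] at hx
          rw [diff2, hf.supp x hx.1, hf.supp _ hx.2.1, hf.supp _ hx.2.2]
          simp
    _ = c * volume b := by rw [lintegral_indicator hbm, setLIntegral_const]
    _ ≤ c * (3 * volume (box d)) := by
        gcongr
        refine (measure_union_le _ _).trans ?_
        refine (add_le_add le_rfl (measure_union_le _ _)).trans (le_of_eq ?_)
        rw [measure_preimage_add_right]
        simp only [sub_eq_add_neg]
        rw [measure_preimage_add_right]
        ring

/-- `L^p` bound from `L^∞` and `L^1` bounds. -/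
lemma eLpNorm_le_of_bounds {g : Euc d → ℂ} {p : ℝ} (hp : 1 < p) {S : ℝ} (hS : 0 ≤ S) {V : ℝ}
    (hV : 0 ≤ V) (h1 : ∀ x, ‖g x‖ ≤ S)
    (h2 : ∫⁻ x, ENNReal.ofReal ‖g x‖ ≤ ENNReal.ofReal (S * V)) :
    eLpNorm g (ENNReal.ofReal p) volume ≤ ENNReal.ofReal (S * V ^ (1 / p)) := by
  have hp0 : 0 < p := by linarith
  rw [eLpNorm_eq_lintegral_rpow_enorm_toReal (by simpa using hp0) ENNReal.ofReal_ne_top,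
    ENNReal.toReal_ofReal hp0.le]
  have : ∫⁻ x, ‖g x‖ₑ ^ p ≤ ENNReal.ofReal (S ^ p * V) := by
    calc ∫⁻ x, ‖g x‖ₑ ^ p ≤ ∫⁻ x, ENNReal.ofReal (S ^ (p - 1)) * ENNReal.ofReal ‖g x‖ := by
          refine lintegral_mono fun x => ?_
          rw [← ENNReal.ofReal_mul (by positivity), ← ofReal_norm,
            ENNReal.ofReal_rpow_of_nonneg (norm_nonneg _) hp0.le]
          refine ENNReal.ofReal_le_ofReal ?_
          rcases eq_or_lt_of_le (norm_nonneg (g x)) with h0 | h0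
          · rw [← h0, Real.zero_rpow hp0.ne', mul_zero]
          · calc ‖g x‖ ^ p = ‖g x‖ ^ (p - 1) * ‖g x‖ := by
                  rw [← Real.rpow_add_one h0.ne', sub_add_cancel]
              _ ≤ _ := by
                gcongr
                exact h1 x
      _ = ENNReal.ofReal (S ^ (p - 1)) * ∫⁻ x, ENNReal.ofReal ‖g x‖ :=
          lintegral_const_mul' _ _ ENNReal.ofReal_ne_top
      _ ≤ ENNReal.ofReal (S ^ (p - 1)) * ENNReal.ofReal (S * V) := by gcongr
      _ = ENNReal.ofReal (S ^ p * V) := by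
          rw [← ENNReal.ofReal_mul (by positivity), ← mul_assoc]
          rcases eq_or_lt_of_le hS with h0 | h0
          · rw [← h0, mul_zero, Real.zero_rpow hp0.ne']
          · rw [← Real.rpow_add_one h0.ne', sub_add_cancel]
  refine (ENNReal.rpow_le_rpow this (by positivity)).trans (le_of_eq ?_)
  rw [ENNReal.ofReal_rpow_of_nonneg (by positivity) (by positivity),
    Real.mul_rpow (by positivity) hV, ← Real.rpow_mul hS, mul_one_div_cancel hp0.ne', Real.rpow_one]

lemma wspNormE_le_of_lt_two (hd : 0 < d) {r : ℝ} (hr : 0 < r) (hr2 : r < 2) {p : ℝ} (hp : 1 < p)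
    (A : ℕ → ℝ) (hA : ∀ k, 0 ≤ A k) : ∃ C, 0 ≤ C ∧ ∀ μ, 0 < μ → ∀ f : Euc d → ℂ,
      Controlled A μ f → wspNormE d r p f ≤ ENNReal.ofReal (C * μ ^ (1 - r)) := by
  set e : Euc d := EuclideanSpace.single ⟨0, hd⟩ 1
  have he : ‖e‖ = 1 := by simp [e]
  have hc := symb_pos hd hr hr2 he
  set c := symb d r e
  set J := ∫ h, trunc d r 1 h with hJ
  have hJ0 : 0 ≤ J := integral_nonneg (trunc_nonneg r 1)
  set V : ℝ := 3 * volume.real (box d)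
  have hV : 0 ≤ V := by positivity
  have hA0 := hA 0
  have hA2 := hA 2
  refine ⟨c⁻¹ * (2 * A 0 + A 2) * J * V ^ (1 / p), by positivity, fun μ hμ f hf => ?_⟩
  set g := 𝓕⁻ (fun ξ : Euc d => (‖ξ‖ ^ r : ℝ) • 𝓕 f ξ) with hg
  set F : 𝓢(Euc d, ℂ) := hf.compact.toSchwartzMap hf.smooth
  have rep : ∀ x, g x = c⁻¹ • ∫ h, ker d r h • diff2 f h x := fun x => by
    rw [eq_inv_smul_iff₀ hc.ne']
    exact fracLap_eq hd hr hr2 he F x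
  set S : ℝ := c⁻¹ * ((2 * A 0 + A 2) * J) * μ ^ (1 - r) with hS
  have hS0 : 0 ≤ S := by positivity
  have hμr : μ * μ ^ (-r) = μ ^ (1 - r) := by
    rw [sub_eq_add_neg, Real.rpow_add hμ, Real.rpow_one]
  have hpt : ∀ h x, ‖ker d r h • diff2 f h x‖ ≤ (2 * A 0 + A 2) * μ * trunc d r μ h := fun h x => by
    rw [norm_smul, Real.norm_of_nonneg (ker_nonneg r h), trunc, mul_comm, ← mul_assoc]
    exact mul_le_mul_of_nonneg_right (hf.diff2_le hμ h x) (ker_nonneg r h)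
  have hit := (integrable_trunc hd hr hr2 hμ).const_mul ((2 * A 0 + A 2) * μ)
  have htot : ∫ h, (2 * A 0 + A 2) * μ * trunc d r μ h = (2 * A 0 + A 2) * J * μ ^ (1 - r) := by
    rw [integral_const_mul, integral_trunc r hμ, ← hJ, ← hμr]; ring
  have b1 : ∀ x, ‖g x‖ ≤ S := fun x => by
    rw [rep, norm_smul, Real.norm_of_nonneg (inv_pos.2 hc).le, hS, mul_assoc]
    refine mul_le_mul_of_nonneg_left ?_ (inv_pos.2 hc).le
    rw [← htot]
    exact norm_integral_le_of_norm_le hit (Eventually.of_forall fun h => hpt h x)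
  have hfc := hf.smooth.continuous
  have b2 : ∫⁻ x, ENNReal.ofReal ‖g x‖ ≤ ENNReal.ofReal (S * V) := by
    have hmeas : Measurable fun q : Euc d × Euc d =>
        ENNReal.ofReal (ker d r q.2) * ENNReal.ofReal ‖diff2 f q.2 q.1‖ := by
      refine Measurable.mul ((measurable_ker r).comp measurable_snd).ennreal_ofReal ?_
      refine Measurable.ennreal_ofReal (Measurable.norm ?_)
      have : Continuous fun q : Euc d × Euc d => diff2 f q.2 q.1 := by
        unfold diff2; fun_prop
      exact this.measurable
    calc ∫⁻ x, ENNReal.ofReal ‖g x‖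
        ≤ ∫⁻ x, ENNReal.ofReal c⁻¹ *
            ∫⁻ h, ENNReal.ofReal (ker d r h) * ENNReal.ofReal ‖diff2 f h x‖ := by
          refine lintegral_mono fun x => ?_
          rw [rep, norm_smul, Real.norm_of_nonneg (inv_pos.2 hc).le,
            ENNReal.ofReal_mul (inv_pos.2 hc).le, ofReal_norm]
          gcongr
          refine (enorm_integral_le_lintegral_enorm _).trans (lintegral_mono fun h => ?_)
          rw [← ofReal_norm, norm_smul, Real.norm_of_nonneg (ker_nonneg r h),
            ENNReal.ofReal_mul (ker_nonneg r h)]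
      _ = ENNReal.ofReal c⁻¹ * ∫⁻ h, ENNReal.ofReal (ker d r h) *
            ∫⁻ x, ENNReal.ofReal ‖diff2 f h x‖ := by
          rw [lintegral_const_mul' _ _ ENNReal.ofReal_ne_top,
            lintegral_lintegral_swap hmeas.aemeasurable]
          congr 2; funext h
          rw [lintegral_const_mul' _ _ ENNReal.ofReal_ne_top]
      _ ≤ ENNReal.ofReal c⁻¹ * ∫⁻ h, ENNReal.ofReal ((2 * A 0 + A 2) * μ * trunc d r μ h) *
            ENNReal.ofReal V := by
          refine mul_le_mul_right (lintegral_mono fun h => ?_) _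
          refine (mul_le_mul_right (hf.lintegral_diff2_le hμ h) _).trans (le_of_eq ?_)
          have hVe : 3 * volume (box d) = ENNReal.ofReal V := by
            rw [ENNReal.ofReal_mul (by norm_num), measureReal_def,
              ENNReal.ofReal_toReal (isCompact_box d).measure_lt_top.ne]
            simp
          have hm : 0 ≤ min 1 ((‖h‖ / μ) ^ 2) := le_min zero_le_one (sq_nonneg _)
          rw [hVe, ← mul_assoc, ← ENNReal.ofReal_mul (ker_nonneg r h)]
          congr 2
          unfold trunc; ring
      _ = ENNReal.ofReal (S * V) := by
          rw [lintegral_mul_const' _ _ ENNReal.ofReal_ne_top,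
            ← ofReal_integral_eq_lintegral_ofReal hit (Eventually.of_forall fun h =>
              mul_nonneg (by positivity) (trunc_nonneg r μ h)), htot,
            ← ENNReal.ofReal_mul (by positivity), ← ENNReal.ofReal_mul (inv_pos.2 hc).le, hS]
          congr 1; ring
  refine (eLpNorm_le_of_bounds hp hS0 hV b1 b2).trans (le_of_eq ?_)
  rw [hS]; congr 1; ring

end fractional

/-! ### Sobolev norms of arbitrary order -/

section higher

variable {d : ℕ}

open scoped SchwartzMap LineDeriv Laplacian

lemma Controlled.dirDeriv {A : ℕ → ℝ} {μ : ℝ} (hμ : 0 < μ) {f : Euc d → ℂ}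
    (hf : Controlled A μ f) {v : Euc d} (hv : ‖v‖ ≤ 1) :
    Controlled (fun k => A (k + 1)) μ fun x => μ • fderiv ℝ f x v := by
  have hs : ContDiff ℝ ∞ (fderiv ℝ f) := hf.smooth.fderiv_right (by simp)
  set L : (Euc d →L[ℝ] ℂ) →L[ℝ] ℂ := μ • ContinuousLinearMap.apply ℝ ℂ v
  have hL : ‖L‖ ≤ μ := by
    refine ContinuousLinearMap.opNorm_le_bound _ hμ.le fun B => ?_
    change ‖μ • B v‖ ≤ _
    rw [norm_smul, Real.norm_of_nonneg hμ.le]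
    have := B.le_opNorm v
    have h2 := norm_nonneg B
    gcongr
    nlinarith
  refine ⟨L.contDiff.comp hs, fun x hx => ?_, fun k x => ?_⟩
  · have : f =ᶠ[𝓝 x] fun _ => 0 :=
      Filter.eventually_of_mem ((isClosed_box d).isOpen_compl.mem_nhds hx) fun y hy => hf.supp y hy
    rw [this.fderiv_eq]
    simp
  · change ‖iteratedFDeriv ℝ k (L ∘ fderiv ℝ f) x‖ ≤ _
    refine (L.norm_iteratedFDeriv_comp_left (n := k) hs.contDiffAt
      (by exact_mod_cast le_top)).trans ?_
    rw [norm_iteratedFDeriv_fderiv]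
    have h1 := hf.bound (k + 1) x
    have h2 := norm_nonneg (iteratedFDeriv ℝ (k + 1) f x)
    calc ‖L‖ * ‖iteratedFDeriv ℝ (k + 1) f x‖ ≤ μ * (A (k + 1) * (μ * μ⁻¹ ^ (k + 1))) := by
          gcongr
      _ = (μ * μ⁻¹) * (A (k + 1) * (μ * μ⁻¹ ^ k)) := by rw [pow_succ]; ring
      _ = _ := by rw [mul_inv_cancel₀ hμ.ne', one_mul]

lemma Controlled.sum {A : ℕ → ℝ} {μ : ℝ} {f : Fin d → Euc d → ℂ}
    (hf : ∀ i, Controlled A μ (f i)) :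
    Controlled (fun k => d * A k) μ fun x => ∑ i, f i x := by
  refine ⟨ContDiff.sum fun i _ => (hf i).smooth, fun x hx =>
    Finset.sum_eq_zero fun i _ => (hf i).supp x hx, fun k x => ?_⟩
  rw [iteratedFDeriv_sum fun i _ => (hf i).smooth.of_le (by exact_mod_cast le_top),
    Finset.sum_apply]
  refine (norm_sum_le _ _).trans ((Finset.sum_le_sum fun i _ => (hf i).bound k x).trans ?_)
  simp [mul_assoc]

/-- The rescaled Laplacian of a controlled function is controlled. -/
lemma Controlled.laplacian {A : ℕ → ℝ} {μ : ℝ} (hμ : 0 < μ) {F : 𝓢(Euc d, ℂ)}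
    (hf : Controlled A μ F) :
    Controlled (fun k => d * A (k + 2)) μ ((μ ^ 2) • Δ F : 𝓢(Euc d, ℂ)) := by
  set b := EuclideanSpace.basisFun (Fin d) ℝ
  have h : ∀ i, Controlled (fun k => A (k + 2)) μ
      fun x => μ • fderiv ℝ (fun x => μ • fderiv ℝ F x (b i)) x (b i) := fun i =>
    (hf.dirDeriv hμ (b.norm_eq_one i).le).dirDeriv hμ (b.norm_eq_one i).le
  convert Controlled.sum h using 1
  funext x
  rw [SchwartzMap.laplacian_eq_sum b]
  simp only [smul_apply, sum_apply, Finset.smul_sum]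
  refine Finset.sum_congr rfl fun i _ => ?_
  have e : (fun x => μ • fderiv ℝ F x (b i)) = μ • ⇑(∂_{b i} F : 𝓢(Euc d, ℂ)) := by
    funext x
    rw [Pi.smul_apply, SchwartzMap.lineDerivOp_apply_eq_fderiv]
  rw [e, fderiv_const_smul (SchwartzMap.differentiableAt _), SchwartzMap.lineDerivOp_apply_eq_fderiv,
    smul_apply, smul_smul, sq]

lemma fourier_laplacian (F : 𝓢(Euc d, ℂ)) (ξ : Euc d) :
    𝓕 (Δ F) ξ = (-(2 * π) ^ 2) • (‖ξ‖ ^ 2 : ℝ) • 𝓕 F ξ := by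
  rw [SchwartzMap.laplacian_eq_fourierMultiplierCLM, FourierTransform.fourier_smul,
    SchwartzMap.fourierMultiplierCLM_apply, FourierTransform.fourier_fourierInv_eq,
    smul_apply, SchwartzMap.smulLeftCLM_apply_apply (by fun_prop)]

/-- The Laplacian trades two orders of differentiability. -/
lemma wspNormE_add_two {r : ℝ} (hr : 0 ≤ r) (p : ℝ) {μ : ℝ} (hμ : 0 < μ) (F : 𝓢(Euc d, ℂ)) :
    wspNormE d (r + 2) p F = ENNReal.ofReal (((2 * π) ^ 2)⁻¹ * (μ ^ 2)⁻¹) *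
      wspNormE d r p ((μ ^ 2) • Δ F : 𝓢(Euc d, ℂ)) := by
  set κ : ℝ := -(((2 * π) ^ 2)⁻¹ * (μ ^ 2)⁻¹)
  have hpi := Real.pi_pos
  have e : (fun ξ : Euc d => (‖ξ‖ ^ (r + 2) : ℝ) • 𝓕 (F : Euc d → ℂ) ξ) = fun ξ => κ •
      ((‖ξ‖ ^ r : ℝ) • 𝓕 (((μ ^ 2) • Δ F : 𝓢(Euc d, ℂ)) : Euc d → ℂ) ξ) := by
    funext ξ
    rw [← SchwartzMap.fourier_coe, ← SchwartzMap.fourier_coe, FourierTransform.fourier_smul,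
      smul_apply, fourier_laplacian, smul_smul, smul_smul, smul_smul, smul_smul,
      Real.rpow_add' (norm_nonneg ξ) (by linarith), Real.rpow_two]
    congr 1
    simp only [κ]
    field_simp
  have e2 : 𝓕⁻ (fun ξ : Euc d => (‖ξ‖ ^ (r + 2) : ℝ) • 𝓕 (F : Euc d → ℂ) ξ) = κ • 𝓕⁻
      (fun ξ : Euc d => (‖ξ‖ ^ r : ℝ) • 𝓕 (((μ ^ 2) • Δ F : 𝓢(Euc d, ℂ)) : Euc d → ℂ) ξ) := by
    rw [e]
    funext x
    rw [Pi.smul_apply, Real.fourierInv_eq, Real.fourierInv_eq, ← integral_smul]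
    congr 1; funext ξ
    rw [smul_comm]
  unfold wspNormE
  rw [e2, eLpNorm_const_smul, ← ofReal_norm]
  congr 2
  rw [norm_neg, Real.norm_of_nonneg (by positivity)]

lemma wspNormE_zero_le {p : ℝ} (hp : 1 < p) (A : ℕ → ℝ) (hA : ∀ k, 0 ≤ A k) {μ : ℝ} (hμ : 0 < μ)
    {f : Euc d → ℂ} (hf : Controlled A μ f) :
    wspNormE d 0 p f ≤
      ENNReal.ofReal (A 0 * volume.real (box d) ^ (1 / p) * μ ^ (1 - 0 : ℝ)) := by
  set F : 𝓢(Euc d, ℂ) := hf.compact.toSchwartzMap hf.smooth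
  have e : 𝓕⁻ (fun ξ : Euc d => (‖ξ‖ ^ (0 : ℝ) : ℝ) • 𝓕 f ξ) = f := by
    simp only [Real.rpow_zero, one_smul]
    exact F.continuous.fourierInv_fourier_eq F.integrable (𝓕 F).integrable
  have b1 : ∀ x, ‖f x‖ ≤ A 0 * μ := fun x => by
    have := hf.bound 0 x
    rwa [norm_iteratedFDeriv_zero, pow_zero, mul_one] at this
  have hS : 0 ≤ A 0 * μ := mul_nonneg (hA 0) hμ.le
  unfold wspNormE
  rw [e]
  refine (eLpNorm_le_of_bounds hp hS (measureReal_nonneg (μ := volume) (s := box d)) b1 ?_).trans (le_of_eq ?_)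
  · calc ∫⁻ x, ENNReal.ofReal ‖f x‖
        ≤ ∫⁻ x, (box d).indicator (fun _ => ENNReal.ofReal (A 0 * μ)) x := by
          refine lintegral_mono fun x => ?_
          by_cases hx : x ∈ box d
          · rw [indicator_of_mem hx]
            exact ENNReal.ofReal_le_ofReal (b1 x)
          · rw [hf.supp x hx]; simp
      _ = ENNReal.ofReal (A 0 * μ * volume.real (box d)) := by
          rw [lintegral_indicator (isClosed_box d).measurableSet, setLIntegral_const,
            ENNReal.ofReal_mul hS, measureReal_def,
            ENNReal.ofReal_toReal (isCompact_box d).measure_lt_top.ne]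
  · rw [sub_zero, Real.rpow_one]; congr 1; ring

/-- Homogeneous Sobolev norms of controlled functions scale like powers of the length scale. -/
lemma wspNormE_le (hd : 0 < d) {r : ℝ} (hr : 0 ≤ r) {p : ℝ} (hp : 1 < p) (A : ℕ → ℝ)
    (hA : ∀ k, 0 ≤ A k) : ∃ C, 0 ≤ C ∧ ∀ μ, 0 < μ → ∀ f : Euc d → ℂ,
      Controlled A μ f → wspNormE d r p f ≤ ENNReal.ofReal (C * μ ^ (1 - r)) := by
  obtain ⟨n, hn⟩ := exists_nat_gt (r / 2)
  induction n generalizing r A with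
  | zero => exact absurd hn (by push_cast; linarith)
  | succ n ih =>
    rcases eq_or_lt_of_le hr with rfl | hr0
    · exact ⟨A 0 * volume.real (box d) ^ (1 / p), mul_nonneg (hA 0) (by positivity),
        fun μ hμ f hf => wspNormE_zero_le hp A hA hμ hf⟩
    rcases lt_or_ge r 2 with hr2 | hr2
    · exact wspNormE_le_of_lt_two hd hr0 hr2 hp A hA
    have hn' : (r - 2) / 2 < n := by push_cast at hn; linarith
    obtain ⟨C, hC, h⟩ := ih (sub_nonneg.2 hr2) (fun k => d * A (k + 2))
      (fun k => mul_nonneg (Nat.cast_nonneg d) (hA _)) hn'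
    refine ⟨((2 * π) ^ 2)⁻¹ * C, by positivity, fun μ hμ f hf => ?_⟩
    set F : 𝓢(Euc d, ℂ) := hf.compact.toSchwartzMap hf.smooth
    have hF : Controlled A μ F := hf
    have := wspNormE_add_two (sub_nonneg.2 hr2) p hμ F
    rw [sub_add_cancel] at this
    change wspNormE d r p F ≤ _
    rw [this]
    refine (mul_le_mul_right (h μ hμ _ (hF.laplacian hμ)) _).trans (le_of_eq ?_)
    rw [← ENNReal.ofReal_mul (by positivity)]
    congr 1
    have : μ ^ (1 - r) = μ ^ (1 - (r - 2)) * (μ ^ 2)⁻¹ := by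
      rw [← Real.rpow_natCast, ← Real.rpow_neg hμ.le, ← Real.rpow_add hμ]
      congr 1; push_cast; ring
    rw [this]; ring

end higher

lemma scale_rpow_le {r t : ℝ} (ht : 0 ≤ t) :
    scale t ^ (1 - r) ≤ √2 ^ |1 - r| * Real.exp ((r - 1) * (Real.log 2 / 2) * t) := by
  have h2 : (1 : ℝ) ≤ √2 := Real.one_le_sqrt.2 (by norm_num)
  have he : Real.exp (-(Real.log 2 / 2) * t) ^ (1 - r) =
      Real.exp ((r - 1) * (Real.log 2 / 2) * t) := by
    rw [← Real.exp_mul]; congr 1; ring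
  rcases le_total r 1 with hr | hr
  · rw [abs_of_nonneg (by linarith), ← he, ← Real.mul_rpow (by positivity) (Real.exp_pos _).le]
    exact Real.rpow_le_rpow (scale_pos t).le (scale_le_exp t) (by linarith)
  · rw [← he]
    refine (Real.rpow_le_rpow_of_nonpos (Real.exp_pos _) (exp_le_scale ht) (by linarith)).trans ?_
    exact le_mul_of_one_le_left (by positivity) (Real.one_le_rpow h2 (abs_nonneg _))

lemma vel_wspNormE_le (m : ℕ) {r : ℝ} (hr : 0 ≤ r) {p : ℝ} (hp : 1 < p) :
    ∃ b : ℝ, 0 < b ∧ ∃ B : ℝ, 0 < B ∧ ∀ t ≥ (0 : ℝ),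
      ∑ i, wspNormE (m + 2) r p (fun x => (vel (t, x) i : ℂ)) ≤
        ENNReal.ofReal (B * Real.exp ((r - 1) * b * t)) := by
  obtain ⟨A, hA, hv⟩ := vel_controlled m
  obtain ⟨C, hC, h⟩ := wspNormE_le (d := m + 2) (by omega) hr hp A hA
  refine ⟨Real.log 2 / 2, by have := Real.log_pos one_lt_two; linarith,
    (m + 2 : ℕ) * (C * √2 ^ |1 - r|) + 1, by positivity, fun t ht => ?_⟩
  calc ∑ i, wspNormE (m + 2) r p (fun x => (vel (t, x) i : ℂ))
      ≤ ∑ _i : Fin (m + 2), ENNReal.ofReal (C * scale t ^ (1 - r)) :=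
        Finset.sum_le_sum fun i _ => h _ (scale_pos t) _ (hv t i)
    _ = ENNReal.ofReal ((m + 2 : ℕ) * (C * scale t ^ (1 - r))) := by
        rw [ENNReal.ofReal_mul (Nat.cast_nonneg _), ENNReal.ofReal_natCast]
        simp
    _ ≤ _ := by
        refine ENNReal.ofReal_le_ofReal ?_
        have h1 := mul_le_mul_of_nonneg_left (mul_le_mul_of_nonneg_left
          (scale_rpow_le (r := r) ht) hC) (Nat.cast_nonneg (α := ℝ) (m + 2))
        have h2 := Real.exp_pos ((r - 1) * (Real.log 2 / 2) * t)
        linarith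

end Mixer

/-- **An example of exponential mixing.**
For `d ≥ 2` there exist a smooth velocity field `u` and a smooth nontrivial solution `ρ` of
the continuity equation such that: `u(t,·)` is bounded, divergence-free and compactly
supported in the unit cube `Q`; `ρ(t,·)` has zero average and is bounded and compactly
supported in `Q`; `u(t,·)` is Lipschitz uniformly in time; for all `r ≥ 0`, `1 < p < ∞`
one has `‖u(t,·)‖_{Ẇ^{r,p}} ≤ B_r exp((r-1) b t)`; and for all `0 < s < 2` one has
`‖ρ(t,·)‖_{Ḣ^{-s}} ≤ Chat_s exp(-s c t)`. -/
theorem exponential_mixing (d : ℕ) (hd : 2 ≤ d) :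
    ∃ (u : ℝ → Euc d → Euc d) (ρ : ℝ → Euc d → ℝ),
      -- u, ρ ∈ C^∞([0,∞) × ℝ^d)
      ContDiffOn ℝ (⊤ : ℕ∞) (fun q : ℝ × Euc d => u q.1 q.2) {q : ℝ × Euc d | 0 ≤ q.1} ∧
      ContDiffOn ℝ (⊤ : ℕ∞) (fun q : ℝ × Euc d => ρ q.1 q.2) {q : ℝ × Euc d | 0 ≤ q.1} ∧
      -- ρ is a nontrivial solution of the continuity equation with velocity u
      (∃ x : Euc d, ρ 0 x ≠ 0) ∧
      IsWeakSol d u ρ ∧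
      -- (i) u(t,·) is bounded, divergence-free, compactly supported in Q
      (∃ M : ℝ, ∀ t ≥ (0:ℝ), ∀ x, ‖u t x‖ ≤ M) ∧
      (∀ t ≥ (0:ℝ), WeakDivFree d (u t)) ∧
      (∀ t ≥ (0:ℝ), tsupport (u t) ⊆ unitCube d) ∧
      -- (ii) ρ(t,·) has zero average, is bounded, compactly supported in Q
      (∀ t ≥ (0:ℝ), ∫ x : Euc d, ρ t x = 0) ∧
      (∃ M : ℝ, ∀ t ≥ (0:ℝ), ∀ x, |ρ t x| ≤ M) ∧
      (∀ t ≥ (0:ℝ), tsupport (ρ t) ⊆ unitCube d) ∧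
      -- (iii) u(t,·) is Lipschitz uniformly in time
      (∃ L : ℝ≥0, ∀ t ≥ (0:ℝ), LipschitzWith L (u t)) ∧
      -- (iv) exponential bounds on the Ẇ^{r,p} norms of u
      (∀ r : ℝ, 0 ≤ r → ∀ p : ℝ, 1 < p →
        ∃ b : ℝ, 0 < b ∧ ∃ B : ℝ, 0 < B ∧ ∀ t ≥ (0:ℝ),
          wspNormVecE d r p (u t) ≤ ENNReal.ofReal (B * Real.exp ((r - 1) * b * t))) ∧
      -- (v) exponential decay of the Ḣ^{-s} norms of ρ
      (∀ s : ℝ, 0 < s → s < 2 →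
        ∃ c : ℝ, 0 < c ∧ ∃ Chat : ℝ, 0 < Chat ∧ ∀ t ≥ (0:ℝ),
          hsNormE d (-s) (fun x => (ρ t x : ℂ)) ≤
            ENNReal.ofReal (Chat * Real.exp (-(s * c * t)))) := by
  obtain ⟨m, rfl⟩ := Nat.exists_eq_add_of_le' hd
  obtain ⟨M, hM⟩ := Mixer.vel_norm_le m
  obtain ⟨L, hL⟩ := Mixer.vel_lipschitz m
  exact ⟨fun t x => Mixer.vel (t, x), fun t x => Mixer.den (t, x),
    Mixer.vel_contDiff.contDiffOn, Mixer.den_contDiff.contDiffOn, Mixer.den_ne_zero,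
    fun φ hφ hc _ => Mixer.den_weak φ hφ hc, ⟨M, fun t _ => hM t⟩,
    fun t _ ψ hψ hc => Mixer.vel_divFree t ψ hψ hc,
    fun t _ => (Mixer.tsupport_vel_subset t).trans (Mixer.box_subset_unitCube _),
    fun t _ => Mixer.integral_den m t, ⟨1, fun t _ x => Mixer.den_abs_le (t, x)⟩,
    fun t _ => (Mixer.tsupport_den_subset t).trans (Mixer.box_subset_unitCube _),
    ⟨L, fun t _ => hL t⟩, fun r hr p hp => Mixer.vel_wspNormE_le m hr hp,
    fun s hs hs2 => Mixer.den_hsNormE_le m hs hs2⟩
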